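/- Fix a rational α ∈ (0,1/2). Then the limits below exist and lim_{d→∞} lim_{N→∞} ( E_{R(N,d)}[MCUT_α] − N d α(1−α) ) / (√d · N) = lim_{N→∞} (1/(4N)) E[ max_{σ ∈ S_N(α)} H_1(σ) ], where N ranges over integers with αN an integer and Nd even. -/

import Mathlib

open Finset MeasureTheory

noncomputable section

/-- Number of edges of a simple graph on `Fin N`. -/
def numEdges {N : ℕ} (G : SimpleGraph (Fin N)) : ℕ := Nat.card G.edgeSet

/-- Number of edges of `G` with exactly one endpoint in `s` (counted as ordered pairs
with the first coordinate in `s`, so each crossing edge is counted once). -/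
def cutCount {N : ℕ} (G : SimpleGraph (Fin N)) (s : Finset (Fin N)) : ℕ :=
  Nat.card {p : Fin N × Fin N // p.1 ∈ s ∧ p.2 ∉ s ∧ G.Adj p.1 p.2}

/-- `MCUT_α(G)`: the maximum over vertex sets `V₁` of size `αN` of the number of
edges of `G` with exactly one endpoint in `V₁`. -/
def mcut {N : ℕ} (α : ℚ) (G : SimpleGraph (Fin N)) : ℕ :=
  (Finset.powersetCard ⌊α * (N : ℚ)⌋₊ (Finset.univ : Finset (Fin N))).sup fun s => cutCount G s

/-- `α N` is a (nonnegative) integer. -/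
def alphaIntegral (α : ℚ) (N : ℕ) : Prop := ∃ k : ℕ, α * (N : ℚ) = (k : ℚ)

/-- Expectation of `f` under the Erdős–Rényi measure `G(N,p)`: each potential edge is
present independently with probability `p`, so a graph with `e` edges has probability
`p^e (1-p)^(C(N,2) - e)`. -/
def erExp (N : ℕ) (p : ℝ) (f : SimpleGraph (Fin N) → ℝ) : ℝ :=
  ∑ G : SimpleGraph (Fin N),
    p ^ numEdges G * (1 - p) ^ (N.choose 2 - numEdges G) * f G

/-- Probability of an event under the Erdős–Rényi measure `G(N,p)`. -/
def erProb (N : ℕ) (p : ℝ) (E : Set (SimpleGraph (Fin N))) : ℝ :=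
  erExp N p (Set.indicator E fun _ => 1)

/-- `G` is `d`-regular. -/
def IsDReg {N : ℕ} (d : ℕ) (G : SimpleGraph (Fin N)) : Prop :=
  ∀ v, Nat.card (G.neighborSet v) = d

open Classical in
/-- The finite set of simple `d`-regular graphs on `N` labeled vertices. -/
def regFinset (N d : ℕ) : Finset (SimpleGraph (Fin N)) :=
  Finset.univ.filter fun G => IsDReg d G

/-- Expectation of `f` under the uniform measure `R(N,d)` on simple `d`-regular graphs. -/
def regExp (N d : ℕ) (f : SimpleGraph (Fin N) → ℝ) : ℝ :=
  (∑ G ∈ regFinset N d, f G) / ((regFinset N d).card : ℝ)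

/-- Probability of an event under the uniform measure `R(N,d)`. -/
def regProb (N d : ℕ) (E : Set (SimpleGraph (Fin N))) : ℝ :=
  regExp N d (Set.indicator E fun _ => 1)

end

open Finset MeasureTheory ProbabilityTheory

noncomputable section

/-- The law of the independent Gaussian entries used to build a GOE matrix: a product of
centered real Gaussians indexed by pairs `(i,j)`, with variance `2` on the diagonal and `1`
off the diagonal.  (Only the coordinates with `i ≤ j` are ever read off, so this realizes a
GOE matrix: the entries `(J_{ij})_{i≤j}` are independent centered Gaussians with
`Var(J_{ij}) = 1` for `i < j` and `Var(J_{ii}) = 2`.) -/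
def goeMeasure (N : ℕ) : Measure ((Fin N × Fin N) → ℝ) :=
  Measure.pi fun p => gaussianReal 0 (if p.1 = p.2 then 2 else 1)

/-- The symmetric (GOE) matrix built from the sample `ω`. -/
def Jmat {N : ℕ} (ω : (Fin N × Fin N) → ℝ) (i j : Fin N) : ℝ :=
  if i ≤ j then ω (i, j) else ω (j, i)

/-- The value `±1` of a Boolean spin. -/
def spin (b : Bool) : ℝ := if b then 1 else -1

/-- The configuration space `S_N(α) = {σ ∈ {−1,1}^N : ∑ᵢ σᵢ = N(2α−1)}`. -/
def SNset (N : ℕ) (α : ℚ) : Set (Fin N → Bool) :=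
  {σ | ∑ i, spin (σ i) = (N : ℝ) * (2 * (α : ℝ) - 1)}

open Classical in
/-- `S_N(α)` as a finite set. -/
def SNfinset (N : ℕ) (α : ℚ) : Finset (Fin N → Bool) :=
  Finset.univ.filter fun σ => ∑ i, spin (σ i) = (N : ℝ) * (2 * (α : ℝ) - 1)

/-- `H_0(σ) = N^{-1/2} ∑_{i,j} J_{ij} σ_i σ_j`. -/
def H0 {N : ℕ} (ω : (Fin N × Fin N) → ℝ) (σ : Fin N → Bool) : ℝ :=
  (Real.sqrt N)⁻¹ * ∑ i, ∑ j, Jmat ω i j * spin (σ i) * spin (σ j)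

/-- `g_i = N^{-1/2} ∑_j J_{ij}`. -/
def gvec {N : ℕ} (ω : (Fin N × Fin N) → ℝ) (i : Fin N) : ℝ :=
  (Real.sqrt N)⁻¹ * ∑ j, Jmat ω i j

/-- `H_1(σ) = H_0(σ) − 2(2α−1) ∑ᵢ gᵢ σᵢ + (2α−1)² N^{-1/2} ∑_{i,j} J_{ij}`. -/
def H1 {N : ℕ} (α : ℚ) (ω : (Fin N × Fin N) → ℝ) (σ : Fin N → Bool) : ℝ :=
  H0 ω σ - 2 * (2 * (α : ℝ) - 1) * ∑ i, gvec ω i * spin (σ i)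
    + (2 * (α : ℝ) - 1) ^ 2 * ((Real.sqrt N)⁻¹ * ∑ i, ∑ j, Jmat ω i j)

/-- `E[max_{σ ∈ S_N(α)} H(σ)]`, the expectation over the GOE matrix of the maximum of a
Hamiltonian `H` over the configuration space `S_N(α)`. -/
def Emax (N : ℕ) (α : ℚ) (H : ((Fin N × Fin N) → ℝ) → (Fin N → Bool) → ℝ) : ℝ :=
  ∫ ω, sSup ((H ω) '' SNset N α) ∂(goeMeasure N)

end

open Finset MeasureTheory ProbabilityTheory
open scoped BigOperators

namespace MC

/-- number of cut edges among the index set `A`, edge `i` joining `e (i,false)` and `e (i,true)`. -/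
def cutN {I C : Type*} (A : Finset I) (e : I × Bool → C) (s : C → Bool) : ℕ :=
  #{i ∈ A | s (e (i, false)) ≠ s (e (i, true))}

def mx {I C : Type*} (S : Finset (C → Bool)) (A : Finset I) (e : I × Bool → C) : ℕ :=
  S.sup (cutN A e)

/-- gain from adding an edge. -/
def gain {C : Type*} (S : Finset (C → Bool)) (G : (C → Bool) → ℕ) (a b : C) : ℝ :=
  ((S.sup fun s => G s + if s a ≠ s b then 1 else 0 : ℕ) : ℝ) - ((S.sup G : ℕ) : ℝ)

section
variable {C : Type*} [Fintype C] [DecidableEq C] (S : Finset (C → Bool)) (G : (C → Bool) → ℕ)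

open Classical in
def optv (a : C) : (C → Bool) → Bool := fun s => if s ∈ S ∧ G s = S.sup G then s a else false

lemma gain_eq (hS : S.Nonempty) (a b : C) :
    gain S G a b = 1 - if optv S G a = optv S G b then 1 else 0 := by
  classical
  unfold gain
  obtain ⟨s0, hs0, hs0'⟩ := Finset.exists_mem_eq_sup S hS G
  split_ifs with h
  · have : (S.sup fun s => G s + if s a ≠ s b then 1 else 0) = S.sup G := by
      apply le_antisymm
      · apply Finset.sup_le
        intro s hs
        have h1 : G s ≤ S.sup G := Finset.le_sup (f := G) hs
        by_cases hopt : G s = S.sup G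
        · have := congrFun h s
          simp only [optv, hs, hopt, and_self, if_true] at this
          simp [this, hopt]
        · split_ifs <;> omega
      · apply Finset.sup_le
        intro s hs
        exact le_trans (Nat.le_add_right _ _) (Finset.le_sup (f := fun s => G s + if s a ≠ s b then 1 else 0) hs)
    rw [this]; simp
  · have : (S.sup fun s => G s + if s a ≠ s b then 1 else 0) = S.sup G + 1 := by
      apply le_antisymm
      · apply Finset.sup_le
        intro s hs
        have h1 : G s ≤ S.sup G := Finset.le_sup (f := G) hs
        split_ifs <;> omega
      · have : ∃ s, s ∈ S ∧ G s = S.sup G ∧ s a ≠ s b := by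
          by_contra hcon
          push Not at hcon
          apply h
          funext s
          simp only [optv]
          split_ifs with h2
          · exact hcon s h2.1 h2.2
          · rfl
        obtain ⟨s, hs, h1, h2⟩ := this
        have := Finset.le_sup (f := fun s => G s + if s a ≠ s b then 1 else 0) hs
        simp only [ne_eq, h2, not_false_eq_true, if_true, h1] at this
        simpa using this
    rw [this]; push_cast; ring

lemma gain_self (hS : S.Nonempty) (a : C) : gain S G a a = 0 := by
  rw [gain_eq S G hS]; simp

lemma gain_le_one (hS : S.Nonempty) (a b : C) : gain S G a b ≤ 1 := by
  rw [gain_eq S G hS]; split_ifs <;> norm_num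

lemma gain_nonneg (hS : S.Nonempty) (a b : C) : 0 ≤ gain S G a b := by
  rw [gain_eq S G hS]; split_ifs <;> norm_num

lemma sum_eqind_nonneg {D : Type*} [Fintype D] [DecidableEq D] (φ : C → D) (w : C → ℝ) :
    0 ≤ ∑ a, ∑ b, w a * w b * (if φ a = φ b then 1 else 0) := by
  have : ∑ a, ∑ b, w a * w b * (if φ a = φ b then (1:ℝ) else 0)
      = ∑ c : D, (∑ a, w a * if φ a = c then 1 else 0) ^ 2 := by
    simp_rw [sq, Finset.sum_mul_sum]
    rw [Finset.sum_comm' (s := univ) (t := fun _ => univ) (t' := univ) (s' := fun _ => univ) (by simp)]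
    conv_rhs => rw [Finset.sum_comm]
    rw [Finset.sum_comm]
    refine Finset.sum_congr rfl fun a _ => ?_
    rw [Finset.sum_comm]
    refine Finset.sum_congr rfl fun b _ => ?_
    simp [eq_comm]
  rw [this]
  positivity

lemma gain_neg (hS : S.Nonempty) (w : C → ℝ) (hw : ∑ a, w a = 0) :
    ∑ a, ∑ b, w a * w b * gain S G a b ≤ 0 := by
  classical
  have h1 := sum_eqind_nonneg (optv S G) w
  have : ∑ a, ∑ b, w a * w b * gain S G a b = (∑ a, w a) * (∑ b, w b) -
      ∑ a, ∑ b, w a * w b * (if optv S G a = optv S G b then 1 else 0) := by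
    rw [Finset.sum_mul_sum, ← Finset.sum_sub_distrib]
    refine Finset.sum_congr rfl fun a _ => ?_
    rw [← Finset.sum_sub_distrib]
    refine Finset.sum_congr rfl fun b _ => ?_
    rw [gain_eq S G hS]; ring
  rw [this, hw]
  simpa using h1

end

/-- two-block kernel inequality -/
lemma kernel_two_block {C : Type*} [Fintype C] [DecidableEq C] (d : C → C → ℝ) (F1 F2 : Finset C)
    (hneg : ∀ w : C → ℝ, ∑ a, w a = 0 → ∑ a, ∑ b, w a * w b * d a b ≤ 0)
    (hself : ∀ a, d a a = 0) (hle : ∀ a b, d a b ≤ 1)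
    (d11 d22 d12 : ℝ)
    (h11 : ∀ a ∈ F1, ∀ b ∈ F1, a ≠ b → d a b = d11)
    (h22 : ∀ a ∈ F2, ∀ b ∈ F2, a ≠ b → d a b = d22)
    (h12 : ∀ a ∈ F1, ∀ b ∈ F2, d a b = d12)
    (h21 : ∀ a ∈ F1, ∀ b ∈ F2, d b a = d12)
    (hc1 : 2 ≤ #F1) (hc2 : 2 ≤ #F2) :
    d11 + d22 - 1 / (#F1 : ℝ) - 1 / (#F2 : ℝ) ≤ 2 * d12 := by
  have p1 : (0:ℝ) < #F1 := by exact_mod_cast (by omega : 0 < #F1)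
  have p2 : (0:ℝ) < #F2 := by exact_mod_cast (by omega : 0 < #F2)
  set w : C → ℝ := fun c => (if c ∈ F1 then 1 / (#F1 : ℝ) else 0) - (if c ∈ F2 then 1 / (#F2:ℝ) else 0) with hw
  have hw0 : ∑ a, w a = 0 := by
    simp only [hw, Finset.sum_sub_distrib, Finset.sum_ite_mem, Finset.univ_inter, Finset.sum_const, nsmul_eq_mul]
    field_simp
    ring
  have key := hneg w hw0
  have e11 : ∀ a ∈ F1, ∑ b ∈ F1, d a b = ((#F1:ℝ) - 1) * d11 := by
    intro a ha
    rw [← Finset.add_sum_erase F1 _ ha, hself, Finset.sum_congr rfl (g := fun _ => d11), Finset.sum_const,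
      Finset.card_erase_of_mem ha, nsmul_eq_mul, Nat.cast_sub (by omega)]
    · push_cast; ring
    · intro b hb; exact h11 a ha b (Finset.mem_of_mem_erase hb) (Finset.ne_of_mem_erase hb).symm
  have e22 : ∀ a ∈ F2, ∑ b ∈ F2, d a b = ((#F2:ℝ) - 1) * d22 := by
    intro a ha
    rw [← Finset.add_sum_erase F2 _ ha, hself, Finset.sum_congr rfl (g := fun _ => d22), Finset.sum_const,
      Finset.card_erase_of_mem ha, nsmul_eq_mul, Nat.cast_sub (by omega)]
    · push_cast; ring
    · intro b hb; exact h22 a ha b (Finset.mem_of_mem_erase hb) (Finset.ne_of_mem_erase hb).symm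
  have expand : ∑ a, ∑ b, w a * w b * d a b =
      (1/(#F1:ℝ))^2 * ∑ a ∈ F1, ∑ b ∈ F1, d a b + (1/(#F2:ℝ))^2 * ∑ a ∈ F2, ∑ b ∈ F2, d a b
      - (1/(#F1:ℝ)) * (1/(#F2:ℝ)) * ∑ a ∈ F1, ∑ b ∈ F2, d a b
      - (1/(#F1:ℝ)) * (1/(#F2:ℝ)) * ∑ a ∈ F2, ∑ b ∈ F1, d a b := by
    have gen : ∀ (F F' : Finset C) (x y : ℝ), x * y * ∑ a ∈ F, ∑ b ∈ F', d a b =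
        ∑ a, ∑ b, (if a ∈ F then x else 0) * (if b ∈ F' then y else 0) * d a b := by
      intro F F' x y
      simp only [ite_mul, zero_mul, mul_ite, mul_zero, Finset.mul_sum]
      rw [← Finset.sum_filter_add_sum_filter_not univ (· ∈ F)]
      simp only [Finset.filter_mem_eq_inter, Finset.univ_inter]
      rw [Finset.sum_eq_zero (s := univ.filter (· ∉ F)), add_zero]
      · refine Finset.sum_congr rfl fun a ha => ?_
        simp [ha, Finset.sum_ite_mem]
      · intro a ha
        have : a ∉ F := by simpa using ha
        simp [this]
    rw [sq, sq, gen, gen, gen, mul_comm (1/(#F1:ℝ)) (1/(#F2:ℝ)), gen, ← Finset.sum_add_distrib, ← Finset.sum_sub_distrib, ← Finset.sum_sub_distrib]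
    refine Finset.sum_congr rfl fun a _ => ?_
    rw [← Finset.sum_add_distrib, ← Finset.sum_sub_distrib, ← Finset.sum_sub_distrib]
    refine Finset.sum_congr rfl fun b _ => ?_
    simp only [hw]; ring
  rw [expand, Finset.sum_congr rfl e11, Finset.sum_congr rfl e22,
    Finset.sum_congr rfl (fun a ha => Finset.sum_congr rfl (fun b hb => h12 a ha b hb)),
    Finset.sum_congr rfl (fun a ha => Finset.sum_congr rfl (fun b hb => h21 b hb a ha))] at key
  simp only [Finset.sum_const, nsmul_eq_mul] at key
  have k2 : (1 - 1/(#F1:ℝ)) * d11 + (1 - 1/(#F2:ℝ)) * d22 - 2 * d12 ≤ 0 := by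
    refine le_trans (le_of_eq ?_) key
    field_simp
    ring
  obtain ⟨a, ha, a', ha', hne⟩ := Finset.one_lt_card.1 (by omega : 1 < #F1)
  obtain ⟨b, hb, b', hb', hne'⟩ := Finset.one_lt_card.1 (by omega : 1 < #F2)
  have l1 : d11 ≤ 1 := h11 a ha a' ha' hne ▸ hle a a'
  have l2 : d22 ≤ 1 := h22 b hb b' hb' hne' ▸ hle b b'
  have q1 : 1/(#F1:ℝ) * d11 ≤ 1/(#F1:ℝ) := by
    have : 0 < 1/(#F1:ℝ) := by positivity
    nlinarith
  have q2 : 1/(#F2:ℝ) * d22 ≤ 1/(#F2:ℝ) := by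
    have : 0 < 1/(#F2:ℝ) := by positivity
    nlinarith
  linarith

end MC

open Finset MeasureTheory ProbabilityTheory
open scoped BigOperators
set_option linter.all false

namespace MC

lemma gain_comm {C : Type*} (S : Finset (C → Bool)) (G : (C → Bool) → ℕ) (a b : C) :
    gain S G a b = gain S G b a := by
  unfold gain; simp only [ne_comm]

section
variable {C I R : Type*} [Fintype C] [DecidableEq C] [Fintype I] [DecidableEq I] [Fintype R] [Nonempty R]
 (act : R → Equiv.Perm C) (S : Finset (C → Bool)) (b : C → Bool)

noncomputable def Phi (A : Finset I) (e : I × Bool → C) : ℝ := 𝔼 ρ, (mx S A (act ρ ∘ e) : ℝ)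

noncomputable def dk (A : Finset I) (e : I × Bool → C) (a b : C) : ℝ :=
  𝔼 ρ, gain S (cutN A (act ρ ∘ e)) (act ρ a) (act ρ b)

lemma cutN_insert {A : Finset I} {i : I} (hi : i ∉ A) (e : I × Bool → C) (s : C → Bool) :
    cutN (insert i A) e s = cutN A e s + if s (e (i,false)) ≠ s (e (i,true)) then 1 else 0 := by
  unfold cutN
  rw [Finset.filter_insert]
  split_ifs with h
  · rw [Finset.card_insert_of_notMem (by simp [hi])]
  · rfl

lemma cutN_congr {A : Finset I} {e e' : I × Bool → C} (h : ∀ i ∈ A, ∀ t, e (i,t) = e' (i,t)) (s : C → Bool) :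
    cutN A e s = cutN A e' s := by
  unfold cutN
  congr 1
  refine Finset.filter_congr fun i hi => ?_
  rw [h i hi, h i hi]

lemma mx_congr {A : Finset I} {e e' : I × Bool → C} (h : ∀ i ∈ A, ∀ t, e (i,t) = e' (i,t)) :
    mx S A e = mx S A e' := by
  unfold mx
  congr 1; funext s; exact cutN_congr h s

lemma mx_mono {A A' : Finset I} (h : A ⊆ A') (e : I × Bool → C) : mx S A e ≤ mx S A' e := by
  unfold mx
  apply Finset.sup_mono_fun
  intro s _
  exact Finset.card_le_card (Finset.filter_subset_filter _ h)

lemma mx_le_add {A A' : Finset I} (h : A ⊆ A') (e : I × Bool → C) : mx S A' e ≤ mx S A e + #(A' \ A) := by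
  unfold mx
  apply Finset.sup_le
  intro s hs
  have h1 : cutN A e s ≤ S.sup (cutN A e) := Finset.le_sup (f := cutN A e) hs
  have h2 : cutN A' e s ≤ cutN A e s + #(A' \ A) := by
    unfold cutN
    rw [← Finset.card_filter_add_card_filter_not (s := A'.filter _) (fun i => i ∈ A)]
    apply Nat.add_le_add
    · apply Finset.card_le_card
      intro i hi; simp at hi ⊢; tauto
    · apply Finset.card_le_card
      intro i hi; simp at hi ⊢; tauto
  omega

lemma Phi_congr {A : Finset I} {e e' : I × Bool → C} (h : ∀ i ∈ A, ∀ t, e (i,t) = e' (i,t)) :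
    Phi act S A e = Phi act S A e' := by
  unfold Phi
  refine Finset.expect_congr rfl fun ρ _ => ?_
  rw [mx_congr S (e' := act ρ ∘ e')]
  intro i hi t; simp [h i hi t]

lemma dk_congr {A : Finset I} {e e' : I × Bool → C} (h : ∀ i ∈ A, ∀ t, e (i,t) = e' (i,t)) (a b : C) :
    dk act S A e a b = dk act S A e' a b := by
  unfold dk
  refine Finset.expect_congr rfl fun ρ _ => ?_
  congr 1
  funext s
  apply cutN_congr
  intro i hi t; simp [h i hi t]

lemma Phi_mono {A A' : Finset I} (h : A ⊆ A') (e : I × Bool → C) : Phi act S A e ≤ Phi act S A' e := by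
  unfold Phi
  refine Finset.expect_le_expect fun ρ _ => ?_
  exact_mod_cast mx_mono S h _

lemma Phi_insert {A : Finset I} {i : I} (hi : i ∉ A) (e : I × Bool → C) :
    Phi act S (insert i A) e = Phi act S A e + dk act S A e (e (i,false)) (e (i,true)) := by
  unfold Phi dk
  rw [← Finset.expect_add_distrib]
  refine Finset.expect_congr rfl fun ρ _ => ?_
  unfold gain mx
  rw [show (cutN (insert i A) (act ρ ∘ e)) = fun s => cutN A (act ρ ∘ e) s +
    if s (act ρ (e (i,false))) ≠ s (act ρ (e (i,true))) then 1 else 0 from ?_]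
  · ring
  · funext s; rw [cutN_insert hi]; rfl

lemma dk_comm (A : Finset I) (e : I × Bool → C) (x y : C) : dk act S A e x y = dk act S A e y x := by
  unfold dk; simp only [gain_comm]


lemma dk_swap (hsym : ∀ c c', b c = b c' → ∀ g : Equiv.Perm C → ℝ,
      𝔼 ρ, g (act ρ) = 𝔼 ρ, g (act ρ * Equiv.swap c c'))
    {A : Finset I} {e : I × Bool → C} {c c' : C} (hb : b c = b c')
    (hc : ∀ i ∈ A, ∀ t, e (i,t) ≠ c) (hc' : ∀ i ∈ A, ∀ t, e (i,t) ≠ c') (x y : C) :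
    dk act S A e x y = dk act S A e (Equiv.swap c c' x) (Equiv.swap c c' y) := by
  unfold dk
  rw [hsym c c' hb (fun π => gain S (cutN A (π ∘ e)) (π x) (π y))]
  refine Finset.expect_congr rfl fun ρ _ => ?_
  congr 1
  funext s
  apply cutN_congr
  intro i hi t
  simp [Equiv.swap_apply_of_ne_of_ne (hc i hi t) (hc' i hi t)]

lemma dk_step (hsym : ∀ c c', b c = b c' → ∀ g : Equiv.Perm C → ℝ,
      𝔼 ρ, g (act ρ) = 𝔼 ρ, g (act ρ * Equiv.swap c c'))
    (hS : S.Nonempty) (A : Finset I) (e : I × Bool → C) (F1 F2 : Finset C)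
    (hF1 : ∀ c ∈ F1, b c = true ∧ ∀ i ∈ A, ∀ t, e (i,t) ≠ c)
    (hF2 : ∀ c ∈ F2, b c = false ∧ ∀ i ∈ A, ∀ t, e (i,t) ≠ c)
    (a0 a1 b0 b1 : C) (ha0 : a0 ∈ F1) (ha1 : a1 ∈ F1) (hb0 : b0 ∈ F2) (hb1 : b1 ∈ F2)
    (hne1 : a0 ≠ a1) (hne2 : b0 ≠ b1) :
    dk act S A e a0 a1 + dk act S A e b0 b1 - 1 / (#F1 : ℝ) - 1 / (#F2 : ℝ) ≤ 2 * dk act S A e a0 b0 := by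
  have hsw : ∀ c c', b c = b c' → (∀ i ∈ A, ∀ t, e (i,t) ≠ c) → (∀ i ∈ A, ∀ t, e (i,t) ≠ c') → ∀ x y,
    dk act S A e x y = dk act S A e (Equiv.swap c c' x) (Equiv.swap c c' y) :=
    fun c c' h1 h2 h3 x y => dk_swap act S b hsym h1 h2 h3 x y
  have same : ∀ (F : Finset C) (u : Bool), (∀ c ∈ F, b c = u ∧ ∀ i ∈ A, ∀ t, e (i,t) ≠ c) →
      ∀ x ∈ F, ∀ y ∈ F, ∀ x' ∈ F, ∀ y' ∈ F, x ≠ y → x' ≠ y' → dk act S A e x y = dk act S A e x' y' := by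
    intro F u hF x hx y hy x' hx' y' hy' hxy hxy'
    rw [hsw x x' (by rw [(hF x hx).1, (hF x' hx').1]) (hF x hx).2 (hF x' hx').2, Equiv.swap_apply_left]
    have hm : Equiv.swap x x' y ∈ F := by
      rw [Equiv.swap_apply_def]; split_ifs <;> assumption
    have hn : Equiv.swap x x' y ≠ x' := by
      intro h
      have := congrArg (Equiv.swap x x') h
      rw [Equiv.swap_apply_self, Equiv.swap_apply_right] at this
      exact hxy this.symm
    set y2 := Equiv.swap x x' y
    rw [hsw y2 y' (by rw [(hF _ hm).1, (hF y' hy').1]) (hF _ hm).2 (hF y' hy').2, Equiv.swap_apply_left,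
      Equiv.swap_apply_of_ne_of_ne hn.symm hxy']
  have cross : ∀ x ∈ F1, ∀ y ∈ F2, dk act S A e x y = dk act S A e a0 b0 := by
    intro x hx y hy
    have nn : ∀ x ∈ F1, ∀ y ∈ F2, y ≠ x := by
      intro x hx y hy h
      have h1 := (hF1 x hx).1
      have h2 := (hF2 y hy).1
      rw [h, h1] at h2; exact absurd h2 (by simp)
    rw [hsw x a0 (by rw [(hF1 x hx).1, (hF1 _ ha0).1]) (hF1 x hx).2 (hF1 _ ha0).2, Equiv.swap_apply_left,
      Equiv.swap_apply_of_ne_of_ne (nn x hx y hy) (nn _ ha0 y hy),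
      hsw y b0 (by rw [(hF2 y hy).1, (hF2 _ hb0).1]) (hF2 y hy).2 (hF2 _ hb0).2, Equiv.swap_apply_left,
      Equiv.swap_apply_of_ne_of_ne (nn _ ha0 y hy).symm (nn _ ha0 _ hb0).symm]
  refine kernel_two_block (dk act S A e) F1 F2 ?_ ?_ ?_ _ _ _ ?_ ?_ ?_ ?_ ?_ ?_
  · intro w hw
    have : ∑ a, ∑ b, w a * w b * dk act S A e a b =
        𝔼 ρ, ∑ a, ∑ b, w a * w b * gain S (cutN A (act ρ ∘ e)) (act ρ a) (act ρ b) := by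
      rw [Finset.expect_sum_comm]
      refine Finset.sum_congr rfl fun a _ => ?_
      rw [Finset.expect_sum_comm]
      refine Finset.sum_congr rfl fun b _ => ?_
      rw [dk, Finset.mul_expect]
    rw [this]
    refine Finset.expect_le univ_nonempty (fun ρ _ => ?_)
    have h := gain_neg S (cutN A (act ρ ∘ e)) hS (fun c => w ((act ρ).symm c))
      (by rw [← hw]; exact Equiv.sum_comp (act ρ).symm w)
    rw [← Equiv.sum_comp (act ρ)] at h
    refine le_trans (le_of_eq ?_) h
    refine Finset.sum_congr rfl fun a _ => ?_
    rw [eq_comm, ← Equiv.sum_comp (act ρ)]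
    simp
  · intro a; unfold dk; simp [gain_self _ _ hS]
  · intro a c; unfold dk
    refine Finset.expect_le univ_nonempty (fun ρ _ => gain_le_one _ _ hS _ _)
  · intro x hx y hy hxy; exact same F1 true hF1 x hx y hy a0 ha0 a1 ha1 hxy hne1
  · intro x hx y hy hxy; exact same F2 false hF2 x hx y hy b0 hb0 b1 hb1 hxy hne2
  · intro x hx y hy; exact cross x hx y hy
  · intro x hx y hy; rw [dk_comm]; exact cross x hx y hy
  · exact Finset.one_lt_card.2 ⟨a0, ha0, a1, ha1, hne1⟩
  · exact Finset.one_lt_card.2 ⟨b0, hb0, b1, hb1, hne2⟩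

end
end MC

open Finset MeasureTheory ProbabilityTheory
open scoped BigOperators
set_option linter.all false

namespace MC

section
variable {C I R : Type*} [Fintype C] [DecidableEq C] [Fintype I] [DecidableEq I] [Fintype R] [Nonempty R]
 (act : R → Equiv.Perm C) (S : Finset (C → Bool)) (b : C → Bool)

/-- free clones with block label `u`. -/
def Fr (A : Finset I) (τ : I × Bool ≃ C) (u : Bool) : Finset C :=
  univ.filter fun c => b c = u ∧ (τ.symm c).1 ∉ A

lemma mem_Fr (A : Finset I) (τ : I × Bool ≃ C) (u : Bool) (c : C) :
    c ∈ Fr b A τ u ↔ b c = u ∧ (τ.symm c).1 ∉ A := by simp [Fr]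

lemma Fr_card (A : Finset I) (τ : I × Bool ≃ C) :
    #(Fr b A τ true) + #(Fr b A τ false) = 2 * #Aᶜ := by
  have h1 : #(Fr b A τ true) + #(Fr b A τ false) = #(univ.filter fun c => (τ.symm c).1 ∉ A) := by
    rw [← Finset.card_filter_add_card_filter_not (s := univ.filter fun c => (τ.symm c).1 ∉ A) (fun c => b c = true)]
    unfold Fr
    rw [Finset.filter_filter, Finset.filter_filter]
    congr 2
    · ext c; simp [and_comm]
    · ext c; simp [and_comm]
  rw [h1]
  have : (univ.filter fun c => (τ.symm c).1 ∉ A) = (Aᶜ ×ˢ (univ : Finset Bool)).map τ.toEmbedding := by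
    ext c
    simp only [mem_filter, mem_univ, true_and, mem_map, mem_product, mem_compl, and_true, Equiv.coe_toEmbedding]
    constructor
    · intro h; exact ⟨τ.symm c, h, by simp⟩
    · rintro ⟨p, hp, rfl⟩; simpa using hp
  rw [this, card_map, card_product]
  simp [mul_comm]

lemma cutN_card_sdiff (A : Finset I) (e : I × Bool → C) :
    cutN (A.filter fun i => b (e (i,false)) = b (e (i,true))) e b = 0 := by
  unfold cutN
  rw [Finset.card_eq_zero, Finset.filter_eq_empty_iff]
  intro i hi; simp at hi; simp [hi.2]

lemma drop_cross (c : ℝ)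
    (hbase : ∀ (A : Finset I) (τ : I × Bool ≃ C), cutN A τ b = 0 → c - #Aᶜ ≤ Phi act S A τ)
    (A : Finset I) (τ : I × Bool ≃ C) :
    c - #Aᶜ - cutN A τ b ≤ Phi act S A τ := by
  have h := hbase _ τ (cutN_card_sdiff b A τ)
  have h2 := Phi_mono act S (Finset.filter_subset (fun i => b (τ (i,false)) = b (τ (i,true))) A) τ
  have h3 : #(A.filter fun i => b (τ (i,false)) = b (τ (i,true)))ᶜ = #Aᶜ + cutN A τ b := by
    rw [Finset.card_compl, Finset.card_compl]
    have := Finset.card_filter_add_card_filter_not (s := A) (fun i => b (τ (i,false)) = b (τ (i,true)))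
    have h4 := Finset.card_le_univ A
    unfold cutN
    simp only [ne_eq]
    omega
  rw [h3] at h
  push_cast at h
  linarith

/-- rewiring lemma : replace far end `y` (end of edge `i` at position `(i,u)`) by free clone `z`. -/
lemma rewire {A : Finset I} {i : I} (hi : i ∈ A) (τ : I × Bool ≃ C) (u : Bool) (z : C) (hz : (τ.symm z).1 ∉ A) :
    Phi act S A (τ.trans (Equiv.swap (τ (i,u)) z)) = Phi act S (A.erase i) τ + dk act S (A.erase i) τ (τ (i,!u)) z := by
  have hne : ∀ j t, j ∈ A → τ (j,t) ≠ z := by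
    intro j t hj h
    apply hz; rw [← h]; simpa using hj
  have key : ∀ j ∈ A.erase i, ∀ t, (τ.trans (Equiv.swap (τ (i,u)) z)) (j,t) = τ (j,t) := by
    intro j hj t
    simp only [Equiv.trans_apply]
    apply Equiv.swap_apply_of_ne_of_ne
    · intro h
      have := τ.injective h
      simp only [Prod.mk.injEq] at this
      exact (Finset.ne_of_mem_erase hj) this.1
    · exact hne j t (Finset.mem_of_mem_erase hj)
  conv_lhs => rw [← Finset.insert_erase hi]
  rw [Phi_insert act S (Finset.notMem_erase i A), Phi_congr act S key, dk_congr act S key]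
  congr 1
  have e1 : (τ.trans (Equiv.swap (τ (i,u)) z)) (i,u) = z := by simp
  have e2 : (τ.trans (Equiv.swap (τ (i,u)) z)) (i,!u) = τ (i,!u) := by
    simp only [Equiv.trans_apply]
    apply Equiv.swap_apply_of_ne_of_ne
    · intro h; have := τ.injective h; simp at this
    · exact hne _ _ hi
  cases u
  · rw [e1]; simp only [Bool.not_false] at e2 ⊢; rw [e2, dk_comm]
  · rw [e1]; simp only [Bool.not_true] at e2 ⊢; rw [e2]

lemma rewire_cut {A : Finset I} {i : I} (hi : i ∈ A) (τ : I × Bool ≃ C) (u : Bool) (z : C) (hz : (τ.symm z).1 ∉ A)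
    (hcr : b (τ (i,u)) ≠ b (τ (i,!u))) (hbz : b z = b (τ (i,!u))) :
    cutN A (τ.trans (Equiv.swap (τ (i,u)) z)) b + 1 = cutN A τ b := by
  have hne : ∀ j t, j ∈ A → τ (j,t) ≠ z := by
    intro j t hj h
    apply hz; rw [← h]; simpa using hj
  have key : ∀ j ∈ A.erase i, ∀ t, (τ.trans (Equiv.swap (τ (i,u)) z)) (j,t) = τ (j,t) := by
    intro j hj t
    simp only [Equiv.trans_apply]
    apply Equiv.swap_apply_of_ne_of_ne
    · intro h
      have := τ.injective h
      simp only [Prod.mk.injEq] at this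
      exact (Finset.ne_of_mem_erase hj) this.1
    · exact hne j t (Finset.mem_of_mem_erase hj)
  have e1 : (τ.trans (Equiv.swap (τ (i,u)) z)) (i,u) = z := by simp
  have e2 : (τ.trans (Equiv.swap (τ (i,u)) z)) (i,!u) = τ (i,!u) := by
    simp only [Equiv.trans_apply]
    apply Equiv.swap_apply_of_ne_of_ne
    · intro h; have := τ.injective h; simp at this
    · exact hne _ _ hi
  rw [← Finset.insert_erase hi, cutN_insert (Finset.notMem_erase i A), cutN_insert (Finset.notMem_erase i A),
    cutN_congr key]
  cases u
  · rw [e1]; simp only [Bool.not_false] at e2 hcr hbz ⊢; rw [e2]; simp [hcr, hbz]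
  · rw [e1]; simp only [Bool.not_true] at e2 hcr hbz ⊢; rw [e2]; simp [hcr.symm, hbz]

lemma rewire_Fr {A : Finset I} {i : I} (hi : i ∈ A) (τ : I × Bool ≃ C) (u : Bool) (z : C) (hz : (τ.symm z).1 ∉ A)
    (hcr : b (τ (i,u)) ≠ b z) :
    #(Fr b A (τ.trans (Equiv.swap (τ (i,u)) z)) (b z)) + 1 = #(Fr b A τ (b z)) := by
  have hzm : z ∈ Fr b A τ (b z) := by simp [Fr, hz]
  have : Fr b A (τ.trans (Equiv.swap (τ (i,u)) z)) (b z) = (Fr b A τ (b z)).erase z := by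
    ext c
    rw [mem_erase, mem_Fr, mem_Fr, Equiv.symm_trans_apply, Equiv.symm_swap]
    by_cases h1 : c = z
    · subst h1; simp [hi]
    by_cases h2 : c = τ (i,u)
    · subst h2; simp [hcr]
    rw [Equiv.swap_apply_of_ne_of_ne h2 h1]
    tauto
  rw [this, Finset.card_erase_of_mem hzm]
  have := Finset.card_pos.2 ⟨z, hzm⟩
  omega

lemma claim (hsym : ∀ c c', b c = b c' → ∀ g : Equiv.Perm C → ℝ,
      𝔼 ρ, g (act ρ) = 𝔼 ρ, g (act ρ * Equiv.swap c c')) (hS : S.Nonempty) (c : ℝ)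
    (hbase : ∀ (A : Finset I) (τ : I × Bool ≃ C), cutN A τ b = 0 → c - #Aᶜ ≤ Phi act S A τ)
    (s : ℕ) (hs : 1 ≤ s) (k : ℕ) (hk : k ≤ s^3) : ∀ (A : Finset I) (τ : I × Bool ≃ C), #Aᶜ = 2 * s^2 →
    cutN A τ b = k → c - 2 * s^2 - k * (1/s + 1/s^2) - 1/s * ((#(Fr b A τ true) : ℝ) - 2*s^2)^2 ≤ Phi act S A τ := by
  have s0 : (0:ℝ) < s := by exact_mod_cast hs
  induction k with
  | zero =>
    intro A τ hA h0
    have := hbase A τ h0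
    rw [hA] at this
    push_cast at this ⊢
    have h2 : 0 ≤ 1/(s:ℝ) * ((#(Fr b A τ true) : ℝ) - 2*s^2)^2 := by positivity
    linarith
  | succ k ih =>
    intro A τ hA hk1
    set m : ℕ := #(Fr b A τ true) with hm
    by_cases htriv : ((k+1:ℕ):ℝ) ≤ 1/s * ((m : ℝ) - 2*s^2)^2
    · have := drop_cross act S b c hbase A τ
      rw [hA, hk1] at this
      push_cast at this htriv ⊢
      have h2 : 0 ≤ ((k:ℝ)+1) * (1/s+1/s^2) := by positivity
      linarith
    push Not at htriv
    have hx : ((m:ℝ) - 2*s^2)^2 < (s^2)^2 := by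
      have h1 : ((k+1:ℕ):ℝ) ≤ (s:ℝ)^3 := by exact_mod_cast hk
      have h2 : 1/(s:ℝ) * ((m : ℝ) - 2*s^2)^2 < s^3 := lt_of_lt_of_le htriv h1
      rw [one_div, inv_mul_lt_iff₀ s0] at h2
      calc _ < _ := h2
        _ = _ := by ring
    have hx2 := abs_lt.1 (abs_lt_of_sq_lt_sq hx (by positivity))
    have hcard := Fr_card b A τ
    rw [hA, ← hm] at hcard
    have hm1 : (s:ℝ)^2 < m := by linarith [hx2.1]
    have hm1' : s^2 < m := by exact_mod_cast hm1
    have hm2 : (s:ℝ)^2 < #(Fr b A τ false) := by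
      have : (m:ℝ) + #(Fr b A τ false) = 2 * (2 * s^2) := by exact_mod_cast hcard
      linarith [hx2.2]
    have hm2' : s^2 < #(Fr b A τ false) := by exact_mod_cast hm2
    obtain ⟨i, hi⟩ : ∃ i, i ∈ A.filter fun i => b (τ (i,false)) ≠ b (τ (i,true)) := by
      apply Finset.card_pos.1
      unfold cutN at hk1
      rw [hk1]; omega
    obtain ⟨hiA, hicr⟩ := Finset.mem_filter.1 hi
    -- orientation: position `(i,u)` carries `true`
    obtain ⟨u, hu, hu'⟩ : ∃ u, b (τ (i,u)) = true ∧ b (τ (i,!u)) = false := by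
      cases h1 : b (τ (i,false)) <;> cases h2 : b (τ (i,true))
      · simp [h1,h2] at hicr
      · exact ⟨true, h2, by simpa using h1⟩
      · exact ⟨false, h1, by simpa using h2⟩
      · simp [h1,h2] at hicr
    obtain ⟨a1, ha1⟩ := Finset.card_pos.1 (lt_of_le_of_lt (Nat.zero_le _) hm1')
    obtain ⟨b1, hb1⟩ := Finset.card_pos.1 (lt_of_le_of_lt (Nat.zero_le _) hm2')
    have ha1' : b a1 = true ∧ (τ.symm a1).1 ∉ A := by simpa [Fr] using ha1
    have hb1' : b b1 = false ∧ (τ.symm b1).1 ∉ A := by simpa [Fr] using hb1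
    -- two rewirings
    set τ1 := τ.trans (Equiv.swap (τ (i,!u)) a1) with hτ1
    set τ2 := τ.trans (Equiv.swap (τ (i,u)) b1) with hτ2
    have P1 := rewire act S hiA τ (!u) a1 ha1'.2
    have P2 := rewire act S hiA τ u b1 hb1'.2
    rw [Bool.not_not] at P1
    have c1 := rewire_cut b hiA τ (!u) a1 ha1'.2 (by rw [Bool.not_not, hu, hu']; simp) (by rw [Bool.not_not, hu, ha1'.1])
    have c2 := rewire_cut b hiA τ u b1 hb1'.2 (by rw [hu, hu']; simp) (by rw [hu', hb1'.1])
    have f1 := rewire_Fr b hiA τ (!u) a1 ha1'.2 (by rw [hu', ha1'.1]; simp)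
    have f2 := rewire_Fr b hiA τ u b1 hb1'.2 (by rw [hu, hb1'.1]; simp)
    rw [ha1'.1] at f1
    rw [hb1'.1] at f2
    rw [← hτ1] at P1 c1 f1
    rw [← hτ2] at P2 c2 f2
    have f2' : #(Fr b A τ2 true) = m + 1 := by
      have := Fr_card b A τ2
      rw [hA] at this
      omega
    have f1' : (#(Fr b A τ1 true) : ℝ) = m - 1 := by
      rw [← hm] at f1
      rw [← f1]; push_cast; ring
    have I1 := ih (by omega) A τ1 hA (by omega)
    have I2 := ih (by omega) A τ2 hA (by omega)
    rw [f1'] at I1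
    rw [f2'] at I2
    have P0 : Phi act S A τ = Phi act S (A.erase i) τ + dk act S (A.erase i) τ (τ (i,u)) (τ (i,!u)) := by
      conv_lhs => rw [← Finset.insert_erase hiA]
      rw [Phi_insert act S (Finset.notMem_erase i A)]
      cases u
      · rfl
      · rw [dk_comm]; rfl
    have hsub : ∀ v, Fr b A τ v ⊆ Fr b (A.erase i) τ v := by
      intro v x hx
      simp only [Fr, mem_filter, mem_univ, true_and, mem_erase] at hx ⊢
      tauto
    have hfree : ∀ v, ∀ x ∈ Fr b (A.erase i) τ v, b x = v ∧ ∀ j ∈ A.erase i, ∀ t, τ (j,t) ≠ x := by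
      intro v x hx
      simp only [Fr, mem_filter, mem_univ, true_and] at hx
      refine ⟨hx.1, fun j hj t h => hx.2 ?_⟩
      rw [← h]; simpa using hj
    have D := dk_step act S b hsym hS (A.erase i) τ (Fr b (A.erase i) τ true) (Fr b (A.erase i) τ false)
      (hfree true) (hfree false) (τ (i,u)) a1 (τ (i,!u)) b1
      (by simp [Fr, hu]) (hsub _ ha1) (by simp [Fr, hu']) (hsub _ hb1)
      (by intro h; apply ha1'.2; rw [← h]; simpa using hiA)
      (by intro h; apply hb1'.2; rw [← h]; simpa using hiA)
    have q1 : 1 / (#(Fr b (A.erase i) τ true) : ℝ) ≤ 1/s^2 := by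
      apply one_div_le_one_div_of_le (by positivity)
      exact hm1.le.trans (by exact_mod_cast Finset.card_le_card (hsub true))
    have q2 : 1 / (#(Fr b (A.erase i) τ false) : ℝ) ≤ 1/s^2 := by
      apply one_div_le_one_div_of_le (by positivity)
      exact hm2.le.trans (by exact_mod_cast Finset.card_le_card (hsub false))
    have ex : 1/(s:ℝ) * ((m:ℝ) - 1 - 2*s^2)^2 + 1/(s:ℝ) * (((m+1:ℕ):ℝ) - 2*s^2)^2
        = 2 * (1/(s:ℝ) * ((m:ℝ) - 2*s^2)^2) + 2 * (1/s) := by push_cast; ring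
    push_cast at I1 I2 ex ⊢
    linarith

lemma superadd_abs (hsym : ∀ c c', b c = b c' → ∀ g : Equiv.Perm C → ℝ,
      𝔼 ρ, g (act ρ) = 𝔼 ρ, g (act ρ * Equiv.swap c c')) (hS : S.Nonempty) (c : ℝ)
    (hbase : ∀ (A : Finset I) (τ : I × Bool ≃ C), cutN A τ b = 0 → c - #Aᶜ ≤ Phi act S A τ)
    (s : ℕ) (hs : 1 ≤ s) (τ : I × Bool ≃ C) (hk : cutN univ τ b ≤ s^3) :
    c - 4 * s^2 ≤ Phi act S univ τ := by
  have s1 : (1:ℝ) ≤ s := by exact_mod_cast hs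
  have s0 : (0:ℝ) < s := by linarith
  by_cases hT : cutN univ τ b < 2 * s^2
  · have := drop_cross act S b c hbase univ τ
    have h1 : (cutN univ τ b : ℝ) < 2 * s^2 := by exact_mod_cast hT
    simp at this
    nlinarith
  push Not at hT
  obtain ⟨D, hD, hDc⟩ := Finset.exists_subset_card_eq hT
  have h1 := claim act S b hsym hS c hbase s hs (cutN Dᶜ τ b)
    (le_trans (Finset.card_le_card (Finset.filter_subset_filter _ (Finset.subset_univ _))) hk) Dᶜ τ (by rw [compl_compl, hDc]) rfl
  have hmT : #(Fr b Dᶜ τ true) = 2 * s^2 := by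
    rw [← hDc]
    symm
    refine Finset.card_bij (fun i _ => if b (τ (i,false)) = true then τ (i,false) else τ (i,true)) ?_ ?_ ?_
    · intro i hi
      have hcr := (Finset.mem_filter.1 (hD hi)).2
      split_ifs with h
      · simp [Fr, h, hi]
      · have : b (τ (i,true)) = true := by
          cases h2 : b (τ (i,true))
          · simp [h2] at hcr; exact absurd hcr h
          · rfl
        simp [Fr, this, hi]
    · intro i hi j hj h
      split_ifs at h <;> simpa using congrArg Prod.fst (τ.injective h)
    · intro x hx
      simp only [Fr, mem_filter, mem_univ, true_and, mem_compl, not_not] at hx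
      refine ⟨(τ.symm x).1, hx.2, ?_⟩
      have hcr := (Finset.mem_filter.1 (hD hx.2)).2
      have hxx : τ ((τ.symm x).1, (τ.symm x).2) = x := by simp
      cases h : (τ.symm x).2
      · rw [h] at hxx; rw [hxx]; simp [hx.1]
      · rw [h] at hxx; rw [hxx, hx.1] at hcr; simp at hcr; simp [hcr, hxx]
  rw [hmT] at h1
  have h2 := Phi_mono act S (Finset.subset_univ Dᶜ) τ
  have hk' : (cutN Dᶜ τ b : ℝ) ≤ s^3 := by
    exact_mod_cast (le_trans (Finset.card_le_card (Finset.filter_subset_filter _ (Finset.subset_univ _))) hk)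
  have h3 : (cutN Dᶜ τ b : ℝ) * (1/s + 1/s^2) ≤ s^3 * (1/s+1/s^2) := by gcongr
  have h4 : (s:ℝ)^3 * (1/s+1/s^2) = s^2 + s := by field_simp
  push_cast at h1
  have : 1/(s:ℝ) * (2 * (s:ℝ)^2 - 2*s^2)^2 = 0 := by ring
  nlinarith

end
end MC

open Finset MeasureTheory ProbabilityTheory
open scoped BigOperators
set_option linter.all false

namespace MC

noncomputable def confT (I : Type*) {C : Type*} [Fintype C] [DecidableEq C] [Fintype I] [DecidableEq I]
    (S : Finset (C → Bool)) : ℝ := 𝔼 τ : (I × Bool ≃ C), (mx S univ τ : ℝ)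

lemma equiv_extend {X Y C : Type*} [Fintype Y] [Fintype C] [Fintype X] [DecidableEq Y] [DecidableEq C]
    (hc : Fintype.card Y = Fintype.card C) (φ : X → Y) (hφ : φ.Injective)
    (ψ : X → C) (hψ : ψ.Injective) : ∃ g : Y ≃ C, ∀ x, g (φ x) = ψ x := by
  classical
  let g0 : Y ≃ C := Fintype.equivOfCardEq hc
  obtain ⟨g, hg⟩ := Finset.exists_equiv_extend_of_card_eq (α := Y) (β := C) (t := univ) (by simpa using hc)
    (s := univ.image φ) (f := Function.extend φ ψ g0) (by simp) (by
      intro a ha b hb h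
      simp at ha hb
      obtain ⟨x, rfl⟩ := ha
      obtain ⟨y, rfl⟩ := hb
      rw [hφ.extend_apply, hφ.extend_apply] at h
      rw [hψ h])
  refine ⟨g.trans (Equiv.subtypeUnivEquiv (by simp)), fun x => ?_⟩
  have := hg (φ x) (by simp)
  rw [hφ.extend_apply] at this
  simpa using this

/-- completion of a partial matching -/
lemma completion {I I1 C1 : Type*} [Fintype I1] [DecidableEq I1] [Fintype C1] [DecidableEq C1] [DecidableEq I]
    (hc : Fintype.card C1 = 2 * Fintype.card I1) (A : Finset I) (e : A × Bool → C1) (he : e.Injective) :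
    ∃ (f : A → I1) (τ : I1 × Bool ≃ C1), f.Injective ∧ ∀ i t, τ (f i, t) = e (i,t) := by
  have h1 := Fintype.card_le_of_injective e he
  rw [Fintype.card_prod, hc, Fintype.card_bool] at h1
  obtain ⟨f⟩ : Nonempty (A ↪ I1) := Function.Embedding.nonempty_of_card_le (by omega)
  obtain ⟨g, hg⟩ := equiv_extend (Y := I1 × Bool) (C := C1) (X := A × Bool) (by rw [Fintype.card_prod, hc, Fintype.card_bool]; ring)
    (Prod.map f id) (f.injective.prodMap Function.injective_id) e he
  exact ⟨f, g, f.injective, fun i t => hg (i,t)⟩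

section
variable {I I1 I2 C1 C2 : Type*} [Fintype I] [DecidableEq I] [Fintype I1] [DecidableEq I1] [Fintype I2] [DecidableEq I2]
  [Fintype C1] [DecidableEq C1] [Fintype C2] [DecidableEq C2]
  (S1 : Finset (C1 → Bool)) (S2 : Finset (C2 → Bool)) (S : Finset (C1 ⊕ C2 → Bool))

def actS (ρ : Equiv.Perm C1 × Equiv.Perm C2) : Equiv.Perm (C1 ⊕ C2) := Equiv.sumCongr ρ.1 ρ.2

lemma actS_sym (c c' : C1 ⊕ C2) (h : c.isLeft = c'.isLeft) (g : Equiv.Perm (C1 ⊕ C2) → ℝ) :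
    𝔼 ρ : Equiv.Perm C1 × Equiv.Perm C2, g (actS ρ) = 𝔼 ρ : Equiv.Perm C1 × Equiv.Perm C2, g (actS ρ * Equiv.swap c c') := by
  rcases c with a | a <;> rcases c' with a' | a'
  · symm
    refine Fintype.expect_equiv (Equiv.prodCongr (Equiv.mulRight (Equiv.swap a a')) (Equiv.refl _)) _ _ ?_
    intro ρ
    congr 1
    ext x
    rcases x with x | x
    · simp only [actS, Equiv.Perm.mul_apply, Equiv.prodCongr_apply, Prod.map, Equiv.coe_mulRight, Equiv.refl_apply, Equiv.sumCongr_apply, Sum.map_inl]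
      rw [Equiv.swap_apply_def, Equiv.swap_apply_def]
      simp only [Sum.inl.injEq]
      split_ifs <;> simp
    · simp [actS, Equiv.swap_apply_def]
  · simp at h
  · simp at h
  · symm
    refine Fintype.expect_equiv (Equiv.prodCongr (Equiv.refl _) (Equiv.mulRight (Equiv.swap a a'))) _ _ ?_
    intro ρ
    congr 1
    ext x
    rcases x with x | x
    · simp [actS, Equiv.swap_apply_def]
    · simp only [actS, Equiv.Perm.mul_apply, Equiv.prodCongr_apply, Prod.map, Equiv.coe_mulRight, Equiv.refl_apply, Equiv.sumCongr_apply, Sum.map_inr]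
      rw [Equiv.swap_apply_def, Equiv.swap_apply_def]
      simp only [Sum.inr.injEq]
      split_ifs <;> simp

lemma confT_perm {I1 C1 : Type*} [Fintype I1] [DecidableEq I1] [Fintype C1] [DecidableEq C1]
   (S1 : Finset (C1 → Bool)) (τ : I1 × Bool ≃ C1) :
    𝔼 ρ : Equiv.Perm C1, (mx S1 univ (ρ ∘ τ) : ℝ) = confT I1 S1 := by
  unfold confT
  refine Fintype.expect_equiv ⟨fun ρ => τ.trans ρ, fun g => τ.symm.trans g, ?_, ?_⟩ _ _ ?_
  · intro ρ; ext; simp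
  · intro ρ; ext; simp
  · intro ρ; rfl

/-- restrict cut count through embedding -/
lemma cutN_transfer {I I1 C1 : Type*} [DecidableEq I1] [Fintype I1] [DecidableEq I] (A : Finset I) (f : A → I1) (hf : f.Injective) (e : I × Bool → Bool)
    (e1 : I1 × Bool → C1) (s : C1 → Bool) (h : ∀ (i : A) t, e (i.1, t) = s (e1 (f i, t))) :
    cutN univ e1 s ≤ #{i ∈ A | e (i,false) ≠ e (i,true)} + (Fintype.card I1 - #A) := by
  unfold cutN
  rw [← Finset.card_filter_add_card_filter_not (s := univ.filter _) (fun i => i ∈ univ.image f)]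
  apply Nat.add_le_add
  · have : Finset.filter (fun i => i ∈ univ.image f) ({i | s (e1 (i, false)) ≠ s (e1 (i, true))} : Finset I1)
        = (univ.filter fun i : A => e (i.1,false) ≠ e (i.1,true)).image f := by
      ext x
      simp only [mem_filter, mem_univ, true_and, mem_image]
      constructor
      · rintro ⟨h1, i, rfl⟩; exact ⟨i, by rw [h, h]; exact h1, rfl⟩
      · rintro ⟨i, h1, rfl⟩; rw [h, h] at h1; exact ⟨h1, i, rfl⟩
    rw [this, card_image_of_injective _ hf]
    apply le_of_eq
    refine Finset.card_bij (fun i _ => i.1) ?_ ?_ ?_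
    · intro i hi; simp at hi ⊢; exact hi
    · intro i _ j _ hij; exact Subtype.ext hij
    · intro i hi; simp at hi; exact ⟨⟨i, hi.1⟩, by simpa using hi.2, rfl⟩
  · have : #(univ.image f) = #A := by rw [card_image_of_injective _ hf]; simp
    rw [← this, ← card_compl]
    apply card_le_card
    intro x hx
    simp only [mem_filter] at hx
    simpa using hx.2

lemma base_lemma (hc1 : Fintype.card C1 = 2 * Fintype.card I1) (hc2 : Fintype.card C2 = 2 * Fintype.card I2)
    (hI : Fintype.card I = Fintype.card I1 + Fintype.card I2)
    (hS1 : S1.Nonempty) (hS2 : S2.Nonempty) (hS : ∀ s1 ∈ S1, ∀ s2 ∈ S2, Sum.elim s1 s2 ∈ S)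
    (A : Finset I) (τ : I × Bool ≃ C1 ⊕ C2) (h0 : cutN A τ Sum.isLeft = 0) :
    confT I1 S1 + confT I2 S2 - #Aᶜ ≤ Phi actS S A τ := by
  classical
  unfold cutN at h0
  rw [Finset.card_eq_zero, Finset.filter_eq_empty_iff] at h0
  have h0' : ∀ i ∈ A, ∀ t, (τ (i,t)).isLeft = (τ (i,false)).isLeft := by
    intro i hi t
    have := h0 hi
    push Not at this
    cases t
    · rfl
    · exact this.symm
  set A1 := A.filter fun i => (τ (i,false)).isLeft = true with hA1
  set A2 := A.filter fun i => ¬ ((τ (i,false)).isLeft = true) with hA2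
  have hl : ∀ (p : A1 × Bool), (τ (p.1.1,p.2)).isLeft := by
    rintro ⟨⟨i, hi⟩, t⟩
    have := Finset.mem_filter.1 hi
    rw [h0' i this.1 t]; exact this.2
  have hr : ∀ (p : A2 × Bool), (τ (p.1.1,p.2)).isRight := by
    rintro ⟨⟨i, hi⟩, t⟩
    have := Finset.mem_filter.1 hi
    have h2 := h0' i this.1 t
    rw [← Sum.not_isLeft, h2]; simpa using this.2
  obtain ⟨f1, τ1, hf1, hτ1⟩ := completion hc1 A1 (fun p => (τ (p.1.1,p.2)).getLeft (hl p)) (by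
    intro p q h
    have h1 : Sum.inl ((τ (p.1.1,p.2)).getLeft (hl p)) = (Sum.inl ((τ (q.1.1,q.2)).getLeft (hl q)) : C1 ⊕ C2) := congrArg _ h
    rw [Sum.inl_getLeft, Sum.inl_getLeft] at h1
    have := τ.injective h1
    simp only [Prod.mk.injEq] at this
    exact Prod.ext (Subtype.ext this.1) this.2)
  obtain ⟨f2, τ2, hf2, hτ2⟩ := completion hc2 A2 (fun p => (τ (p.1.1,p.2)).getRight (hr p)) (by
    intro p q h
    have h1 : Sum.inr ((τ (p.1.1,p.2)).getRight (hr p)) = (Sum.inr ((τ (q.1.1,q.2)).getRight (hr q)) : C1 ⊕ C2) := congrArg _ h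
    rw [Sum.inr_getRight, Sum.inr_getRight] at h1
    have := τ.injective h1
    simp only [Prod.mk.injEq] at this
    exact Prod.ext (Subtype.ext this.1) this.2)
  have L1 : ∀ (i : A1) t, τ (i.1,t) = Sum.inl (τ1 (f1 i, t)) := by intro i t; rw [hτ1]; simp
  have L2 : ∀ (i : A2) t, τ (i.1,t) = Sum.inr (τ2 (f2 i, t)) := by intro i t; rw [hτ2]; simp
  have hAc : #A1 + #A2 = #A := Finset.card_filter_add_card_filter_not _
  have b1 : #A1 ≤ Fintype.card I1 := by
    have := Fintype.card_le_of_injective f1 hf1; simpa using this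
  have b2 : #A2 ≤ Fintype.card I2 := by
    have := Fintype.card_le_of_injective f2 hf2; simpa using this
  have main : ∀ ρ : Equiv.Perm C1 × Equiv.Perm C2, (mx S1 univ (ρ.1 ∘ τ1) : ℝ) + mx S2 univ (ρ.2 ∘ τ2) - #Aᶜ ≤ mx S A (actS ρ ∘ τ) := by
    intro ρ
    obtain ⟨s1, hs1, e1⟩ := Finset.exists_mem_eq_sup S1 hS1 (cutN univ (ρ.1 ∘ τ1))
    obtain ⟨s2, hs2, e2⟩ := Finset.exists_mem_eq_sup S2 hS2 (cutN univ (ρ.2 ∘ τ2))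
    have h3 : cutN A (actS ρ ∘ τ) (Sum.elim s1 s2) ≤ mx S A (actS ρ ∘ τ) :=
      Finset.le_sup (f := cutN A (actS ρ ∘ τ)) (hS s1 hs1 s2 hs2)
    have t1 := cutN_transfer A1 f1 hf1 (fun p => Sum.elim s1 s2 (actS ρ (τ p))) (ρ.1 ∘ τ1) s1 (by
      intro i t; simp [L1, actS])
    have t2 := cutN_transfer A2 f2 hf2 (fun p => Sum.elim s1 s2 (actS ρ (τ p))) (ρ.2 ∘ τ2) s2 (by
      intro i t; simp [L2, actS])
    have t3 : cutN A (actS ρ ∘ τ) (Sum.elim s1 s2) =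
      #{i ∈ A1 | Sum.elim s1 s2 (actS ρ (τ (i,false))) ≠ Sum.elim s1 s2 (actS ρ (τ (i,true)))} +
      #{i ∈ A2 | Sum.elim s1 s2 (actS ρ (τ (i,false))) ≠ Sum.elim s1 s2 (actS ρ (τ (i,true)))} := by
      unfold cutN
      rw [← Finset.card_filter_add_card_filter_not (s := A.filter _) (fun i => (τ (i,false)).isLeft = true)]
      congr 1
      · congr 1; ext i; simp only [hA1, mem_filter, Function.comp]; tauto
      · congr 1; ext i; simp only [hA2, mem_filter, Function.comp]; tauto
    have t4 : mx S1 univ (ρ.1 ∘ τ1) + mx S2 univ (ρ.2 ∘ τ2) ≤ mx S A (actS ρ ∘ τ) + #Aᶜ := by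
      unfold mx at h3 ⊢
      rw [e1, e2]
      rw [card_compl]
      have := Finset.card_le_univ A
      omega
    have : ((mx S1 univ (ρ.1 ∘ τ1) + mx S2 univ (ρ.2 ∘ τ2) : ℕ) : ℝ) ≤ ((mx S A (actS ρ ∘ τ) + #Aᶜ : ℕ) : ℝ) := by exact_mod_cast t4
    push_cast at this
    linarith
  have E1 : 𝔼 ρ : Equiv.Perm C1 × Equiv.Perm C2, (mx S1 univ (ρ.1 ∘ τ1) : ℝ) = confT I1 S1 := by
    rw [← confT_perm S1 τ1, ← Finset.univ_product_univ, Finset.expect_product]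
    simp
  have E2 : 𝔼 ρ : Equiv.Perm C1 × Equiv.Perm C2, (mx S2 univ (ρ.2 ∘ τ2) : ℝ) = confT I2 S2 := by
    rw [← confT_perm S2 τ2, ← Finset.univ_product_univ, Finset.expect_product]
    simp
  rw [← E1, ← E2]
  unfold Phi
  calc _ = 𝔼 ρ : Equiv.Perm C1 × Equiv.Perm C2, ((mx S1 univ (ρ.1 ∘ τ1) : ℝ) + mx S2 univ (ρ.2 ∘ τ2) - #Aᶜ) := by
        rw [Finset.expect_sub_distrib, Finset.expect_add_distrib, Finset.expect_const univ_nonempty]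
    _ ≤ _ := Finset.expect_le_expect fun ρ _ => main ρ

lemma superadd_T (hc1 : Fintype.card C1 = 2 * Fintype.card I1) (hc2 : Fintype.card C2 = 2 * Fintype.card I2)
    (hI : Fintype.card I = Fintype.card I1 + Fintype.card I2)
    (hS1 : S1.Nonempty) (hS2 : S2.Nonempty) (hS : ∀ s1 ∈ S1, ∀ s2 ∈ S2, Sum.elim s1 s2 ∈ S)
    (s : ℕ) (hs : 1 ≤ s) (hcs : Fintype.card C1 ≤ s^3) :
    confT I1 S1 + confT I2 S2 - 4 * s^2 ≤ confT I S := by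
  have hSne : S.Nonempty := by
    obtain ⟨s1, h1⟩ := hS1; obtain ⟨s2, h2⟩ := hS2
    exact ⟨_, hS s1 h1 s2 h2⟩
  have hne : Nonempty (I × Bool ≃ C1 ⊕ C2) := by
    refine ⟨Fintype.equivOfCardEq ?_⟩
    rw [Fintype.card_prod, Fintype.card_sum, Fintype.card_bool]; omega
  have key : ∀ τ : I × Bool ≃ C1 ⊕ C2, confT I1 S1 + confT I2 S2 - 4 * s^2 ≤ Phi actS S univ τ := by
    intro τ
    refine superadd_abs actS S Sum.isLeft (fun c c' h g => actS_sym c c' h g) hSne _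
      (fun A τ h0 => base_lemma S1 S2 S hc1 hc2 hI hS1 hS2 hS A τ h0) s hs τ (le_trans ?_ hcs)
    unfold cutN
    rw [← Finset.card_univ]
    have : #(univ.filter fun c : C1 ⊕ C2 => c.isLeft = true) = #(univ : Finset C1) := by
      symm
      refine Finset.card_bij (fun a _ => Sum.inl a) (by simp) (by simp) ?_
      intro c hc
      rcases c with a | a
      · exact ⟨a, by simp⟩
      · simp at hc
    rw [← this]
    refine Finset.card_le_card_of_injOn (fun i => if (τ (i,false)).isLeft = true then τ (i,false) else τ (i,true)) ?_ ?_
    · intro i hi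
      simp only [mem_coe, mem_filter, mem_univ, true_and] at hi ⊢
      split_ifs with h
      · exact h
      · cases h2 : (τ (i,true)).isLeft
        · simp_all
        · rfl
    · intro i hi j hj h
      simp only at h
      split_ifs at h <;> simpa using congrArg Prod.fst (τ.injective h)
  have h2 : 𝔼 τ : I × Bool ≃ C1 ⊕ C2, Phi actS S univ τ = confT I S := by
    unfold Phi
    rw [Finset.expect_comm]
    have : ∀ ρ : Equiv.Perm C1 × Equiv.Perm C2, 𝔼 τ : I × Bool ≃ C1 ⊕ C2, (mx S univ (actS ρ ∘ τ) : ℝ) = confT I S := by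
      intro ρ
      unfold confT
      refine Fintype.expect_equiv ⟨fun τ => τ.trans (actS ρ), fun τ => τ.trans (actS ρ).symm, ?_, ?_⟩ _ _ ?_
      · intro ρ; ext; simp
      · intro ρ; ext; simp
      · intro ρ; rfl
    rw [Finset.expect_congr rfl (fun ρ _ => this ρ), Finset.expect_const univ_nonempty]
  rw [← h2]
  exact Finset.le_expect univ_nonempty (fun τ _ => key τ)

end
end MC

open Finset MeasureTheory ProbabilityTheory
open scoped BigOperators
set_option linter.all false

namespace MC

lemma conv_superadd (a e : ℕ → ℝ) (P : Set ℕ) (D : ℝ)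
    (hsub : ∀ N0 ∈ P, ∀ N ∈ P, N0 ≤ N → N - N0 ∈ P)
    (ha0 : ∀ N, 0 ≤ a N) (hab : ∀ N ∈ P, a N ≤ D * N)
    (he : Filter.Tendsto (fun N : ℕ => e N / N) Filter.atTop (nhds 0))
    (he0 : ∀ N, 0 ≤ e N)
    (hs : ∀ N1 ∈ P, ∀ N2 ∈ P, a N1 + a N2 - e N1 ≤ a (N1 + N2))
    (hne : ∃ N ∈ P, 1 ≤ N) :
    ∃ l, Filter.Tendsto (fun N : ℕ => a N / N) (Filter.atTop ⊓ Filter.principal P) (nhds l) := by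
  have key : ∀ N0 ∈ P, 1 ≤ N0 → ∀ N, N ∈ P → ((N / N0 : ℕ) : ℝ) * (a N0 - e N0) ≤ a N := by
    intro N0 h0 h1 N
    induction N using Nat.strong_induction_on with
    | _ N ih =>
      intro hN
      by_cases h : N < N0
      · rw [Nat.div_eq_of_lt h]; simpa using ha0 N
      push Not at h
      have := ih (N - N0) (by omega) (hsub _ h0 _ hN h)
      have h2 := hs N0 h0 _ (hsub _ h0 _ hN h)
      rw [Nat.add_sub_cancel' h] at h2
      rw [Nat.div_eq_sub_div (by omega) h]
      push_cast
      linarith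
  set X : Set ℝ := (fun N : ℕ => (a N - e N) / N) '' {N | N ∈ P ∧ 1 ≤ N} with hX
  have hXb : BddAbove X := by
    refine ⟨D, ?_⟩
    rintro _ ⟨N, ⟨hN, h1⟩, rfl⟩
    have : (0:ℝ) < N := by exact_mod_cast h1
    simp only
    rw [div_le_iff₀ this]
    linarith [hab N hN, he0 N]
  have hXne : X.Nonempty := by
    obtain ⟨N, hN, h1⟩ := hne
    exact ⟨_, N, ⟨hN, h1⟩, rfl⟩
  refine ⟨sSup X, ?_⟩
  rw [Metric.tendsto_nhds]
  intro ε hε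
  obtain ⟨_, ⟨N0, ⟨hN0, h1⟩, rfl⟩, hlt⟩ := exists_lt_of_lt_csSup hXne (sub_lt_self (sSup X) (half_pos hε))
  have p0 : (0:ℝ) < N0 := by exact_mod_cast h1
  set b := a N0 - e N0 with hb
  have ev1 : ∀ᶠ N : ℕ in Filter.atTop, |b| / N < ε / 2 :=
    (tendsto_const_div_atTop_nhds_zero_nat |b|).eventually_lt_const (half_pos hε)
  have ev2 : ∀ᶠ N : ℕ in Filter.atTop, e N / N < ε := he.eventually_lt_const hε
  rw [Filter.eventually_inf_principal]
  filter_upwards [ev1, ev2, Filter.eventually_ge_atTop 1] with N e1 e2 hN1 hNP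
  have pN : (0:ℝ) < N := by exact_mod_cast hN1
  have up : (a N - e N) / N ≤ sSup X := le_csSup hXb ⟨N, ⟨hNP, hN1⟩, rfl⟩
  have lo := key N0 hN0 h1 N hNP
  have lo2 : N * (b / N0) - |b| ≤ a N := by
    refine le_trans ?_ lo
    have hq : (N:ℝ) = N0 * ((N / N0 : ℕ):ℝ) + ((N % N0 : ℕ) : ℝ) := by exact_mod_cast (Nat.div_add_mod N N0).symm
    have hr : ((N % N0 : ℕ) : ℝ) ≤ N0 := by exact_mod_cast (Nat.mod_lt N h1).le
    have hr0 : (0:ℝ) ≤ ((N % N0 : ℕ) : ℝ) := Nat.cast_nonneg _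
    have : N * (b / N0) = ((N / N0 : ℕ):ℝ) * b + ((N % N0 : ℕ) : ℝ) / N0 * b := by
      conv_lhs => rw [hq]
      field_simp
    rw [this]
    have h3 : ((N % N0 : ℕ) : ℝ) / N0 * b ≤ 1 * |b| := by
      have t0 : 0 ≤ ((N % N0 : ℕ) : ℝ) / N0 := by positivity
      have t1 : ((N % N0 : ℕ) : ℝ) / N0 ≤ 1 := by rw [div_le_one p0]; exact hr
      calc _ ≤ ((N % N0 : ℕ) : ℝ) / N0 * |b| := mul_le_mul_of_nonneg_left (le_abs_self b) t0
        _ ≤ _ := mul_le_mul_of_nonneg_right t1 (abs_nonneg b)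
    linarith
  have lo3 : b / N0 - |b| / N ≤ a N / N := by
    rw [le_div_iff₀ pN]
    have : (b / N0 - |b| / N) * N = N * (b / N0) - |b| := by field_simp
    linarith
  rw [Real.dist_eq, abs_lt]
  rw [sub_div] at up
  constructor <;> linarith

def SV (N k : ℕ) : Finset (Fin N → Bool) := univ.filter fun σ => #(univ.filter fun v => σ v = true) = k

def SC (N d k : ℕ) : Finset (Fin N × Fin d → Bool) := (SV N k).image fun σ c => σ c.1

noncomputable def confE (N d k : ℕ) : ℝ := confT (Fin (N * d / 2)) (SC N d k)

lemma SV_nonempty {N k : ℕ} (h : k ≤ N) : (SV N k).Nonempty := by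
  obtain ⟨t, -, ht⟩ := Finset.exists_subset_card_eq (s := (univ : Finset (Fin N))) (n := k) (by simpa using h)
  refine ⟨fun v => decide (v ∈ t), ?_⟩
  simp [SV, ht]

lemma SC_nonempty {N d k : ℕ} (h : k ≤ N) : (SC N d k).Nonempty := (SV_nonempty h).image _

lemma confT_equiv {I C C' : Type*} [Fintype C] [DecidableEq C] [Fintype C'] [DecidableEq C'] [Fintype I] [DecidableEq I]
    (S : Finset (C → Bool)) (φ : C' ≃ C) : confT I (S.image fun s => s ∘ φ) = confT I S := by
  unfold confT
  refine Fintype.expect_equiv ⟨fun τ => τ.trans φ, fun τ => τ.trans φ.symm, ?_, ?_⟩ _ _ ?_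
  · intro ρ; ext; simp
  · intro ρ; ext; simp
  · intro τ
    simp only [Equiv.coe_fn_mk]
    congr 1
    unfold mx
    rw [Finset.sup_image]
    rfl

lemma confE_superadd (N1 N2 d k1 k2 s : ℕ) (h1 : Even (N1 * d)) (h2 : Even (N2 * d)) (hk1 : k1 ≤ N1) (hk2 : k2 ≤ N2)
    (hs : 1 ≤ s) (hs3 : N1 * d ≤ s ^ 3) :
    confE N1 d k1 + confE N2 d k2 - 4 * s^2 ≤ confE (N1 + N2) d (k1 + k2) := by
  obtain ⟨a1, ha1⟩ := h1
  obtain ⟨a2, ha2⟩ := h2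
  set φ : (Fin N1 × Fin d) ⊕ (Fin N2 × Fin d) ≃ Fin (N1 + N2) × Fin d :=
    (Equiv.sumProdDistrib _ _ _).symm.trans (Equiv.prodCongr finSumFinEquiv (Equiv.refl _)) with hφ
  unfold confE
  rw [← confT_equiv (SC (N1+N2) d (k1+k2)) φ]
  refine superadd_T (SC N1 d k1) (SC N2 d k2) _ ?_ ?_ ?_ (SC_nonempty hk1) (SC_nonempty hk2) ?_ s hs (by simpa using hs3)
  · simp; omega
  · simp; omega
  · simp [add_mul]; omega
  · intro s1 hs1 s2 hs2
    obtain ⟨σ1, hσ1, rfl⟩ := Finset.mem_image.1 hs1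
    obtain ⟨σ2, hσ2, rfl⟩ := Finset.mem_image.1 hs2
    refine Finset.mem_image.2 ⟨fun c => Sum.elim σ1 σ2 (finSumFinEquiv.symm c.1), Finset.mem_image.2 ⟨fun v => Sum.elim σ1 σ2 (finSumFinEquiv.symm v), ?_, rfl⟩, ?_⟩
    · simp only [SV, mem_filter, mem_univ, true_and] at hσ1 hσ2 ⊢
      rw [Finset.card_filter, ← Equiv.sum_comp finSumFinEquiv, Fintype.sum_sum_type]
      simp only [Equiv.symm_apply_apply, Sum.elim_inl, Sum.elim_inr]
      rw [← Finset.card_filter, ← Finset.card_filter, hσ1, hσ2]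
    · funext c
      rcases c with c | c <;> simp [hφ]

lemma confE_nonneg (N d k : ℕ) : 0 ≤ confE N d k := by
  unfold confE confT
  exact Finset.expect_nonneg fun _ _ => Nat.cast_nonneg _

lemma confE_le (N d k : ℕ) : confE N d k ≤ d * N := by
  unfold confE confT
  have hm : ∀ τ : Fin (N*d/2) × Bool ≃ Fin N × Fin d, (mx (SC N d k) univ τ : ℝ) ≤ d * N := by
    intro τ
    have : mx (SC N d k) univ τ ≤ N * d := by
      unfold mx
      apply Finset.sup_le
      intro s _
      unfold cutN
      refine (Finset.card_le_univ _).trans ?_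
      simp; exact Nat.div_le_self _ _
    calc (mx (SC N d k) univ τ : ℝ) ≤ ((N * d : ℕ) : ℝ) := by exact_mod_cast this
      _ = _ := by push_cast; ring
  by_cases hne : (univ : Finset (Fin (N*d/2) × Bool ≃ Fin N × Fin d)).Nonempty
  · exact Finset.expect_le hne fun τ _ => hm τ
  · rw [Finset.not_nonempty_iff_eq_empty.1 hne, Finset.expect_empty]; positivity

/-- Inner limit for the configuration model. -/
lemma confE_lim (α : ℚ) (hα0 : 0 < α) (hα : α < 1 / 2) (d : ℕ) (hd : 0 < d) :
    ∃ l, Filter.Tendsto (fun N : ℕ => confE N d ⌊α * (N:ℚ)⌋₊ / N)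
      (Filter.atTop ⊓ Filter.principal {N | alphaIntegral α N ∧ Even (N * d)}) (nhds l) := by
  have hk : ∀ N : ℕ, ⌊α * (N:ℚ)⌋₊ ≤ N := by
    intro N
    apply Nat.floor_le_of_le
    have : (0:ℚ) ≤ N := Nat.cast_nonneg _
    nlinarith
  refine conv_superadd (fun N => confE N d ⌊α * (N:ℚ)⌋₊)
    (fun N => 4 * (⌈((N:ℝ) * d) ^ (1/3:ℝ)⌉₊ + 1 : ℕ)^2) _ d ?_ (fun N => confE_nonneg _ _ _) (fun N _ => confE_le _ _ _) ?_ ?_ ?_ ?_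
  · rintro N0 ⟨⟨k0, h0⟩, e0⟩ N ⟨⟨k, h1⟩, e1⟩ hle
    refine ⟨⟨k - k0, ?_⟩, ?_⟩
    · have : k0 ≤ k := by
        have : (k0:ℚ) ≤ k := by rw [← h0, ← h1]; gcongr
        exact_mod_cast this
      rw [Nat.cast_sub hle, Nat.cast_sub this, mul_sub, h0, h1]
    · rw [Nat.sub_mul]; exact Even.tsub e1 e0
  · have hb : ∀ N : ℕ, 1 ≤ N → 4 * ((⌈((N:ℝ) * d) ^ (1/3:ℝ)⌉₊ + 1 : ℕ):ℝ)^2 / N ≤ 36 * (d * ((N:ℝ)^(-(1/3):ℝ))) := by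
      intro N hN
      have pN : (1:ℝ) ≤ N := by exact_mod_cast hN
      have pd : (1:ℝ) ≤ d := by exact_mod_cast hd
      set x := ((N:ℝ) * d) ^ (1/3:ℝ) with hx
      have x1 : 1 ≤ x := Real.one_le_rpow (by nlinarith) (by norm_num)
      have c1 : (⌈x⌉₊ : ℝ) < x + 1 := Nat.ceil_lt_add_one (by linarith)
      have c2 : (((⌈x⌉₊ + 1 : ℕ)):ℝ) ≤ 3 * x := by push_cast; linarith
      have c3 : (((⌈x⌉₊ + 1 : ℕ)):ℝ)^2 ≤ (3*x)^2 := by gcongr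
      have x2 : x^2 ≤ N^(2/3:ℝ) * d := by
        rw [hx, ← Real.rpow_natCast, ← Real.rpow_mul (by positivity), Real.mul_rpow (by positivity) (by positivity)]
        norm_num
        gcongr
        calc (d:ℝ)^(2/3:ℝ) ≤ (d:ℝ)^(1:ℝ) := Real.rpow_le_rpow_of_exponent_le pd (by norm_num)
          _ = d := Real.rpow_one _
      rw [div_le_iff₀ (by linarith)]
      have : (N:ℝ)^(2/3:ℝ) = (N:ℝ)^(-(1/3):ℝ) * N := by
        conv_rhs => rw [← Real.rpow_one (N:ℝ), ← Real.rpow_mul (by positivity)]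
        rw [← Real.rpow_add (by linarith)]; norm_num
      rw [this] at x2
      nlinarith
    have ht : Filter.Tendsto (fun N : ℕ => 36 * (d * ((N:ℝ)^(-(1/3):ℝ)))) Filter.atTop (nhds 0) := by
      have := ((tendsto_rpow_neg_atTop (y := 1/3) (by norm_num)).comp tendsto_natCast_atTop_atTop).const_mul (36 * (d:ℝ))
      simpa [mul_assoc] using this
    refine squeeze_zero' (Filter.Eventually.of_forall fun N => by positivity) ?_ ht
    filter_upwards [Filter.eventually_ge_atTop 1] with N hN using hb N hN
  · intro N; positivity
  · rintro N1 ⟨⟨k1, h1⟩, e1⟩ N2 ⟨⟨k2, h2⟩, e2⟩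
    have f1 : ⌊α * (N1:ℚ)⌋₊ = k1 := by rw [h1]; simp
    have f2 : ⌊α * (N2:ℚ)⌋₊ = k2 := by rw [h2]; simp
    have f3 : ⌊α * ((N1 + N2 : ℕ):ℚ)⌋₊ = k1 + k2 := by
      push_cast; rw [mul_add, h1, h2]; exact_mod_cast Nat.floor_natCast (k1+k2)
    have := confE_superadd N1 N2 d k1 k2 (⌈((N1:ℝ) * d) ^ (1/3:ℝ)⌉₊ + 1) e1 e2 (f1 ▸ hk N1) (f2 ▸ hk N2) (by omega) (by
      have h3 : ((N1:ℝ) * d) ^ (1/3:ℝ) ≤ ((⌈((N1:ℝ) * d) ^ (1/3:ℝ)⌉₊ + 1 : ℕ) : ℝ) := by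
        push_cast; linarith [Nat.le_ceil (((N1:ℝ) * d) ^ (1/3:ℝ))]
      have h4 : (((N1:ℝ) * d) ^ (1/3:ℝ))^3 = (N1:ℝ) * d := by
        rw [← Real.rpow_natCast, ← Real.rpow_mul (by positivity)]; norm_num
      have h5 : (N1:ℝ) * d ≤ ((⌈((N1:ℝ) * d) ^ (1/3:ℝ)⌉₊ + 1 : ℕ) : ℝ)^3 := by
        rw [← h4]; gcongr; rw [h4]; exact h3
      exact_mod_cast h5)
    simp only [f1, f2, f3]
    exact this
  · refine ⟨2 * α.den, ⟨⟨2 * α.num.toNat, ?_⟩, ?_⟩, ?_⟩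
    · have hn : ((α.num.toNat : ℤ) : ℚ) = α.num := by
        rw [Int.toNat_of_nonneg (Rat.num_pos.2 hα0).le]
      have := Rat.mul_den_eq_num α
      push_cast at hn ⊢
      rw [hn, ← this]; ring
    · rw [mul_assoc]; exact even_two_mul _
    · have := α.den_pos; omega

end MC

open Finset MeasureTheory ProbabilityTheory
open scoped BigOperators
set_option linter.all false

namespace MC

lemma exp_taylor (x : ℝ) : |Real.exp x - 1 - x - x^2/2| ≤ |x|^3 * Real.exp |x| := by
  have h := Complex.norm_exp_sub_sum_le_norm_mul_exp (x:ℂ) 3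
  have e : Complex.exp (x:ℂ) - ∑ m ∈ range 3, (x:ℂ)^m / (m.factorial : ℂ) = ((Real.exp x - 1 - x - x^2/2 : ℝ) : ℂ) := by
    simp [Finset.sum_range_succ]; ring
  rw [e, Complex.norm_real, Complex.norm_real] at h
  simpa using h

lemma exp_taylor1 (x : ℝ) : |Real.exp x - 1| ≤ |x| * Real.exp |x| := by
  have h := Complex.norm_exp_sub_sum_le_norm_mul_exp (x:ℂ) 1
  have e : Complex.exp (x:ℂ) - ∑ m ∈ range 1, (x:ℂ)^m / (m.factorial : ℂ) = ((Real.exp x - 1 : ℝ) : ℂ) := by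
    simp
  rw [e, Complex.norm_real, Complex.norm_real] at h
  simpa using h

lemma exp_taylor2 (x : ℝ) : |Real.exp x - 1 - x| ≤ |x|^2 * Real.exp |x| := by
  have h := Complex.norm_exp_sub_sum_le_norm_mul_exp (x:ℂ) 2
  have e : Complex.exp (x:ℂ) - ∑ m ∈ range 2, (x:ℂ)^m / (m.factorial : ℂ) = ((Real.exp x - 1 - x : ℝ) : ℂ) := by
    simp [Finset.sum_range_succ]; ring
  rw [e, Complex.norm_real, Complex.norm_real] at h
  simpa using h

lemma log_taylor (y : ℝ) (hy : -(1/2) ≤ y) : |Real.log (1+y) - y + y^2/2| ≤ 4 * |y|^3 := by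
  by_cases h : y ≤ 1/2
  · have habs : |y| ≤ 1/2 := abs_le.2 ⟨hy, h⟩
    have h1 := Real.abs_log_sub_add_sum_range_le (x := -y) (by rw [abs_neg]; linarith) 2
    simp [Finset.sum_range_succ] at h1
    have e : -y + y^2/(1+1) + Real.log (1+y) = Real.log (1+y) - y + y^2/2 := by ring
    rw [e] at h1
    refine h1.trans ?_
    rw [div_le_iff₀ (by linarith)]
    have : 0 ≤ |y|^3 := by positivity
    nlinarith
  · push Not at h
    have h1 := Real.log_le_sub_one_of_pos (show 0 < 1 + y by linarith)
    have h2 : 0 ≤ Real.log (1+y) := Real.log_nonneg (by linarith)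
    rw [abs_of_pos (show 0 < y by linarith)]
    rw [abs_le]
    have h3 : y^2 ≥ y/2 := by nlinarith
    have h4 : y^3 ≥ y^2/2 := by nlinarith [sq_nonneg y]
    constructor <;> nlinarith

section
variable {K : Type*} (S : Finset K) (p : K → ℝ)

lemma holder_G (hp : ∀ σ ∈ S, 0 ≤ p σ) (h1 : ∑ σ ∈ S, p σ = 1) (G : K → ℝ) (hG : ∀ σ, 0 ≤ G σ) :
    (∑ σ ∈ S, p σ * G σ ^ 2) * (∑ σ ∈ S, p σ * G σ) ≤ ∑ σ ∈ S, p σ * G σ ^ 3 := by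
  have : (∑ σ ∈ S, p σ * G σ ^ 2) * (∑ σ ∈ S, p σ * G σ) ≤
      ∑ σ ∈ S, ∑ τ ∈ S, (p σ * p τ * (2/3 * G σ^3) + p σ * p τ * (1/3 * G τ ^3)) := by
    rw [Finset.sum_mul_sum]
    refine Finset.sum_le_sum fun σ hσ => Finset.sum_le_sum fun τ hτ => ?_
    have hpp : 0 ≤ p σ * p τ := mul_nonneg (hp σ hσ) (hp τ hτ)
    have : G σ ^2 * G τ ≤ 2/3 * G σ^3 + 1/3 * G τ ^3 := by
      have a := hG σ; have b := hG τ
      nlinarith [mul_nonneg (by linarith : 0 ≤ 2 * G σ + G τ) (sq_nonneg (G σ - G τ))]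
    nlinarith
  refine this.trans (le_of_eq ?_)
  simp only [Finset.sum_add_distrib]
  have e1 : ∀ σ ∈ S, p σ * (∑ τ ∈ S, p τ) * (2/3 * G σ ^3) = 2/3 * (p σ * G σ ^3) := by
    intro σ _; rw [h1]; ring
  have e2 : ∑ σ ∈ S, p σ * (∑ τ ∈ S, p τ * (1/3 * G τ^3)) = 1/3 * ∑ τ ∈ S, p τ * G τ^3 := by
    rw [← Finset.sum_mul, h1, one_mul, Finset.mul_sum]
    exact Finset.sum_congr rfl fun τ _ => by ring
  have e0 : ∑ σ ∈ S, ∑ τ ∈ S, p σ * p τ * (2/3 * G σ ^3) = 2/3 * ∑ σ ∈ S, p σ * G σ ^3 := by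
    rw [Finset.mul_sum]
    refine Finset.sum_congr rfl fun σ hσ => ?_
    rw [← e1 σ hσ, Finset.mul_sum, Finset.sum_mul]
  have e3 : ∑ σ ∈ S, ∑ τ ∈ S, p σ * p τ * (1/3 * G τ^3) = 1/3 * ∑ τ ∈ S, p τ * G τ^3 := by
    rw [← e2]
    refine Finset.sum_congr rfl fun σ hσ => ?_
    rw [Finset.mul_sum]
    exact Finset.sum_congr rfl fun τ _ => by ring
  rw [e0, e3]; ring

/-- second order cumulant expansion. -/
lemma cumulant (hp : ∀ σ ∈ S, 0 ≤ p σ) (h1 : ∑ σ ∈ S, p σ = 1) (X : K → ℝ) :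
    |Real.log (∑ σ ∈ S, p σ * Real.exp (X σ)) - ∑ σ ∈ S, p σ * X σ
      - 1/2 * (∑ σ ∈ S, p σ * X σ ^2 - (∑ σ ∈ S, p σ * X σ)^2)| ≤
      40 * ∑ σ ∈ S, p σ * (|X σ| * Real.exp |X σ|)^3 := by
  set G : K → ℝ := fun σ => |X σ| * Real.exp |X σ| with hG
  have hG0 : ∀ σ, 0 ≤ G σ := fun σ => by positivity
  set g1 := ∑ σ ∈ S, p σ * G σ with hg1
  set g2 := ∑ σ ∈ S, p σ * G σ ^ 2 with hg2
  set g3 := ∑ σ ∈ S, p σ * G σ ^ 3 with hg3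
  set m1 := ∑ σ ∈ S, p σ * X σ with hm1
  set m2 := ∑ σ ∈ S, p σ * X σ ^2 with hm2
  set M := ∑ σ ∈ S, p σ * Real.exp (X σ) with hM
  have p1 : 0 ≤ g1 := Finset.sum_nonneg fun σ hσ => mul_nonneg (hp σ hσ) (hG0 σ)
  have p2 : 0 ≤ g2 := Finset.sum_nonneg fun σ hσ => mul_nonneg (hp σ hσ) (by positivity)
  have p3 : 0 ≤ g3 := Finset.sum_nonneg fun σ hσ => mul_nonneg (hp σ hσ) (pow_nonneg (hG0 σ) 3)
  have hol : g2 * g1 ≤ g3 := holder_G S p hp h1 G hG0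
  have hcub : g1^3 ≤ g3 := by
    have := Real.pow_arith_mean_le_arith_mean_pow S p G hp h1 (fun σ _ => hG0 σ) 3
    simpa [hg1, hg3] using this
  have bound : ∀ (f F : K → ℝ), (∀ σ, |f σ| ≤ F σ) → |∑ σ ∈ S, p σ * f σ| ≤ ∑ σ ∈ S, p σ * F σ := by
    intro f F h
    refine (Finset.abs_sum_le_sum_abs _ _).trans (Finset.sum_le_sum fun σ hσ => ?_)
    rw [abs_mul, abs_of_nonneg (hp σ hσ)]
    exact mul_le_mul_of_nonneg_left (h σ) (hp σ hσ)
  have expge : ∀ σ, 1 ≤ Real.exp |X σ| := fun σ => Real.one_le_exp (abs_nonneg _)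
  have YB : |M - 1| ≤ g1 := by
    have e : M - 1 = ∑ σ ∈ S, p σ * (Real.exp (X σ) - 1) := by
      simp_rw [mul_sub, Finset.sum_sub_distrib, mul_one]; rw [h1]
    rw [e]
    exact bound _ _ fun σ => exp_taylor1 _
  have YX : |M - 1 - m1| ≤ g2 := by
    have e : M - 1 - m1 = ∑ σ ∈ S, p σ * (Real.exp (X σ) - 1 - X σ) := by
      simp_rw [mul_sub, Finset.sum_sub_distrib, mul_one]; rw [h1]
    rw [e]
    refine bound _ _ fun σ => (exp_taylor2 _).trans ?_
    rw [hG]; simp only; rw [mul_pow]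
    have := expge σ
    gcongr
    nlinarith
  have YXX : |M - 1 - m1 - m2/2| ≤ g3 := by
    have e : M - 1 - m1 - m2/2 = ∑ σ ∈ S, p σ * (Real.exp (X σ) - 1 - X σ - X σ^2/2) := by
      simp_rw [mul_sub, Finset.sum_sub_distrib, mul_one]; rw [h1]
      rw [hm2, Finset.sum_div]
      simp_rw [mul_div_assoc]
      rfl
    rw [e]
    refine bound _ _ fun σ => (exp_taylor _).trans ?_
    rw [hG]; simp only; rw [mul_pow]
    have := expge σ
    gcongr
    exact le_self_pow₀ this (by norm_num)
  have XB : |m1| ≤ g1 := by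
    refine bound _ _ fun σ => ?_
    have := expge σ
    rw [hG]; simp only
    exact le_mul_of_one_le_right (abs_nonneg _) this
  have sqB : |(M-1)^2 - m1^2| ≤ 2 * g3 := by
    have e : (M-1)^2 - m1^2 = (M - 1 - m1) * ((M-1) + m1) := by ring
    rw [e, abs_mul]
    have h2 : |(M-1) + m1| ≤ 2 * g1 := (abs_add_le _ _).trans (by linarith)
    calc _ ≤ g2 * (2 * g1) := mul_le_mul YX h2 (abs_nonneg _) p2
      _ ≤ _ := by linarith
  have logB : |Real.log M - (M-1) + (M-1)^2/2| ≤ 20 * g3 := by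
    by_cases hy : -(1/2) ≤ M - 1
    · have := log_taylor (M-1) hy
      rw [show 1 + (M-1) = M by ring] at this
      refine this.trans ?_
      have : |M-1|^3 ≤ g1^3 := by gcongr
      linarith
    · push Not at hy
      have Mpos : 0 < M := by
        apply lt_of_le_of_ne (Finset.sum_nonneg fun σ hσ => mul_nonneg (hp σ hσ) (Real.exp_pos _).le)
        intro h0
        have := (Finset.sum_eq_zero_iff_of_nonneg (fun σ hσ => mul_nonneg (hp σ hσ) (Real.exp_pos (X σ)).le)).1 h0.symm
        have h5 : ∑ σ ∈ S, p σ = 0 := Finset.sum_eq_zero fun σ hσ => by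
          have := this σ hσ
          rcases mul_eq_zero.1 this with h | h
          · exact h
          · exact absurd h (Real.exp_pos _).ne'
        rw [h1] at h5; norm_num at h5
      have jen : m1 ≤ Real.log M := by
        rw [Real.le_log_iff_exp_le Mpos]
        have := convexOn_exp.map_sum_le (t := S) (w := p) (p := X) hp h1 (fun _ _ => Set.mem_univ _)
        simpa [smul_eq_mul] using this
      have lneg : Real.log M ≤ M - 1 := Real.log_le_sub_one_of_pos Mpos
      have hg : 1/2 ≤ g1 := by
        have := neg_abs_le (M-1); linarith
      have hgg : g1 ≤ 4 * g1^3 := by nlinarith [sq_nonneg (g1 - 1/2)]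
      have := abs_le.1 XB
      have := abs_le.1 YB
      rw [abs_le]
      constructor <;> nlinarith
  have fin : Real.log M - m1 - 1/2 * (m2 - m1^2) = (Real.log M - (M-1) + (M-1)^2/2) + (M - 1 - m1 - m2/2) - 1/2*((M-1)^2 - m1^2) := by ring
  rw [fin]
  have := abs_le.1 logB
  have := abs_le.1 YXX
  have := abs_le.1 sqB
  rw [abs_le]
  constructor <;> linarith

end
end MC

open Finset MeasureTheory ProbabilityTheory
open scoped BigOperators
set_option linter.all false

namespace MC

section
variable {K : Type*} (S : Finset K)

noncomputable def LSE (W : K → ℝ) : ℝ := Real.log (∑ σ ∈ S, Real.exp (W σ))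
noncomputable def gib (W : K → ℝ) (σ : K) : ℝ := Real.exp (W σ) / ∑ σ ∈ S, Real.exp (W σ)
/-- quadratic functional -/
noncomputable def Qf (W : K → ℝ) (Rk : K → K → ℝ) : ℝ :=
  ∑ σ ∈ S, gib S W σ * Rk σ σ - ∑ σ ∈ S, ∑ σ' ∈ S, gib S W σ * gib S W σ' * Rk σ σ'

variable {S}

lemma Zpos (hS : S.Nonempty) (W : K → ℝ) : 0 < ∑ σ ∈ S, Real.exp (W σ) :=
  Finset.sum_pos (fun _ _ => Real.exp_pos _) hS

lemma gib_nonneg (hS : S.Nonempty) (W : K → ℝ) (σ : K) : 0 ≤ gib S W σ :=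
  div_nonneg (Real.exp_pos _).le (Zpos hS W).le

lemma gib_sum (hS : S.Nonempty) (W : K → ℝ) : ∑ σ ∈ S, gib S W σ = 1 := by
  unfold gib
  rw [← Finset.sum_div, div_self (Zpos hS W).ne']

lemma LSE_add (hS : S.Nonempty) (W X : K → ℝ) :
    LSE S (fun σ => W σ + X σ) - LSE S W = Real.log (∑ σ ∈ S, gib S W σ * Real.exp (X σ)) := by
  unfold LSE
  rw [← Real.log_div (Zpos hS _).ne' (Zpos hS _).ne']
  congr 1
  unfold gib
  rw [Finset.sum_div]
  refine Finset.sum_congr rfl fun σ _ => ?_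
  rw [Real.exp_add]; ring

lemma avg_abs_le {p : K → ℝ} (hp : ∀ σ ∈ S, 0 ≤ p σ) (h1 : ∑ σ ∈ S, p σ = 1) (f : K → ℝ) (B : ℝ) (h : ∀ σ ∈ S, |f σ| ≤ B) :
    |∑ σ ∈ S, p σ * f σ| ≤ B := by
  calc |∑ σ ∈ S, p σ * f σ| ≤ ∑ σ ∈ S, |p σ * f σ| := Finset.abs_sum_le_sum_abs _ _
    _ ≤ ∑ σ ∈ S, p σ * B := Finset.sum_le_sum fun σ hσ => by
        rw [abs_mul, abs_of_nonneg (hp σ hσ)]; exact mul_le_mul_of_nonneg_left (h σ hσ) (hp σ hσ)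
    _ = B := by rw [← Finset.sum_mul, h1, one_mul]

lemma LSE_lip (hS : S.Nonempty) (W W' : K → ℝ) (B : ℝ) (h : ∀ σ ∈ S, W σ ≤ W' σ + B) : LSE S W ≤ LSE S W' + B := by
  unfold LSE
  rw [← Real.log_exp B, ← Real.log_mul (Zpos hS _).ne' (Real.exp_pos B).ne']
  apply Real.log_le_log (Zpos hS _)
  rw [Finset.sum_mul]
  refine Finset.sum_le_sum fun σ hσ => ?_
  rw [← Real.exp_add]
  exact Real.exp_le_exp.2 (h σ hσ)

lemma LSE_ge (hS : S.Nonempty) (W : K → ℝ) : S.sup' hS W ≤ LSE S W := by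
  apply Finset.sup'_le
  intro σ hσ
  unfold LSE
  rw [Real.le_log_iff_exp_le (Zpos hS _)]
  exact Finset.single_le_sum (f := fun σ => Real.exp (W σ)) (fun _ _ => (Real.exp_pos _).le) hσ

lemma LSE_le (hS : S.Nonempty) (W : K → ℝ) : LSE S W ≤ S.sup' hS W + Real.log #S := by
  have h := LSE_lip hS W (fun _ => 0) (S.sup' hS W) (fun σ hσ => by
    have := Finset.le_sup' W hσ
    show W σ ≤ 0 + _
    linarith)
  have : LSE S (fun _ => 0) = Real.log #S := by unfold LSE; simp
  linarith

end

section
variable {Y : Type*} [DecidableEq Y]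

lemma offdiag_avg (F : Finset Y) (hF : 2 ≤ #F) (k : Y → Y → ℝ) (B : ℝ) (hB : ∀ p q, |k p q| ≤ B) :
    |𝔼 z ∈ F.offDiag, k z.1 z.2 - 𝔼 p ∈ F, 𝔼 q ∈ F, k p q| ≤ 2 * B / #F := by
  have m2 : (2:ℝ) ≤ #F := by exact_mod_cast hF
  set m : ℝ := ((#F : ℕ) : ℝ) with hm
  have hoff : (#F.offDiag : ℝ) = m * (m - 1) := by
    rw [Finset.offDiag_card, Nat.cast_sub (Nat.le_mul_self _)]; push_cast; ring
  set a := ∑ z ∈ F.offDiag, k z.1 z.2 with ha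
  set b := ∑ p ∈ F, k p p with hb
  have hall : ∑ p ∈ F, ∑ q ∈ F, k p q = b + a := by
    rw [← Finset.sum_product', ← Finset.diag_union_offDiag, Finset.sum_union (Finset.disjoint_diag_offDiag F)]
    congr 1
    rw [Finset.sum_diag]
  have e1 : 𝔼 z ∈ F.offDiag, k z.1 z.2 = a / (m * (m-1)) := by
    rw [Finset.expect_eq_sum_div_card, hoff]
  have e2 : 𝔼 p ∈ F, 𝔼 q ∈ F, k p q = (b + a) / (m * m) := by
    simp_rw [Finset.expect_eq_sum_div_card]
    rw [← Finset.sum_div, hall, div_div]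
  have ba : |a| ≤ m * (m-1) * B := by
    rw [← hoff]
    refine (Finset.abs_sum_le_sum_abs _ _).trans ?_
    rw [← nsmul_eq_mul]
    exact Finset.sum_le_card_nsmul _ _ _ fun z _ => hB _ _
  have bb : |b| ≤ m * B := by
    refine (Finset.abs_sum_le_sum_abs _ _).trans ?_
    rw [hm, ← nsmul_eq_mul]
    exact Finset.sum_le_card_nsmul _ _ _ fun z _ => hB _ _
  rw [e1, e2]
  have e3 : a / (m * (m-1)) - (b+a)/(m*m) = a / (m * m * (m-1)) - b/(m*m) := by
    have : m - 1 ≠ 0 := by linarith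
    field_simp; ring
  rw [e3]
  have q1 : |a / (m * m * (m-1))| ≤ B / m := by
    rw [abs_div, abs_of_pos (show 0 < m * m * (m-1) by apply mul_pos <;> nlinarith)]
    rw [div_le_div_iff₀ (by apply mul_pos <;> nlinarith) (by linarith)]
    calc |a| * m ≤ m * (m-1) * B * m := by gcongr
      _ = _ := by ring
  have q2 : |b / (m*m)| ≤ B / m := by
    rw [abs_div, abs_of_pos (show 0 < m * m by nlinarith), div_le_div_iff₀ (by nlinarith) (by linarith)]
    calc |b| * m ≤ m * B * m := by gcongr
      _ = _ := by ring
  calc _ ≤ |a / (m * m * (m-1))| + |b/(m*m)| := abs_sub _ _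
    _ ≤ B/m + B/m := by gcongr
    _ = _ := by ring

variable {K : Type*} {S : Finset K}

lemma edge_det (hS : S.Nonempty) (W : K → ℝ) (y : K → Y → ℝ) (hy : ∀ σ ∈ S, ∀ p, |y σ p| ≤ 2)
    (F : Finset Y) (hF : 2 ≤ #F) (Rb : K → K → ℝ) (hRb : ∀ σ ∈ S, ∀ σ' ∈ S, |Rb σ σ'| ≤ 4) (δ : ℝ) (hδ : 0 ≤ δ)
    (h1 : ∀ σ ∈ S, |𝔼 p ∈ F, y σ p| ≤ 2 * δ)
    (h2 : ∀ σ ∈ S, ∀ σ' ∈ S, |𝔼 p ∈ F, y σ p * y σ' p - Rb σ σ'| ≤ 4 * δ) (κ : ℝ) (hκ : 4 * |κ| ≤ 1) :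
    |𝔼 z ∈ F.offDiag, (LSE S (fun σ => W σ + κ * (y σ z.1 * y σ z.2)) - LSE S W)
      - 1/2 * κ^2 * Qf S W (fun σ σ' => Rb σ σ' ^2)| ≤
      70000 * |κ|^3 + 16 * |κ| / #F + 4 * |κ| * δ^2 + 32 * κ^2 * δ := by
  set p := gib S W with hp
  have p0 : ∀ σ ∈ S, 0 ≤ p σ := fun σ _ => gib_nonneg hS W σ
  have p1 : ∑ σ ∈ S, p σ = 1 := gib_sum hS W
  -- force boundedness off S by truncating y
  have hFne : F.Nonempty := Finset.card_pos.1 (by omega)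
  have hoffne : F.offDiag.Nonempty := by
    rw [← Finset.card_pos, Finset.offDiag_card]
    have : #F * 2 ≤ #F * #F := Nat.mul_le_mul_left _ hF
    omega
  set k : Y → Y → ℝ := fun a b => ∑ σ ∈ S, p σ * (κ * (y σ a * y σ b))
      + 1/2 * (∑ σ ∈ S, p σ * (κ * (y σ a * y σ b))^2 - (∑ σ ∈ S, p σ * (κ * (y σ a * y σ b)))^2) with hk
  have yy : ∀ σ ∈ S, ∀ a b, |κ * (y σ a * y σ b)| ≤ 4 * |κ| := by
    intro σ hσ a b
    rw [abs_mul, abs_mul]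
    have := mul_le_mul (hy σ hσ a) (hy σ hσ b) (abs_nonneg _) (by norm_num)
    nlinarith [abs_nonneg κ]
  have kap : |κ|^2 = κ^2 := sq_abs κ
  have cum : ∀ a b, |LSE S (fun σ => W σ + κ * (y σ a * y σ b)) - LSE S W - k a b| ≤ 70000 * |κ|^3 := by
    intro a b
    rw [LSE_add hS]
    have h := cumulant S p p0 p1 (fun σ => κ * (y σ a * y σ b))
    have e : ∀ x u v : ℝ, x - u - v = x - (u + v) := fun x u v => by ring
    rw [e] at h
    refine h.trans ?_
    have hb := avg_abs_le p0 p1 (fun σ => (|κ * (y σ a * y σ b)| * Real.exp |κ * (y σ a * y σ b)|)^3) ((12 * |κ|)^3) (by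
      intro σ hσ
      have h1 := yy σ hσ a b
      have h2 : Real.exp |κ * (y σ a * y σ b)| ≤ 3 := by
        calc _ ≤ Real.exp 1 := Real.exp_le_exp.2 (h1.trans hκ)
          _ ≤ 3 := by linarith [Real.exp_one_lt_d9]
      rw [abs_of_nonneg (by positivity)]
      have : |κ * (y σ a * y σ b)| * Real.exp |κ * (y σ a * y σ b)| ≤ 12 * |κ| := by
        calc _ ≤ 4 * |κ| * 3 := by gcongr
          _ = _ := by ring
      gcongr)
    have := (abs_le.1 hb).2
    have : 0 ≤ |κ|^3 := by positivity
    nlinarith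
  have kb : ∀ a b, |k a b| ≤ 8 * |κ| := by
    intro a b
    have b1 := avg_abs_le p0 p1 (fun σ => κ * (y σ a * y σ b)) (4 * |κ|) (fun σ hσ => yy σ hσ a b)
    have b2 := avg_abs_le p0 p1 (fun σ => (κ * (y σ a * y σ b))^2) (4 * |κ|) (fun σ hσ => by
      rw [abs_pow]
      have h1 := yy σ hσ a b
      have := abs_nonneg (κ * (y σ a * y σ b))
      nlinarith)
    set u := ∑ σ ∈ S, p σ * (κ * (y σ a * y σ b))
    have b3 : u^2 ≤ 4 * |κ| := by
      rw [← sq_abs]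
      have := abs_nonneg u
      nlinarith
    have := abs_le.1 b1
    have := abs_le.1 b2
    have := sq_nonneg u
    simp only [hk]
    rw [abs_le]
    constructor <;> linarith
  have off := offdiag_avg F hF k (8 * |κ|) kb
  -- full average
  have full : 𝔼 a ∈ F, 𝔼 b ∈ F, k a b = κ * ∑ σ ∈ S, p σ * (𝔼 a ∈ F, y σ a)^2
      + 1/2 * κ^2 * (∑ σ ∈ S, p σ * (𝔼 a ∈ F, y σ a * y σ a)^2
        - ∑ σ ∈ S, ∑ σ' ∈ S, p σ * p σ' * (𝔼 a ∈ F, y σ a * y σ' a)^2) := by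
    have E : ∀ f g : Y → ℝ, 𝔼 a ∈ F, 𝔼 b ∈ F, f a * g b = (𝔼 a ∈ F, f a) * (𝔼 b ∈ F, g b) := by
      intro f g; rw [Finset.expect_mul_expect]
    have t1 : 𝔼 a ∈ F, 𝔼 b ∈ F, ∑ σ ∈ S, p σ * (κ * (y σ a * y σ b)) = κ * ∑ σ ∈ S, p σ * (𝔼 a ∈ F, y σ a)^2 := by
      simp_rw [Finset.expect_sum_comm]
      rw [Finset.mul_sum]
      refine Finset.sum_congr rfl fun σ _ => ?_
      rw [sq, ← E, Finset.mul_expect, Finset.mul_expect]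
      refine Finset.expect_congr rfl fun a _ => ?_
      rw [Finset.mul_expect, Finset.mul_expect]
      exact Finset.expect_congr rfl fun b _ => by ring
    have t2 : 𝔼 a ∈ F, 𝔼 b ∈ F, ∑ σ ∈ S, p σ * (κ * (y σ a * y σ b))^2 = κ^2 * ∑ σ ∈ S, p σ * (𝔼 a ∈ F, y σ a * y σ a)^2 := by
      simp_rw [Finset.expect_sum_comm]
      rw [Finset.mul_sum]
      refine Finset.sum_congr rfl fun σ _ => ?_
      rw [sq (𝔼 a ∈ F, y σ a * y σ a), ← E, Finset.mul_expect, Finset.mul_expect]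
      refine Finset.expect_congr rfl fun a _ => ?_
      rw [Finset.mul_expect, Finset.mul_expect]
      exact Finset.expect_congr rfl fun b _ => by ring
    have t3 : 𝔼 a ∈ F, 𝔼 b ∈ F, (∑ σ ∈ S, p σ * (κ * (y σ a * y σ b)))^2 = κ^2 * ∑ σ ∈ S, ∑ σ' ∈ S, p σ * p σ' * (𝔼 a ∈ F, y σ a * y σ' a)^2 := by
      simp_rw [sq (∑ σ ∈ S, _), Finset.sum_mul_sum, Finset.expect_sum_comm]
      rw [Finset.mul_sum]
      refine Finset.sum_congr rfl fun σ _ => ?_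
      rw [Finset.mul_sum]
      refine Finset.sum_congr rfl fun σ' _ => ?_
      rw [sq (𝔼 a ∈ F, y σ a * y σ' a), ← E, Finset.mul_expect, Finset.mul_expect]
      refine Finset.expect_congr rfl fun a _ => ?_
      rw [Finset.mul_expect, Finset.mul_expect]
      exact Finset.expect_congr rfl fun b _ => by ring
    simp only [hk, Finset.expect_add_distrib, ← Finset.mul_expect, Finset.expect_sub_distrib]
    rw [t1, t2, t3]; ring
  have sqd : ∀ σ ∈ S, ∀ σ' ∈ S, |(𝔼 a ∈ F, y σ a * y σ' a)^2 - Rb σ σ'^2| ≤ 32 * δ := by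
    intro σ hσ σ' hσ'
    have a1 := h2 σ hσ σ' hσ'
    have a2 : |𝔼 a ∈ F, y σ a * y σ' a| ≤ 4 := by
      rw [abs_le]
      have : ∀ a, |y σ a * y σ' a| ≤ 4 := fun a => by
        rw [abs_mul]; nlinarith [hy σ hσ a, hy σ' hσ' a, abs_nonneg (y σ a), abs_nonneg (y σ' a)]
      exact ⟨Finset.le_expect hFne fun a _ => (abs_le.1 (this a)).1, Finset.expect_le hFne fun a _ => (abs_le.1 (this a)).2⟩
    have a3 := hRb σ hσ σ' hσ'
    rw [sq_sub_sq, abs_mul]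
    calc _ ≤ (4 + 4) * (4 * δ) := by
          apply mul_le_mul ((abs_add_le _ _).trans (add_le_add a2 a3)) a1 (abs_nonneg _) (by norm_num)
      _ = _ := by ring
  have d1 : |∑ σ ∈ S, p σ * (𝔼 a ∈ F, y σ a)^2| ≤ 4 * δ^2 := by
    apply avg_abs_le p0 p1
    intro σ hσ
    rw [abs_pow]
    calc _ ≤ (2*δ)^2 := by gcongr; exact h1 σ hσ
      _ = _ := by ring
  have d2 : |∑ σ ∈ S, p σ * (𝔼 a ∈ F, y σ a * y σ a)^2 - ∑ σ ∈ S, p σ * Rb σ σ^2| ≤ 32 * δ := by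
    rw [← Finset.sum_sub_distrib]
    simp_rw [← mul_sub]
    exact avg_abs_le p0 p1 _ _ fun σ hσ => sqd σ hσ σ hσ
  have d3 : |∑ σ ∈ S, ∑ σ' ∈ S, p σ * p σ' * (𝔼 a ∈ F, y σ a * y σ' a)^2 - ∑ σ ∈ S, ∑ σ' ∈ S, p σ * p σ' * Rb σ σ'^2| ≤ 32 * δ := by
    have : ∑ σ ∈ S, ∑ σ' ∈ S, p σ * p σ' * (𝔼 a ∈ F, y σ a * y σ' a)^2 - ∑ σ ∈ S, ∑ σ' ∈ S, p σ * p σ' * Rb σ σ'^2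
        = ∑ σ ∈ S, p σ * ∑ σ' ∈ S, p σ' * ((𝔼 a ∈ F, y σ a * y σ' a)^2 - Rb σ σ'^2) := by
      rw [← Finset.sum_sub_distrib]
      refine Finset.sum_congr rfl fun σ _ => ?_
      rw [← Finset.sum_sub_distrib, Finset.mul_sum]
      exact Finset.sum_congr rfl fun σ' _ => by ring
    rw [this]
    exact avg_abs_le p0 p1 _ _ fun σ hσ => avg_abs_le p0 p1 _ _ fun σ' hσ' => sqd σ hσ σ' hσ'
  have d4 : |𝔼 z ∈ F.offDiag, (LSE S (fun σ => W σ + κ * (y σ z.1 * y σ z.2)) - LSE S W) - 𝔼 z ∈ F.offDiag, k z.1 z.2| ≤ 70000 * |κ|^3 := by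
    rw [← Finset.expect_sub_distrib, abs_le]
    exact ⟨Finset.le_expect hoffne fun z _ => (abs_le.1 (cum z.1 z.2)).1, Finset.expect_le hoffne fun z _ => (abs_le.1 (cum z.1 z.2)).2⟩
  have d5 : |𝔼 a ∈ F, 𝔼 b ∈ F, k a b - 1/2 * κ^2 * Qf S W (fun σ σ' => Rb σ σ' ^2)| ≤ 4 * |κ| * δ^2 + 32 * κ^2 * δ := by
    rw [full]
    unfold Qf
    rw [← hp]
    set A1 := ∑ σ ∈ S, p σ * (𝔼 a ∈ F, y σ a)^2
    set A2 := ∑ σ ∈ S, p σ * (𝔼 a ∈ F, y σ a * y σ a)^2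
    set A3 := ∑ σ ∈ S, ∑ σ' ∈ S, p σ * p σ' * (𝔼 a ∈ F, y σ a * y σ' a)^2
    set B2 := ∑ σ ∈ S, p σ * Rb σ σ^2
    set B3 := ∑ σ ∈ S, ∑ σ' ∈ S, p σ * p σ' * Rb σ σ'^2
    have e : κ * A1 + 1/2 * κ^2 * (A2 - A3) - 1/2 * κ^2 * (B2 - B3) = κ * A1 + 1/2*κ^2 * ((A2 - B2) - (A3 - B3)) := by ring
    rw [e]
    have f1 : |κ * A1| ≤ |κ| * (4 * δ^2) := by rw [abs_mul]; gcongr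
    have f2 : |(A2 - B2) - (A3 - B3)| ≤ 64 * δ := (abs_sub _ _).trans (by linarith)
    have f3 : |1/2*κ^2 * ((A2 - B2) - (A3 - B3))| ≤ 1/2 * κ^2 * (64 * δ) := by
      rw [abs_mul, abs_of_nonneg (by positivity : 0 ≤ 1/2 * κ^2)]; gcongr
    calc _ ≤ _ := abs_add_le _ _
      _ ≤ |κ| * (4 * δ^2) + 1/2 * κ^2 * (64 * δ) := add_le_add f1 f3
      _ = _ := by ring
  have off' : 2 * (8 * |κ|) / (#F:ℝ) = 16 * |κ| / #F := by ring
  rw [off'] at off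
  have := abs_le.1 d4
  have := abs_le.1 d5
  have := abs_le.1 off
  rw [abs_le]
  constructor <;> linarith

end
end MC

open Finset MeasureTheory ProbabilityTheory
open scoped BigOperators
set_option linter.all false

namespace MC

section
variable {P C : Type*} [Fintype P] [DecidableEq P] [Fintype C] [DecidableEq C]

lemma exists_perm2 (p0 q0 p q : P) (h0 : p0 ≠ q0) (h : p ≠ q) :
    ∃ π : Equiv.Perm P, π p0 = p ∧ π q0 = q ∧ ∀ u, u ≠ p0 → u ≠ q0 → u ≠ p → u ≠ q → π u = u := by
  refine ⟨Equiv.swap (Equiv.swap p0 p q0) q * Equiv.swap p0 p, ?_, ?_, ?_⟩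
  · rw [Equiv.Perm.mul_apply, Equiv.swap_apply_left]
    apply Equiv.swap_apply_of_ne_of_ne _ h
    intro e
    have := (Equiv.swap p0 p).injective (e.symm.trans (Equiv.swap_apply_left p0 p).symm)
    exact h0 this.symm
  · rw [Equiv.Perm.mul_apply, Equiv.swap_apply_left]
  · intro u h1 h2 h3 h4
    rw [Equiv.Perm.mul_apply, Equiv.swap_apply_of_ne_of_ne h1 h3]
    apply Equiv.swap_apply_of_ne_of_ne _ h4
    intro e
    by_cases a : q0 = p
    · rw [a, Equiv.swap_apply_right] at e; exact h1 e
    · rw [Equiv.swap_apply_of_ne_of_ne h0.symm a] at e; exact h2 e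

lemma expect_trans (π : Equiv.Perm P) (f : (P ≃ C) → ℝ) : 𝔼 τ : P ≃ C, f (π.trans τ) = 𝔼 τ : P ≃ C, f τ := by
  refine Fintype.expect_equiv (Equiv.equivCongr π.symm (Equiv.refl C)) _ _ fun τ => ?_
  congr 1

lemma exch_pair (F : Finset P) (Φ : (P ≃ C) → P → P → ℝ)
    (hΦ : ∀ (π : Equiv.Perm P), (∀ u, u ∉ F → π u = u) → ∀ τ p q, Φ (π.trans τ) p q = Φ τ (π p) (π q))
    (p0 q0 : P) (hp0 : p0 ∈ F) (hq0 : q0 ∈ F) (h0 : p0 ≠ q0) :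
    𝔼 τ : P ≃ C, Φ τ p0 q0 = 𝔼 τ : P ≃ C, 𝔼 z ∈ F.offDiag, Φ τ z.1 z.2 := by
  have hne : F.offDiag.Nonempty := ⟨(p0, q0), by simp [hp0, hq0, h0]⟩
  rw [Finset.expect_comm]
  symm
  rw [Finset.expect_congr rfl (g := fun _ => 𝔼 τ : P ≃ C, Φ τ p0 q0), Finset.expect_const hne]
  intro z hz
  rw [Finset.mem_offDiag] at hz
  obtain ⟨π, h1, h2, h3⟩ := exists_perm2 p0 q0 z.1 z.2 h0 hz.2.2
  rw [← expect_trans π (fun τ => Φ τ p0 q0)]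
  refine Finset.expect_congr rfl fun τ _ => ?_
  rw [hΦ π _ τ p0 q0, h1, h2]
  intro u hu
  apply h3 <;> rintro rfl
  · exact hu hp0
  · exact hu hq0
  · exact hu hz.1
  · exact hu hz.2.1

lemma exch_one (hc : Fintype.card P = Fintype.card C) (g : C → ℝ) (p : P) :
    (Fintype.card C : ℝ) * 𝔼 τ : P ≃ C, g (τ p) = ∑ c, g c := by
  have : Nonempty (P ≃ C) := ⟨Fintype.equivOfCardEq hc⟩
  have h : ∀ q, 𝔼 τ : P ≃ C, g (τ q) = 𝔼 τ : P ≃ C, g (τ p) := by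
    intro q
    rw [← expect_trans (Equiv.swap q p) (fun τ => g (τ q))]
    refine Finset.expect_congr rfl fun τ _ => ?_
    simp
  have h2 : ∑ q : P, 𝔼 τ : P ≃ C, g (τ q) = ∑ c, g c := by
    rw [← Finset.expect_sum_comm]
    rw [Finset.expect_congr rfl (g := fun _ => ∑ c, g c), Finset.expect_const Finset.univ_nonempty]
    intro τ _
    exact Equiv.sum_comp τ g
  rw [← h2, Finset.sum_congr rfl (fun q _ => h q), Finset.sum_const, Finset.card_univ, hc, nsmul_eq_mul]

lemma exch_var (hc : Fintype.card P = Fintype.card C) (f : C → ℝ) (hf : ∑ c, f c = 0) (F : Finset P) :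
    (Fintype.card C : ℝ) * 𝔼 τ : P ≃ C, (∑ p ∈ F, f (τ p))^2 ≤ #F * ∑ c, f c ^2 := by
  have : Nonempty (P ≃ C) := ⟨Fintype.equivOfCardEq hc⟩
  have hoff : ∀ p q, p ≠ q → 𝔼 τ : P ≃ C, f (τ p) * f (τ q) ≤ 0 := by
    intro p q hpq
    have hs : ∀ q', p ≠ q' → 𝔼 τ : P ≃ C, f (τ p) * f (τ q') = 𝔼 τ : P ≃ C, f (τ p) * f (τ q) := by
      intro q' h
      obtain ⟨π, h1, h2, h3⟩ := exists_perm2 p q' p q h hpq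
      rw [← expect_trans π (fun τ => f (τ p) * f (τ q'))]
      refine Finset.expect_congr rfl fun τ _ => ?_
      simp [h1, h2]
    have hz : ∑ q', 𝔼 τ : P ≃ C, f (τ p) * f (τ q') = 0 := by
      rw [← Finset.expect_sum_comm]
      rw [Finset.expect_congr rfl (g := fun _ => (0:ℝ)), Finset.expect_const Finset.univ_nonempty]
      intro τ _
      rw [← Finset.mul_sum, Equiv.sum_comp τ f, hf, mul_zero]
    rw [← Finset.add_sum_erase _ _ (Finset.mem_univ p)] at hz
    rw [Finset.sum_congr rfl (fun q' hq' => hs q' (Finset.ne_of_mem_erase hq').symm), Finset.sum_const, nsmul_eq_mul] at hz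
    have h1 : 0 ≤ 𝔼 τ : P ≃ C, f (τ p) * f (τ p) := Finset.expect_nonneg fun τ _ => mul_self_nonneg _
    have h2 : 0 < #(Finset.univ.erase p) := Finset.card_pos.2 ⟨q, by simp [hpq.symm]⟩
    have h3 : (0:ℝ) < #(Finset.univ.erase p) := by exact_mod_cast h2
    by_contra hcon
    push Not at hcon
    nlinarith [mul_pos h3 hcon]
  have e1 : 𝔼 τ : P ≃ C, (∑ p ∈ F, f (τ p))^2 = ∑ p ∈ F, ∑ q ∈ F, 𝔼 τ : P ≃ C, f (τ p) * f (τ q) := by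
    simp_rw [sq, Finset.sum_mul_sum, Finset.expect_sum_comm]
  rw [e1, Finset.mul_sum, ← nsmul_eq_mul]
  apply Finset.sum_le_card_nsmul
  intro p hp
  have e2 : ∑ q ∈ F, 𝔼 τ : P ≃ C, f (τ p) * f (τ q) ≤ 𝔼 τ : P ≃ C, f (τ p)^2 := by
    rw [← Finset.add_sum_erase _ _ hp]
    have : ∑ q ∈ F.erase p, 𝔼 τ : P ≃ C, f (τ p) * f (τ q) ≤ 0 :=
      Finset.sum_nonpos fun q hq => hoff p q (Finset.ne_of_mem_erase hq).symm
    simp_rw [sq]; linarith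
  calc _ ≤ (Fintype.card C : ℝ) * 𝔼 τ : P ≃ C, f (τ p)^2 := by gcongr
    _ = _ := exch_one hc (fun c => f c^2) p
end

section
variable {P : Type*} [Fintype P] [DecidableEq P] {N d : ℕ}

noncomputable def nuv (F : Finset P) (τ : P ≃ Fin N × Fin d) (v : Fin N) : ℝ := 𝔼 p ∈ F, (if (τ p).1 = v then 1 else 0)
noncomputable def dlt (F : Finset P) (τ : P ≃ Fin N × Fin d) : ℝ := ∑ v, |nuv F τ v - 1 / N|

lemma nuv_sum (F : Finset P) (τ : P ≃ Fin N × Fin d) (f : Fin N → ℝ) :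
    𝔼 p ∈ F, f (τ p).1 = ∑ v, nuv F τ v * f v := by
  unfold nuv
  simp_rw [Finset.expect_mul]
  rw [← Finset.expect_sum_comm]
  refine Finset.expect_congr rfl fun p _ => ?_
  simp

lemma nuv_dev (F : Finset P) (τ : P ≃ Fin N × Fin d) (f : Fin N → ℝ) (B : ℝ) (hB : ∀ v, |f v| ≤ B) :
    |𝔼 p ∈ F, f (τ p).1 - (∑ v, f v) / N| ≤ B * dlt F τ := by
  rw [nuv_sum, Finset.sum_div, ← Finset.sum_sub_distrib]
  refine (Finset.abs_sum_le_sum_abs _ _).trans ?_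
  unfold dlt
  rw [Finset.mul_sum]
  refine Finset.sum_le_sum fun v _ => ?_
  have : nuv F τ v * f v - f v / N = f v * (nuv F τ v - 1/N) := by ring
  rw [this, abs_mul]
  gcongr
  exact hB v

lemma nuv_tot (F : Finset P) (hF : F.Nonempty) (τ : P ≃ Fin N × Fin d) : ∑ v, nuv F τ v = 1 := by
  have := nuv_sum F τ (fun _ => 1)
  rw [Finset.expect_const hF] at this
  simpa using this.symm

lemma nuv_nonneg (F : Finset P) (τ : P ≃ Fin N × Fin d) (v) : 0 ≤ nuv F τ v :=
  Finset.expect_nonneg fun p _ => by split_ifs <;> norm_num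

lemma dlt_nonneg (F : Finset P) (τ : P ≃ Fin N × Fin d) : 0 ≤ dlt F τ := Finset.sum_nonneg fun _ _ => abs_nonneg _

lemma dlt_le (hN : 0 < N) (F : Finset P) (hF : F.Nonempty) (τ : P ≃ Fin N × Fin d) : dlt F τ ≤ 2 := by
  have hN' : (0:ℝ) < N := by exact_mod_cast hN
  calc dlt F τ ≤ ∑ v : Fin N, (nuv F τ v + 1/N) := Finset.sum_le_sum fun v _ => by
        rw [abs_le]; have := nuv_nonneg F τ v; have : (0:ℝ) < 1/N := by positivity
        constructor <;> linarith
    _ = 2 := by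
        rw [Finset.sum_add_distrib, nuv_tot F hF]; simp; field_simp; norm_num

lemma dlt_sq (hN : 0 < N) (hd : 0 < d) (hc : Fintype.card P = N * d) (F : Finset P) (hF : F.Nonempty) :
    𝔼 τ : P ≃ Fin N × Fin d, dlt F τ ^2 ≤ N / #F := by
  have hN' : (0:ℝ) < N := by exact_mod_cast hN
  have hd' : (0:ℝ) < d := by exact_mod_cast hd
  have hm' : (0:ℝ) < #F := by exact_mod_cast Finset.card_pos.2 hF
  have hc' : Fintype.card P = Fintype.card (Fin N × Fin d) := by simp [hc]
  have h1 : ∀ v : Fin N, 𝔼 τ : P ≃ Fin N × Fin d, (nuv F τ v - 1/N)^2 ≤ (1:ℝ) / (#F * N) := by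
    intro v
    have ind : ∑ c : Fin N × Fin d, (if c.1 = v then (1:ℝ) else 0) = d := by
      rw [Fintype.sum_prod_type]
      rw [Finset.sum_congr rfl (g := fun x => if x = v then (d:ℝ) else 0)]
      · simp
      · intro x _
        by_cases h : x = v <;> simp [h]
    set f : Fin N × Fin d → ℝ := fun c => (if c.1 = v then 1 else 0) - 1/N with hf
    have s0 : ∑ c, f c = 0 := by
      simp only [hf, Finset.sum_sub_distrib]
      rw [ind]
      simp; field_simp; norm_num
    have s2 : ∑ c, f c^2 ≤ d := by
      have : ∑ c, f c^2 = d - d / N := by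
        have : ∀ c, f c^2 = (if c.1 = v then 1 else 0) * (1 - 2/N) + 1/N^2 := by
          intro c; simp only [hf]; split_ifs <;> ring
        simp only [this, Finset.sum_add_distrib]
        rw [← Finset.sum_mul, ind]
        simp; field_simp; ring
      rw [this]
      have : (0:ℝ) ≤ d / N := by positivity
      linarith
    have hv := exch_var hc' f s0 F
    have e : ∀ τ : P ≃ Fin N × Fin d, ∑ p ∈ F, f (τ p) = #F * (nuv F τ v - 1/N) := by
      intro τ
      simp only [hf, nuv, Finset.sum_sub_distrib, Finset.expect_eq_sum_div_card]
      rw [mul_sub, mul_div_cancel₀ _ hm'.ne']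
      simp
    simp_rw [e, mul_pow] at hv
    rw [← Finset.mul_expect] at hv
    have : ((Fintype.card (Fin N × Fin d) : ℕ) : ℝ) = N * d := by simp
    rw [this] at hv
    set E := 𝔼 τ : P ≃ Fin N × Fin d, (nuv F τ v - 1/N)^2
    rw [le_div_iff₀ (by positivity)]
    have h3 : N * d * ((#F:ℝ)^2 * E) ≤ #F * d := hv.trans (by gcongr)
    have h4 : (#F * d : ℝ) * (E * (#F * N)) ≤ (#F * d : ℝ) * 1 := by nlinarith
    exact le_of_mul_le_mul_left h4 (by positivity)
  calc 𝔼 τ : P ≃ Fin N × Fin d, dlt F τ ^2 ≤ 𝔼 τ : P ≃ Fin N × Fin d, (N:ℝ) * ∑ v, (nuv F τ v - 1/N)^2 := by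
        refine Finset.expect_le_expect fun τ _ => ?_
        unfold dlt
        have := sq_sum_le_card_mul_sum_sq (s := (Finset.univ : Finset (Fin N))) (f := fun v => |nuv F τ v - 1/N|)
        simpa using this
    _ = (N:ℝ) * ∑ v, 𝔼 τ : P ≃ Fin N × Fin d, (nuv F τ v - 1/N)^2 := by
        rw [← Finset.mul_expect, Finset.expect_sum_comm]
    _ ≤ N * ∑ v : Fin N, (1:ℝ) / (#F * N) := by gcongr with v; exact h1 v
    _ = N / #F := by simp; field_simp
end
end MC

open Finset MeasureTheory ProbabilityTheory
open scoped BigOperators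
set_option linter.all false

namespace MC

noncomputable def rt4 (x : ℝ) : ℝ := Real.sqrt (Real.sqrt x)

lemma rt4_pow {x : ℝ} (hx : 0 ≤ x) : rt4 x ^ 4 = x := by
  unfold rt4
  calc _ = ((Real.sqrt (Real.sqrt x))^2)^2 := by ring
    _ = x := by rw [Real.sq_sqrt (Real.sqrt_nonneg _), Real.sq_sqrt hx]

lemma rt4_nonneg (x : ℝ) : 0 ≤ rt4 x := Real.sqrt_nonneg _

lemma rt4_mono {x y : ℝ} (h : x ≤ y) : rt4 x ≤ rt4 y := Real.sqrt_le_sqrt (Real.sqrt_le_sqrt h)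

lemma rt4_mul {x y : ℝ} (hx : 0 ≤ x) : rt4 (x * y) = rt4 x * rt4 y := by
  unfold rt4
  rw [Real.sqrt_mul hx, Real.sqrt_mul (Real.sqrt_nonneg _)]

lemma qbound (N m : ℝ) (hN : 0 < N) (hm : 1 ≤ m) (q : ℝ) (h1 : q ≤ 1) (h2 : q ≤ N / m) :
    q ≤ 4 * rt4 N ^3 * (rt4 m - rt4 (m - 1)) := by
  set t := rt4 N
  set s := rt4 m
  set s' := rt4 (m-1)
  have ht : t^4 = N := rt4_pow hN.le
  have hs : s^4 = m := rt4_pow (by linarith)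
  have hs' : s'^4 = m-1 := rt4_pow (by linarith)
  have t0 : 0 ≤ t := rt4_nonneg _
  have s0' : 0 ≤ s' := rt4_nonneg _
  have ss : s' ≤ s := rt4_mono (by linarith)
  have s0 : 0 < s := by
    rcases (rt4_nonneg m).lt_or_eq with h | h
    · exact h
    · exfalso; have : s = 0 := h.symm
      rw [this] at hs; norm_num at hs; linarith
  have k1 : 1 ≤ 4 * (s - s') * s^3 := by
    have e : 1 = (s - s') * (s^3 + s^2*s' + s*s'^2 + s'^3) := by
      have : s^4 - s'^4 = 1 := by rw [hs, hs']; ring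
      nlinarith
    have a1 : s^2 * s' ≤ s^3 := by calc _ ≤ s^2*s := by gcongr
                                    _ = _ := by ring
    have a2 : s * s'^2 ≤ s^3 := by calc _ ≤ s*s^2 := by gcongr
                                    _ = _ := by ring
    have a3 : s'^3 ≤ s^3 := by gcongr
    calc 1 = (s - s') * (s^3 + s^2*s' + s*s'^2 + s'^3) := e
      _ ≤ (s - s') * (4 * s^3) := by
          apply mul_le_mul_of_nonneg_left _ (by linarith); linarith
      _ = _ := by ring
  have k2 : q * s^3 ≤ t^3 := by
    by_cases h : s ≤ t
    · calc q * s^3 ≤ 1 * s^3 := by gcongr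
        _ ≤ t^3 := by rw [one_mul]; gcongr
    · push Not at h
      rw [← ht, ← hs, le_div_iff₀ (by positivity)] at h2
      have : q * s^3 * s ≤ t^3 * s := by
        calc _ = q * s^4 := by ring
          _ ≤ t^4 := h2
          _ = t^3 * t := by ring
          _ ≤ t^3 * s := by gcongr
      exact le_of_mul_le_mul_right this s0
  by_cases hq : q ≤ 0
  · refine hq.trans ?_
    have : 0 ≤ s - s' := by linarith
    positivity
  push Not at hq
  have : q ≤ q * (4 * (s - s') * s^3) := by nlinarith
  calc q ≤ (q * s^3) * (4 * (s - s')) := by linarith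
    _ ≤ t^3 * (4 * (s - s')) := by gcongr
    _ = _ := by ring

section
variable {K : Type*} {S : Finset K} {N d h : ℕ}

noncomputable def usum (x : K → Fin N → ℝ) (τ : Fin h × Bool ≃ Fin N × Fin d) (r : ℕ) (σ : K) : ℝ :=
  ∑ i : Fin h with i.1 < r, x σ (τ (i, true)).1 * x σ (τ (i, false)).1

noncomputable def Rb (x : K → Fin N → ℝ) (σ σ' : K) : ℝ := (∑ v, x σ v * x σ' v) / N

noncomputable def edgeErr (N h : ℕ) (κ η : ℝ) (r : ℕ) : ℝ :=
  70000 * |κ|^3 + 16 * κ^2 * η + (32 * |κ| + 64 * κ^2 / η) * (4 * rt4 N ^3 * (rt4 (2 * h - 2 * r) - rt4 (2 * h - 2 * (r + 1))))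

def freeP (h r : ℕ) : Finset (Fin h × Bool) := univ.filter fun p => r ≤ p.1.1

lemma freeP_card (r : ℕ) (hr : r ≤ h) : #(freeP h r) = 2 * (h - r) := by
  have : freeP h r = (univ.filter fun i : Fin h => r ≤ i.1) ×ˢ (univ : Finset Bool) := by
    ext p; simp [freeP]
  rw [this, Finset.card_product]
  have h2 := Finset.card_filter_add_card_filter_not (s := (univ : Finset (Fin h))) (fun i => r ≤ i.1)
  have h3 : #(univ.filter fun i : Fin h => ¬ r ≤ i.1) = r := by
    simp only [not_le]
    rw [Fin.card_filter_val_lt]; omega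
  rw [h3] at h2
  simp at h2 ⊢
  omega

lemma usum_succ (x : K → Fin N → ℝ) (τ : Fin h × Bool ≃ Fin N × Fin d) (r : ℕ) (hr : r < h) (σ : K) :
    usum x τ (r+1) σ = usum x τ r σ + x σ (τ (⟨r, hr⟩, true)).1 * x σ (τ (⟨r, hr⟩, false)).1 := by
  unfold usum
  have : (univ.filter fun i : Fin h => i.1 < r + 1) = insert ⟨r, hr⟩ (univ.filter fun i : Fin h => i.1 < r) := by
    ext i; simp [Fin.ext_iff]; omega
  rw [this, Finset.sum_insert (by simp)]; ring

lemma edge_step (hS : S.Nonempty) (hN : 0 < N) (hd : 0 < d) (hh : 2 * h = N * d) (x : K → Fin N → ℝ)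
    (hx : ∀ σ ∈ S, ∀ v, |x σ v| ≤ 2) (hx0 : ∀ σ ∈ S, ∑ v, x σ v = 0) (W : K → ℝ) (κ : ℝ) (hκ : 4 * |κ| ≤ 1) (η : ℝ) (hη : 0 < η)
    (r : ℕ) (hr : r < h) :
    |𝔼 τ : Fin h × Bool ≃ Fin N × Fin d, (LSE S (fun σ => W σ + κ * usum x τ (r+1) σ) - LSE S (fun σ => W σ + κ * usum x τ r σ)
      - 1/2 * κ^2 * Qf S (fun σ => W σ + κ * usum x τ r σ) (fun σ σ' => Rb x σ σ' ^2))| ≤ edgeErr N h κ η r := by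
  have hc : Fintype.card (Fin h × Bool) = N * d := by simp; omega
  have : Nonempty (Fin h × Bool ≃ Fin N × Fin d) := ⟨Fintype.equivOfCardEq (by simp; omega)⟩
  set F := freeP h r with hF
  have cF : #F = 2 * (h - r) := freeP_card r hr.le
  have F2 : 2 ≤ #F := by omega
  have Fne : F.Nonempty := Finset.card_pos.1 (by omega)
  have mF : (#F : ℝ) = 2 * h - 2 * r := by rw [cF]; push_cast [Nat.cast_sub hr.le]; ring
  have m2 : (2:ℝ) ≤ #F := by exact_mod_cast F2
  have hN' : (0:ℝ) < N := by exact_mod_cast hN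
  have N1 : (1:ℝ) ≤ N := by exact_mod_cast hN
  set D : (Fin h × Bool ≃ Fin N × Fin d) → (Fin h × Bool) → (Fin h × Bool) → ℝ := fun τ p q =>
    LSE S (fun σ => (W σ + κ * usum x τ r σ) + κ * (x σ (τ p).1 * x σ (τ q).1)) - LSE S (fun σ => W σ + κ * usum x τ r σ) with hD
  have ex := exch_pair F D (by
    intro π hπ τ p q
    have hu : ∀ σ, usum x (Equiv.trans π τ) r σ = usum x τ r σ := by
      intro σ
      unfold usum
      refine Finset.sum_congr rfl fun i hi => ?_
      have hi' : i.1 < r := by simpa using hi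
      have : ∀ b, π (i, b) = (i, b) := fun b => hπ _ (by simp [hF, freeP, hi'])
      simp [this]
    simp only [hD, hu]
    rfl) (⟨r, hr⟩, true) (⟨r, hr⟩, false) (by simp [hF, freeP]) (by simp [hF, freeP]) (by simp)
  have e1 : 𝔼 τ : Fin h × Bool ≃ Fin N × Fin d, (LSE S (fun σ => W σ + κ * usum x τ (r+1) σ) - LSE S (fun σ => W σ + κ * usum x τ r σ)
      - 1/2 * κ^2 * Qf S (fun σ => W σ + κ * usum x τ r σ) (fun σ σ' => Rb x σ σ' ^2))
      = 𝔼 τ : Fin h × Bool ≃ Fin N × Fin d, (𝔼 z ∈ F.offDiag, D τ z.1 z.2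
        - 1/2 * κ^2 * Qf S (fun σ => W σ + κ * usum x τ r σ) (fun σ σ' => Rb x σ σ' ^2)) := by
    rw [Finset.expect_sub_distrib, Finset.expect_sub_distrib (s := univ) (f := fun τ => 𝔼 z ∈ F.offDiag, D τ z.1 z.2), ← ex]
    congr 1
    refine Finset.expect_congr rfl fun τ _ => ?_
    simp only [hD, usum_succ x τ r hr]
    congr 2
    ext σ; ring
  have hRb : ∀ σ ∈ S, ∀ σ' ∈ S, |Rb x σ σ'| ≤ 4 := by
    intro σ hσ σ' hσ'
    unfold Rb
    rw [abs_div, abs_of_pos hN', div_le_iff₀ hN']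
    calc |∑ v, x σ v * x σ' v| ≤ ∑ v, |x σ v * x σ' v| := Finset.abs_sum_le_sum_abs _ _
      _ ≤ ∑ v : Fin N, (4:ℝ) := Finset.sum_le_sum fun v _ => by
          rw [abs_mul]; nlinarith [hx σ hσ v, hx σ' hσ' v, abs_nonneg (x σ v), abs_nonneg (x σ' v)]
      _ = 4 * N := by simp; ring
  have pt : ∀ τ : Fin h × Bool ≃ Fin N × Fin d, |𝔼 z ∈ F.offDiag, D τ z.1 z.2
        - 1/2 * κ^2 * Qf S (fun σ => W σ + κ * usum x τ r σ) (fun σ σ' => Rb x σ σ' ^2)|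
        ≤ 70000 * |κ|^3 + 16 * |κ| / #F + 4 * |κ| * dlt F τ^2 + 32 * κ^2 * dlt F τ := by
    intro τ
    apply edge_det hS (fun σ => W σ + κ * usum x τ r σ) (fun σ p => x σ (τ p).1) (fun σ hσ p => hx σ hσ _) F F2
      (Rb x) hRb (dlt F τ) (dlt_nonneg F τ) _ _ κ hκ
    · intro σ hσ
      have := nuv_dev F τ (x σ) 2 (hx σ hσ)
      rwa [hx0 σ hσ, zero_div, sub_zero] at this
    · intro σ hσ σ' hσ'
      exact nuv_dev F τ (fun v => x σ v * x σ' v) 4 (fun v => by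
        rw [abs_mul]; nlinarith [hx σ hσ v, hx σ' hσ' v, abs_nonneg (x σ v), abs_nonneg (x σ' v)])
  rw [e1]
  set E2 := 𝔼 τ : Fin h × Bool ≃ Fin N × Fin d, dlt F τ^2 with hE2
  have b1 : E2 ≤ N / #F := dlt_sq hN hd hc F Fne
  have b2 : E2 ≤ 4 := Finset.expect_le Finset.univ_nonempty fun τ _ => by
    have := dlt_le hN F Fne τ
    have := dlt_nonneg F τ
    nlinarith
  set qq := 4 * rt4 N ^3 * (rt4 (2 * h - 2 * r) - rt4 (2 * h - 2 * (r + 1))) with hqq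
  have q1 : ∀ q : ℝ, q ≤ 1 → q ≤ N / #F → q ≤ qq := by
    intro q u1 u2
    rw [mF] at u2 m2
    refine (qbound N _ hN' (by linarith) q u1 u2).trans ?_
    rw [hqq]
    have h1 : rt4 (2 * (h:ℝ) - 2 * (r + 1)) ≤ rt4 (2 * h - 2 * r - 1) := rt4_mono (by linarith)
    have h2 : 0 ≤ 4 * rt4 (N:ℝ) ^ 3 := by have := rt4_nonneg (N:ℝ); positivity
    apply mul_le_mul_of_nonneg_left _ h2
    linarith
  have b3 : E2 ≤ 4 * qq := by
    have := q1 (E2/4) (by linarith) (by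
      have : 0 ≤ (N:ℝ) / #F := by positivity
      linarith)
    linarith
  have b4 : 1 / (#F:ℝ) ≤ qq := q1 _ (by rw [div_le_one (by linarith)]; linarith) (by gcongr)
  have b5 : 𝔼 τ : Fin h × Bool ≃ Fin N × Fin d, dlt F τ ≤ 1/2 * (η + E2 / η) := by
    have : 𝔼 τ : Fin h × Bool ≃ Fin N × Fin d, 1/2 * (η + dlt F τ^2 / η) = 1/2 * (η + E2 / η) := by
      rw [← Finset.mul_expect, Finset.expect_add_distrib, Finset.expect_const Finset.univ_nonempty, hE2, Finset.expect_div]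
    rw [← this]
    refine Finset.expect_le_expect fun τ _ => ?_
    have : 1/2 * (η + dlt F τ^2 / η) - dlt F τ = 1/2 * (η - dlt F τ)^2 / η := by field_simp; ring
    have : 0 ≤ 1/2 * (η - dlt F τ)^2 / η := by positivity
    linarith
  calc _ ≤ 𝔼 τ : Fin h × Bool ≃ Fin N × Fin d, |𝔼 z ∈ F.offDiag, D τ z.1 z.2
        - 1/2 * κ^2 * Qf S (fun σ => W σ + κ * usum x τ r σ) (fun σ σ' => Rb x σ σ' ^2)| := Finset.abs_expect_le _ _
    _ ≤ 𝔼 τ : Fin h × Bool ≃ Fin N × Fin d, (70000 * |κ|^3 + 16 * |κ| / #F + 4 * |κ| * dlt F τ^2 + 32 * κ^2 * dlt F τ) :=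
        Finset.expect_le_expect fun τ _ => pt τ
    _ = 70000 * |κ|^3 + 16 * |κ| / #F + 4 * |κ| * E2 + 32 * κ^2 * 𝔼 τ : Fin h × Bool ≃ Fin N × Fin d, dlt F τ := by
        rw [Finset.expect_add_distrib, Finset.expect_add_distrib, Finset.expect_const Finset.univ_nonempty,
          ← Finset.mul_expect, ← Finset.mul_expect]
    _ ≤ 70000 * |κ|^3 + 16 * |κ| * qq + 4 * |κ| * (4 * qq) + 32 * κ^2 * (1/2 * (η + (4 * qq) / η)) := by
        have : 16 * |κ| / (#F:ℝ) = 16 * |κ| * (1 / #F) := by ring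
        rw [this]
        gcongr
        exact b5.trans (by gcongr)
    _ = edgeErr N h κ η r := by
        unfold edgeErr
        rw [← hqq]; field_simp; ring
end
end MC

open Finset MeasureTheory ProbabilityTheory
open scoped BigOperators
set_option linter.all false

namespace MC

noncomputable def g3 (z : ℝ) : ℝ := (|z| * Real.exp |z|)^3

lemma g3_nonneg (z : ℝ) : 0 ≤ g3 z := by unfold g3; positivity
lemma g3_cont : Continuous g3 := by unfold g3; fun_prop

lemma g3_scale (s z : ℝ) (h0 : 0 ≤ s) (h1 : s ≤ 1) : g3 (s * z) ≤ s^3 * g3 z := by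
  unfold g3
  rw [← mul_pow, abs_mul, abs_of_nonneg h0, mul_assoc]
  have : s * |z| ≤ |z| := by nlinarith [abs_nonneg z]
  gcongr

lemma g3_int : Integrable g3 (gaussianReal 0 1) := by
  have h1 := integrable_exp_mul_gaussianReal (μ := 0) (v := 1) 4
  have h2 := integrable_exp_mul_gaussianReal (μ := 0) (v := 1) (-4)
  refine Integrable.mono' ((h1.add h2).const_mul 6) g3_cont.aestronglyMeasurable (Filter.Eventually.of_forall fun z => ?_)
  rw [Real.norm_eq_abs, abs_of_nonneg (g3_nonneg z)]
  have a := Real.pow_div_factorial_le_exp |z| (abs_nonneg z) 3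
  have e1 : g3 z ≤ 6 * Real.exp (4 * |z|) := by
    have : Real.exp (4 * |z|) = Real.exp |z| * Real.exp |z|^3 := by
      rw [← Real.exp_nat_mul, ← Real.exp_add]; congr 1; push_cast; ring
    unfold g3
    rw [this, mul_pow]
    have b : |z|^3 ≤ 6 * Real.exp |z| := by
      have : ((Nat.factorial 3 : ℕ):ℝ) = 6 := by norm_num [Nat.factorial]
      rw [this, div_le_iff₀ (by norm_num)] at a
      linarith
    have := mul_le_mul_of_nonneg_right b (by positivity : 0 ≤ Real.exp |z|^3)
    linarith
  refine e1.trans ?_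
  have : Real.exp (4 * |z|) ≤ Real.exp (4 * z) + Real.exp (-4 * z) := by
    rcases abs_cases z with ⟨h, _⟩ | ⟨h, _⟩ <;> rw [h]
    · linarith [Real.exp_pos (-4*z)]
    · have : 4 * -z = -4 * z := by ring
      rw [this]; linarith [Real.exp_pos (4*z)]
  simp only [Pi.add_apply]
  linarith

noncomputable def Cg : ℝ := ∫ z, g3 z ∂(gaussianReal 0 1)
lemma Cg_nonneg : 0 ≤ Cg := integral_nonneg g3_nonneg

section
variable {E : Type*} [NormedAddCommGroup E] [NormedSpace ℝ E] [MeasurableSpace E] [BorelSpace E]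
  (μ : Measure E) [IsGaussian μ] (hμ : ∀ L : StrongDual ℝ E, ∫ ω, L ω ∂μ = 0)

lemma gmap (hμ : ∀ L : StrongDual ℝ E, ∫ ω, L ω ∂μ = 0) (L : StrongDual ℝ E) :
    μ.map L = gaussianReal 0 (∫ ω, L ω * L ω ∂μ).toNNReal := by
  rw [IsGaussian.map_eq_gaussianReal L, hμ L]
  congr 2
  rw [variance_eq_integral (by fun_prop), hμ L]
  congr 1; ext ω; ring

lemma g3L (hμ : ∀ L : StrongDual ℝ E, ∫ ω, L ω ∂μ = 0) (L : StrongDual ℝ E) (s : ℝ) (h0 : 0 ≤ s) (h1 : s ≤ 1)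
    (hs : ∫ ω, L ω * L ω ∂μ ≤ s^2) :
    Integrable (fun ω => g3 (L ω)) μ ∧ ∫ ω, g3 (L ω) ∂μ ≤ s^3 * Cg := by
  have hm := gmap μ hμ L
  set v := (∫ ω, L ω * L ω ∂μ).toNNReal with hv
  set t := Real.sqrt v with ht
  have t0 : 0 ≤ t := Real.sqrt_nonneg _
  have ts : t ≤ s := by
    rw [ht, Real.sqrt_le_left h0, hv, Real.coe_toNNReal']
    exact max_le hs (by positivity)
  have hm2 : gaussianReal 0 v = (gaussianReal 0 1).map (fun z => t * z) := by
    rw [gaussianReal_map_const_mul]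
    congr 1
    · simp
    · ext
      simp [ht]
  rw [hm2] at hm
  have I1 : Integrable (fun z => g3 (t * z)) (gaussianReal 0 1) := by
    refine Integrable.mono' g3_int (by have := g3_cont; fun_prop) (Filter.Eventually.of_forall fun z => ?_)
    rw [Real.norm_eq_abs, abs_of_nonneg (g3_nonneg _)]
    refine (g3_scale t z t0 (ts.trans h1)).trans ?_
    have : t^3 ≤ 1 := pow_le_one₀ t0 (ts.trans h1)
    nlinarith [g3_nonneg z]
  have I2 : Integrable g3 (μ.map L) := by
    rw [hm, integrable_map_measure g3_cont.aestronglyMeasurable (by fun_prop)]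
    exact I1
  constructor
  · exact (integrable_map_measure g3_cont.aestronglyMeasurable (by fun_prop)).1 I2
  · rw [← integral_map (φ := L) (by fun_prop) g3_cont.aestronglyMeasurable, hm,
      integral_map (by fun_prop) g3_cont.aestronglyMeasurable]
    unfold Cg
    rw [← integral_const_mul]
    refine integral_mono I1 (g3_int.const_mul _) fun z => ?_
    refine (g3_scale t z t0 (ts.trans h1)).trans ?_
    have := g3_nonneg z
    show t^3 * g3 z ≤ s^3 * g3 z
    gcongr

variable {K : Type*} {S : Finset K}

lemma LSE_int (hS : S.Nonempty) (W : K → ℝ) (L : K → StrongDual ℝ E) :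
    Integrable (fun ω => LSE S (fun σ => W σ + L σ ω)) μ := by
  have hc : Continuous (fun ω => LSE S (fun σ => W σ + L σ ω)) := by
    unfold LSE
    apply Continuous.log
    · fun_prop
    · intro ω; exact (Zpos hS _).ne'
  have hb : ∀ ω, |LSE S (fun σ => W σ + L σ ω) - LSE S W| ≤ ∑ σ ∈ S, |L σ ω| := by
    intro ω
    have hs : ∀ σ ∈ S, |L σ ω| ≤ ∑ σ ∈ S, |L σ ω| := fun σ hσ =>
      Finset.single_le_sum (f := fun σ => |L σ ω|) (fun _ _ => abs_nonneg _) hσ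
    have h1 := LSE_lip hS (fun σ => W σ + L σ ω) W (∑ σ ∈ S, |L σ ω|) (fun σ hσ => by
      have := hs σ hσ; have := le_abs_self (L σ ω); linarith)
    have h2 := LSE_lip hS W (fun σ => W σ + L σ ω) (∑ σ ∈ S, |L σ ω|) (fun σ hσ => by
      have := hs σ hσ; have := neg_abs_le (L σ ω); linarith)
    rw [abs_le]; constructor <;> linarith
  have I : Integrable (fun ω => ∑ σ ∈ S, |L σ ω|) μ :=
    integrable_finset_sum _ fun σ _ => (IsGaussian.integrable_dual μ (L σ)).abs
  have I2 : Integrable (fun ω => LSE S (fun σ => W σ + L σ ω) - LSE S W) μ :=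
    Integrable.mono' I (hc.sub continuous_const).aestronglyMeasurable (Filter.Eventually.of_forall fun ω => hb ω)
  have := I2.add (integrable_const (LSE S W))
  refine this.congr (Filter.Eventually.of_forall fun ω => ?_)
  simp

lemma gauss_step (hμ : ∀ L : StrongDual ℝ E, ∫ ω, L ω ∂μ = 0) (hS : S.Nonempty) (W : K → ℝ) (L : K → StrongDual ℝ E) (κ : ℝ) (hκ : 4 * |κ| ≤ 1)
    (R : K → K → ℝ) (hR : ∀ σ ∈ S, R σ σ ≤ 16) (hL : ∀ σ ∈ S, ∀ σ' ∈ S, ∫ ω, L σ ω * L σ' ω ∂μ = κ^2 * R σ σ') :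
    |∫ ω, (LSE S (fun σ => W σ + L σ ω) - LSE S W) ∂μ - 1/2 * κ^2 * Qf S W R| ≤ 40 * (4 * |κ|)^3 * Cg := by
  set p := gib S W with hp
  have p0 : ∀ σ ∈ S, 0 ≤ p σ := fun σ _ => gib_nonneg hS W σ
  have p1 : ∑ σ ∈ S, p σ = 1 := gib_sum hS W
  have i1 : ∀ σ, Integrable (fun ω => L σ ω) μ := fun σ => IsGaussian.integrable_dual μ (L σ)
  have i2 : ∀ σ σ', Integrable (fun ω => L σ ω * L σ' ω) μ := fun σ σ' =>
    (IsGaussian.memLp_dual μ (L σ) 2 (by simp)).integrable_mul (IsGaussian.memLp_dual μ (L σ') 2 (by simp))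
  have hg : ∀ σ ∈ S, Integrable (fun ω => g3 (L σ ω)) μ ∧ ∫ ω, g3 (L σ ω) ∂μ ≤ (4 * |κ|)^3 * Cg := by
    intro σ hσ
    apply g3L μ hμ (L σ) (4 * |κ|) (by positivity) hκ
    rw [hL σ hσ σ hσ, mul_pow, sq_abs]
    nlinarith [hR σ hσ, sq_nonneg κ]
  set k : E → ℝ := fun ω => ∑ σ ∈ S, p σ * L σ ω + 1/2 * (∑ σ ∈ S, p σ * (L σ ω * L σ ω) - ∑ σ ∈ S, ∑ σ' ∈ S, p σ * p σ' * (L σ ω * L σ' ω)) with hk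
  have ik1 : Integrable (fun ω => ∑ σ ∈ S, p σ * L σ ω) μ := integrable_finset_sum _ fun σ _ => (i1 σ).const_mul _
  have ik2 : Integrable (fun ω => ∑ σ ∈ S, p σ * (L σ ω * L σ ω)) μ := integrable_finset_sum _ fun σ _ => (i2 σ σ).const_mul _
  have ik3 : Integrable (fun ω => ∑ σ ∈ S, ∑ σ' ∈ S, p σ * p σ' * (L σ ω * L σ' ω)) μ :=
    integrable_finset_sum _ fun σ _ => integrable_finset_sum _ fun σ' _ => (i2 σ σ').const_mul _
  have ik4 : Integrable (fun ω => 1/2 * (∑ σ ∈ S, p σ * (L σ ω * L σ ω) - ∑ σ ∈ S, ∑ σ' ∈ S, p σ * p σ' * (L σ ω * L σ' ω))) μ :=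
    (ik2.sub ik3).const_mul _
  have ik : Integrable k μ := ik1.add ((ik2.sub ik3).const_mul _)
  have kint : ∫ ω, k ω ∂μ = 1/2 * κ^2 * Qf S W R := by
    simp only [hk]
    rw [integral_add ik1 ik4, integral_const_mul, integral_sub ik2 ik3]
    rw [integral_finset_sum _ fun σ _ => (i1 σ).const_mul _, integral_finset_sum _ fun σ _ => (i2 σ σ).const_mul _,
      integral_finset_sum _ fun σ _ => integrable_finset_sum _ fun σ' _ => (i2 σ σ').const_mul _]
    have e1 : ∑ σ ∈ S, ∫ ω, p σ * L σ ω ∂μ = 0 := Finset.sum_eq_zero fun σ _ => by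
      rw [integral_const_mul, hμ, mul_zero]
    have e2 : ∑ σ ∈ S, ∫ ω, p σ * (L σ ω * L σ ω) ∂μ = κ^2 * ∑ σ ∈ S, p σ * R σ σ := by
      rw [Finset.mul_sum]
      exact Finset.sum_congr rfl fun σ hσ => by rw [integral_const_mul, hL σ hσ σ hσ]; ring
    have e3 : ∑ σ ∈ S, ∫ ω, ∑ σ' ∈ S, p σ * p σ' * (L σ ω * L σ' ω) ∂μ = κ^2 * ∑ σ ∈ S, ∑ σ' ∈ S, p σ * p σ' * R σ σ' := by
      rw [Finset.mul_sum]
      refine Finset.sum_congr rfl fun σ hσ => ?_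
      rw [integral_finset_sum _ fun σ' _ => (i2 σ σ').const_mul _, Finset.mul_sum]
      exact Finset.sum_congr rfl fun σ' hσ' => by rw [integral_const_mul, hL σ hσ σ' hσ']; ring
    rw [e1, e2, e3]
    unfold Qf
    ring
  have ilse : Integrable (fun ω => LSE S (fun σ => W σ + L σ ω) - LSE S W) μ :=
    (LSE_int μ hS W L).sub (integrable_const _)
  rw [← kint, ← integral_sub ilse ik]
  have ig : Integrable (fun ω => 40 * ∑ σ ∈ S, p σ * g3 (L σ ω)) μ :=
    (integrable_finset_sum _ fun σ hσ => ((hg σ hσ).1.const_mul _)).const_mul _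
  calc |∫ ω, (LSE S (fun σ => W σ + L σ ω) - LSE S W - k ω) ∂μ|
      ≤ ∫ ω, |LSE S (fun σ => W σ + L σ ω) - LSE S W - k ω| ∂μ := abs_integral_le_integral_abs
    _ ≤ ∫ ω, 40 * ∑ σ ∈ S, p σ * g3 (L σ ω) ∂μ := by
        refine integral_mono (ilse.sub ik).abs ig fun ω => ?_
        have h := cumulant S p p0 p1 (fun σ => L σ ω)
        show |LSE S (fun σ => W σ + L σ ω) - LSE S W - k ω| ≤ 40 * ∑ σ ∈ S, p σ * g3 (L σ ω)
        rw [LSE_add hS]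
        have e : k ω = ∑ σ ∈ S, p σ * L σ ω + 1/2 * (∑ σ ∈ S, p σ * (L σ ω)^2 - (∑ σ ∈ S, p σ * L σ ω)^2) := by
          simp only [hk]
          have : (∑ σ ∈ S, p σ * L σ ω)^2 = ∑ σ ∈ S, ∑ σ' ∈ S, p σ * p σ' * (L σ ω * L σ' ω) := by
            rw [sq, Finset.sum_mul_sum]
            exact Finset.sum_congr rfl fun σ _ => Finset.sum_congr rfl fun σ' _ => by ring
          rw [this]
          simp only [sq]
        rw [e, ← sub_sub]
        exact h
    _ = 40 * ∑ σ ∈ S, p σ * ∫ ω, g3 (L σ ω) ∂μ := by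
        rw [integral_const_mul, integral_finset_sum _ fun σ hσ => ((hg σ hσ).1.const_mul _)]
        simp_rw [integral_const_mul]
    _ ≤ 40 * ∑ σ ∈ S, p σ * ((4 * |κ|)^3 * Cg) := by
        gcongr with σ hσ
        · exact p0 σ hσ
        · exact (hg σ hσ).2
    _ = 40 * (4 * |κ|)^3 * Cg := by rw [← Finset.sum_mul, p1]; ring

variable [SecondCountableTopology E] [CompleteSpace E]

/-- rotation: integral of `f (√(a) ω + √(b) ω')` -/
lemma gauss_split (hμ : ∀ L : StrongDual ℝ E, ∫ ω, L ω ∂μ = 0) (f : E → ℝ) (hf : Continuous f) (a b : ℝ) (hab : a^2 + b^2 = 1)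
    (hi : Integrable f μ) :
    Integrable (fun z : E × E => f (a • z.1 + b • z.2)) (μ.prod μ) ∧
    ∫ ω, f ω ∂μ = ∫ ω, ∫ ω', f (a • ω + b • ω') ∂μ ∂μ := by
  obtain ⟨θ, h1, h2⟩ : ∃ θ, Real.cos θ = a ∧ Real.sin θ = b := by
    have hz : (⟨a, b⟩ : ℂ) ≠ 0 := by
      intro h
      have h1 := congrArg Complex.re h
      have h2 := congrArg Complex.im h
      simp at h1 h2
      rw [h1, h2] at hab; norm_num at hab
    have hn : ‖(⟨a, b⟩ : ℂ)‖ = 1 := by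
      rw [← sq_eq_sq₀ (norm_nonneg _) zero_le_one, ← Complex.normSq_eq_norm_sq, Complex.normSq_mk]; linarith
    refine ⟨Complex.arg ⟨a, b⟩, ?_, ?_⟩
    · rw [Complex.cos_arg hz, hn]; simp
    · rw [Complex.sin_arg, hn]; simp
  have hrot := IsGaussian.map_rotation_eq_self_of_forall_strongDual_eq_zero (μ := μ) hμ θ
  have i0 : Integrable (fun z : E × E => f z.1) (μ.prod μ) := by
    have := (measurePreserving_fst (μ := μ) (ν := μ)).integrable_comp hf.aestronglyMeasurable (g := f)
    exact this.2 hi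
  have hm : AEMeasurable (ContinuousLinearMap.rotation θ : E × E → E × E) (μ.prod μ) := by fun_prop
  have sm : ∀ ν : Measure (E × E), AEStronglyMeasurable (fun z : E × E => f z.1) ν := fun ν => by
    have : Continuous (fun z : E × E => f z.1) := hf.comp continuous_fst
    exact this.aestronglyMeasurable
  have i1 : Integrable (fun z : E × E => f (a • z.1 + b • z.2)) (μ.prod μ) := by
    have i0' := i0
    rw [← hrot, integrable_map_measure (sm _) hm] at i0'
    refine i0'.congr (Filter.Eventually.of_forall fun z => ?_)
    simp [ContinuousLinearMap.rotation_apply, h1, h2]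
  refine ⟨i1, ?_⟩
  calc ∫ ω, f ω ∂μ = ∫ z, f z.1 ∂(μ.prod μ) := by
        rw [integral_fun_fst]; simp
    _ = ∫ z, f (a • z.1 + b • z.2) ∂(μ.prod μ) := by
        conv_lhs => rw [← hrot]
        rw [integral_map hm (sm _)]
        refine integral_congr_ae (Filter.Eventually.of_forall fun z => ?_)
        simp [ContinuousLinearMap.rotation_apply, h1, h2]
    _ = _ := integral_prod _ i1
end
end MC

open Finset MeasureTheory ProbabilityTheory
open scoped BigOperators
set_option linter.all false

namespace MC

section
variable {E : Type*} [NormedAddCommGroup E] [NormedSpace ℝ E] [MeasurableSpace E] [BorelSpace E]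
  (μ : Measure E) [IsGaussian μ] [SecondCountableTopology E] [CompleteSpace E] {K : Type*} {S : Finset K} {N d h : ℕ}

lemma LSE_cont (hS : S.Nonempty) (W : K → ℝ) (L : K → StrongDual ℝ E) : Continuous (fun ω => LSE S (fun σ => W σ + L σ ω)) := by
  unfold LSE
  apply Continuous.log
  · fun_prop
  · intro ω; exact (Zpos hS _).ne'

lemma Psi_split (hμ : ∀ L : StrongDual ℝ E, ∫ ω, L ω ∂μ = 0) (hS : S.Nonempty) (W : K → ℝ) (L : K → StrongDual ℝ E)
    (c c1 c2 : ℝ) (hc : 0 < c) (hcc : c1^2 + c2^2 = c^2) :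
    Integrable (fun ω => ∫ ω', LSE S (fun σ => (W σ + c1 * L σ ω) + c2 * L σ ω') ∂μ) μ ∧
    ∫ ω, LSE S (fun σ => W σ + c * L σ ω) ∂μ = ∫ ω, ∫ ω', LSE S (fun σ => (W σ + c1 * L σ ω) + c2 * L σ ω') ∂μ ∂μ := by
  obtain ⟨i, e⟩ := gauss_split μ hμ (fun ω => LSE S (fun σ => W σ + c * L σ ω)) (LSE_cont hS W (fun σ => c • L σ))
    (c1/c) (c2/c) (by field_simp; exact hcc) (LSE_int μ hS W (fun σ => c • L σ))
  have k : ∀ ω ω', LSE S (fun σ => W σ + c * L σ ((c1/c) • ω + (c2/c) • ω')) = LSE S (fun σ => (W σ + c1 * L σ ω) + c2 * L σ ω') := by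
    intro ω ω'
    congr 1
    ext σ
    simp only [map_add, map_smul, smul_eq_mul]
    field_simp
    ring
  refine ⟨?_, ?_⟩
  · have := i.integral_prod_left
    simpa only [k] using this
  · rw [e]; simp only [k]

lemma integrable_expect {ι : Type*} [Fintype ι] (f : ι → E → ℝ) (hf : ∀ i, Integrable (f i) μ) :
    Integrable (fun ω => 𝔼 i, f i ω) μ := by
  simp_rw [Finset.expect_eq_sum_div_card]
  exact (integrable_finset_sum _ fun i _ => hf i).div_const _

lemma integral_expect {ι : Type*} [Fintype ι] (f : ι → E → ℝ) (hf : ∀ i, Integrable (f i) μ) :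
    ∫ ω, 𝔼 i, f i ω ∂μ = 𝔼 i, ∫ ω, f i ω ∂μ := by
  simp_rw [Finset.expect_eq_sum_div_card]
  rw [integral_div, integral_finset_sum _ fun i _ => hf i]

noncomputable def uu (S : Finset K) (N d h : ℕ) (x : K → Fin N → ℝ) (κ : ℝ) (L : K → StrongDual ℝ E) (r s : ℕ) : ℝ :=
  ∫ ω, 𝔼 τ : Fin h × Bool ≃ Fin N × Fin d, LSE S (fun σ => κ * usum x τ r σ + Real.sqrt (s / h) * L σ ω) ∂μ

lemma uu_step (hμ : ∀ L : StrongDual ℝ E, ∫ ω, L ω ∂μ = 0) (hS : S.Nonempty) (hN : 0 < N) (hd : 0 < d) (hh : 2 * h = N * d) (x : K → Fin N → ℝ)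
    (hx : ∀ σ ∈ S, ∀ v, |x σ v| ≤ 2) (hx0 : ∀ σ ∈ S, ∑ v, x σ v = 0) (κ : ℝ) (hκ : 4 * |κ| ≤ 1) (η : ℝ) (hη : 0 < η)
    (L : K → StrongDual ℝ E) (hL : ∀ σ ∈ S, ∀ σ' ∈ S, ∫ ω, L σ ω * L σ' ω ∂μ = κ^2 * h * Rb x σ σ'^2)
    (r s : ℕ) (hr : r < h) :
    |uu μ S N d h x κ L (r+1) s - uu μ S N d h x κ L r (s+1)| ≤ edgeErr N h κ η r + 40 * (4 * |κ|)^3 * Cg := by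
  have : Nonempty (Fin h × Bool ≃ Fin N × Fin d) := ⟨Fintype.equivOfCardEq (by simp; omega)⟩
  have h0 : (0:ℝ) < h := by exact_mod_cast (by omega : 0 < h)
  have hN' : (0:ℝ) < N := by exact_mod_cast hN
  have hRb : ∀ σ ∈ S, Rb x σ σ ^2 ≤ 16 := by
    intro σ hσ
    have : |Rb x σ σ| ≤ 4 := by
      unfold Rb
      rw [abs_div, abs_of_pos hN', div_le_iff₀ hN']
      calc |∑ v, x σ v * x σ v| ≤ ∑ v, |x σ v * x σ v| := Finset.abs_sum_le_sum_abs _ _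
        _ ≤ ∑ v : Fin N, (4:ℝ) := Finset.sum_le_sum fun v _ => by
            rw [abs_mul]; nlinarith [hx σ hσ v, abs_nonneg (x σ v)]
        _ = 4 * N := by simp; ring
    rw [← sq_abs]; nlinarith [abs_nonneg (Rb x σ σ)]
  set c := Real.sqrt ((s+1:ℕ) / h) with hc
  set c1 := Real.sqrt (s / h) with hc1
  set c2 := Real.sqrt (1 / h) with hc2
  have cpos : 0 < c := Real.sqrt_pos.2 (by positivity)
  have ccc : c1^2 + c2^2 = c^2 := by
    rw [hc, hc1, hc2, Real.sq_sqrt (by positivity), Real.sq_sqrt (by positivity), Real.sq_sqrt (by positivity)]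
    push_cast; ring
  have c2sq : c2^2 * h = 1 := by rw [hc2, Real.sq_sqrt (by positivity)]; field_simp
  have sp := fun τ : Fin h × Bool ≃ Fin N × Fin d => Psi_split μ hμ hS (fun σ => κ * usum x τ r σ) L c c1 c2 cpos ccc
  have iA : ∀ τ : Fin h × Bool ≃ Fin N × Fin d, Integrable (fun ω => LSE S (fun σ => κ * usum x τ (r+1) σ + c1 * L σ ω)) μ :=
    fun τ => LSE_int μ hS (fun σ => κ * usum x τ (r+1) σ) (fun σ => c1 • L σ)
  have iB : ∀ τ : Fin h × Bool ≃ Fin N × Fin d, Integrable (fun ω => LSE S (fun σ => κ * usum x τ r σ + c * L σ ω)) μ :=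
    fun τ => LSE_int μ hS (fun σ => κ * usum x τ r σ) (fun σ => c • L σ)
  have e2 : uu μ S N d h x κ L r (s+1) = ∫ ω, 𝔼 τ : Fin h × Bool ≃ Fin N × Fin d,
      ∫ ω', LSE S (fun σ => (κ * usum x τ r σ + c1 * L σ ω) + c2 * L σ ω') ∂μ ∂μ := by
    unfold uu
    rw [← hc, integral_expect μ _ iB,
      integral_expect μ _ (fun τ => (sp τ).1)]
    exact Finset.expect_congr rfl fun τ _ => (sp τ).2
  rw [e2]
  unfold uu
  rw [← hc1, ← integral_sub (integrable_expect μ _ iA) (integrable_expect μ _ fun τ => (sp τ).1)]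
  have bd : ∀ ω, |(𝔼 τ : Fin h × Bool ≃ Fin N × Fin d, LSE S (fun σ => κ * usum x τ (r+1) σ + c1 * L σ ω))
      - 𝔼 τ : Fin h × Bool ≃ Fin N × Fin d, ∫ ω', LSE S (fun σ => (κ * usum x τ r σ + c1 * L σ ω) + c2 * L σ ω') ∂μ|
      ≤ edgeErr N h κ η r + 40 * (4 * |κ|)^3 * Cg := by
    intro ω
    have es := edge_step hS hN hd hh x hx hx0 (fun σ => c1 * L σ ω) κ hκ η hη r hr
    have gs : ∀ τ : Fin h × Bool ≃ Fin N × Fin d,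
        |∫ ω', (LSE S (fun σ => (c1 * L σ ω + κ * usum x τ r σ) + (c2 • L σ) ω') - LSE S (fun σ => c1 * L σ ω + κ * usum x τ r σ)) ∂μ
          - 1/2 * κ^2 * Qf S (fun σ => c1 * L σ ω + κ * usum x τ r σ) (fun σ σ' => Rb x σ σ'^2)| ≤ 40 * (4 * |κ|)^3 * Cg := by
      intro τ
      apply gauss_step μ hμ hS _ (fun σ => c2 • L σ) κ hκ (fun σ σ' => Rb x σ σ'^2) hRb
      intro σ hσ σ' hσ'
      have : ∀ ω, (c2 • L σ) ω * (c2 • L σ') ω = c2^2 * (L σ ω * L σ' ω) := by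
        intro ω; simp; ring
      simp_rw [this]
      rw [integral_const_mul, hL σ hσ σ' hσ']
      linear_combination (κ^2 * Rb x σ σ'^2) * c2sq
    have gs' := (Finset.abs_expect_le (univ : Finset (Fin h × Bool ≃ Fin N × Fin d)) _).trans (Finset.expect_le Finset.univ_nonempty fun τ _ => gs τ)
    have e3 : ∀ τ : Fin h × Bool ≃ Fin N × Fin d, ∫ ω', (LSE S (fun σ => (c1 * L σ ω + κ * usum x τ r σ) + (c2 • L σ) ω') - LSE S (fun σ => c1 * L σ ω + κ * usum x τ r σ)) ∂μ
       = ∫ ω', LSE S (fun σ => (κ * usum x τ r σ + c1 * L σ ω) + c2 * L σ ω') ∂μ - LSE S (fun σ => c1 * L σ ω + κ * usum x τ r σ) := by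
      intro τ
      rw [integral_sub (LSE_int μ hS _ (fun σ => c2 • L σ)) (integrable_const _)]
      congr 1
      · congr 1
        ext ω'
        congr 1
        ext σ
        simp; ring
      · simp
    simp_rw [e3] at gs'
    have e4 : ∀ τ : Fin h × Bool ≃ Fin N × Fin d, LSE S (fun σ => κ * usum x τ (r+1) σ + c1 * L σ ω) = LSE S (fun σ => c1 * L σ ω + κ * usum x τ (r+1) σ) := by
      intro τ; congr 1; ext σ; ring
    simp_rw [e4]
    rw [Finset.expect_sub_distrib, Finset.expect_sub_distrib] at es gs'
    have := abs_le.1 es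
    have := abs_le.1 gs'
    rw [abs_le]
    constructor <;> linarith
  calc _ ≤ ∫ ω, |_| ∂μ := abs_integral_le_integral_abs
    _ ≤ ∫ ω, (edgeErr N h κ η r + 40 * (4 * |κ|)^3 * Cg) ∂μ :=
        integral_mono ((integrable_expect μ _ iA).sub (integrable_expect μ _ fun τ => (sp τ).1)).abs (integrable_const _) bd
    _ = _ := by simp

lemma compare (hμ : ∀ L : StrongDual ℝ E, ∫ ω, L ω ∂μ = 0) (hS : S.Nonempty) (hN : 0 < N) (hd : 0 < d) (hh : 2 * h = N * d) (x : K → Fin N → ℝ)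
    (hx : ∀ σ ∈ S, ∀ v, |x σ v| ≤ 2) (hx0 : ∀ σ ∈ S, ∑ v, x σ v = 0) (κ : ℝ) (hκ : 4 * |κ| ≤ 1) (η : ℝ) (hη : 0 < η)
    (L : K → StrongDual ℝ E) (hL : ∀ σ ∈ S, ∀ σ' ∈ S, ∫ ω, L σ ω * L σ' ω ∂μ = κ^2 * h * Rb x σ σ'^2) :
    |𝔼 τ : Fin h × Bool ≃ Fin N × Fin d, LSE S (fun σ => κ * usum x τ h σ) - ∫ ω, LSE S (fun σ => L σ ω) ∂μ| ≤
      h * (70000 * |κ|^3 + 16 * κ^2 * η + 40 * (4 * |κ|)^3 * Cg) + (32 * |κ| + 64 * κ^2 / η) * (4 * rt4 N ^3 * rt4 (2 * h)) := by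
  have : Nonempty (Fin h × Bool ≃ Fin N × Fin d) := ⟨Fintype.equivOfCardEq (by simp; omega)⟩
  have h0 : (0:ℝ) < h := by
    have : 0 < N * d := Nat.mul_pos hN hd
    exact_mod_cast (by omega : 0 < h)
  have a1 : uu μ S N d h x κ L h 0 = 𝔼 τ : Fin h × Bool ≃ Fin N × Fin d, LSE S (fun σ => κ * usum x τ h σ) := by
    unfold uu; simp
  have a2 : uu μ S N d h x κ L 0 h = ∫ ω, LSE S (fun σ => L σ ω) ∂μ := by
    unfold uu usum
    simp [div_self h0.ne']
  have tel : ∀ r ≤ h, |uu μ S N d h x κ L r (h - r) - uu μ S N d h x κ L 0 h| ≤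
      r * (70000 * |κ|^3 + 16 * κ^2 * η + 40 * (4 * |κ|)^3 * Cg) + (32 * |κ| + 64 * κ^2 / η) * (4 * rt4 N ^3 * (rt4 (2 * h) - rt4 (2 * h - 2 * r))) := by
    intro r
    induction r with
    | zero => intro _; simp
    | succ r ih =>
      intro hr
      have i1 := ih (by omega)
      have i2 := uu_step μ hμ hS hN hd hh x hx hx0 κ hκ η hη L hL r (h - (r+1)) (by omega)
      rw [show h - (r+1) + 1 = h - r by omega] at i2
      calc _ ≤ |uu μ S N d h x κ L (r+1) (h - (r+1)) - uu μ S N d h x κ L r (h-r)| + |uu μ S N d h x κ L r (h - r) - uu μ S N d h x κ L 0 h| := by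
            exact abs_sub_le _ _ _
        _ ≤ _ := add_le_add i2 i1
        _ = _ := by unfold edgeErr; push_cast; ring
  have t := tel h le_rfl
  rw [Nat.sub_self, a1, a2] at t
  have z : rt4 (2 * h - 2 * h) = 0 := by simp [rt4]
  rw [z, sub_zero] at t
  exact t
end
end MC

open Finset MeasureTheory ProbabilityTheory
open scoped BigOperators
set_option linter.all false

namespace MC

instance goe_prob (N : ℕ) : IsProbabilityMeasure (goeMeasure N) := by
  unfold goeMeasure; infer_instance

lemma goe_indep (N : ℕ) : iIndepFun (fun (p : Fin N × Fin N) (ω : Fin N × Fin N → ℝ) => ω p) (goeMeasure N) := by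
  unfold goeMeasure
  exact iIndepFun_pi (X := fun p x => x) (fun p => aemeasurable_id)

lemma goe_map (N : ℕ) (p : Fin N × Fin N) : (goeMeasure N).map (fun ω => ω p) = gaussianReal 0 (if p.1 = p.2 then 2 else 1) := by
  unfold goeMeasure
  exact (measurePreserving_eval _ p).map_eq

instance goe_gauss (N : ℕ) : IsGaussian (goeMeasure N) := by
  have h := (goe_indep N).hasGaussianLaw (fun p => ⟨by rw [goe_map]; infer_instance⟩)
  have := h.isGaussian_map
  simpa using this

lemma goe_int0 (N : ℕ) (p : Fin N × Fin N) : ∫ ω, ω p ∂(goeMeasure N) = 0 := by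
  have h : ∫ x, x ∂((goeMeasure N).map (fun ω => ω p)) = ∫ ω, ω p ∂(goeMeasure N) :=
    integral_map (measurable_pi_apply p).aemeasurable (by fun_prop)
  rw [← h, goe_map, integral_id_gaussianReal]

lemma goe_centered (N : ℕ) (L : StrongDual ℝ (Fin N × Fin N → ℝ)) : ∫ ω, L ω ∂(goeMeasure N) = 0 := by
  have h : ∀ ω, L ω = ∑ p, ω p * L (Pi.single p 1) := by
    intro ω
    conv_lhs => rw [← Finset.univ_sum_single ω]
    rw [map_sum]
    refine Finset.sum_congr rfl fun p _ => ?_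
    have : (Pi.single p (ω p) : Fin N × Fin N → ℝ) = ω p • Pi.single p 1 := by
      rw [← Pi.single_smul]; simp
    rw [this, map_smul, smul_eq_mul]
  rw [integral_congr_ae (Filter.Eventually.of_forall h), integral_finsetSum]
  · simp [integral_mul_const, goe_int0]
  · intro p _
    apply Integrable.mul_const
    exact (IsGaussian.integrable_dual (goeMeasure N) (ContinuousLinearMap.proj p))

lemma goe_cov (N : ℕ) (p q : Fin N × Fin N) : ∫ ω, ω p * ω q ∂(goeMeasure N) = if p = q then (if p.1 = p.2 then 2 else 1) else 0 := by
  split_ifs with h h2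
  · subst h
    have h : ∫ x, x * x ∂((goeMeasure N).map (fun ω => ω p)) = ∫ ω, ω p * ω p ∂(goeMeasure N) :=
      integral_map (measurable_pi_apply p).aemeasurable (by fun_prop)
    have := variance_fun_id_gaussianReal (μ := 0) (v := 2)
    rw [variance_eq_integral (by fun_prop)] at this
    rw [← h, goe_map, if_pos h2]
    simp [integral_id_gaussianReal] at this
    simpa [sq] using this
  · subst h
    have h : ∫ x, x * x ∂((goeMeasure N).map (fun ω => ω p)) = ∫ ω, ω p * ω p ∂(goeMeasure N) :=
      integral_map (measurable_pi_apply p).aemeasurable (by fun_prop)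
    have := variance_fun_id_gaussianReal (μ := 0) (v := 1)
    rw [variance_eq_integral (by fun_prop)] at this
    rw [← h, goe_map, if_neg h2]
    simp [integral_id_gaussianReal] at this
    simpa [sq] using this
  · have := ((goe_indep N).indepFun h).integral_fun_mul_eq_mul_integral (measurable_pi_apply p).aestronglyMeasurable (measurable_pi_apply q).aestronglyMeasurable
    rw [this, goe_int0]; simp

noncomputable def JL {N : ℕ} (i j : Fin N) : StrongDual ℝ (Fin N × Fin N → ℝ) :=
  ContinuousLinearMap.proj (if i ≤ j then (i,j) else (j,i))

lemma JL_apply {N : ℕ} (i j : Fin N) (ω) : JL i j ω = Jmat ω i j := by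
  unfold JL Jmat; split_ifs <;> rfl

lemma J_symm {N : ℕ} (i j : Fin N) (ω) : Jmat ω i j = Jmat ω j i := by
  unfold Jmat
  rcases lt_trichotomy i j with h | h | h
  · simp [h.le, not_le.2 h]
  · subst h; rfl
  · simp [h.le, not_le.2 h]

lemma J_cov {N : ℕ} (i j k l : Fin N) : ∫ ω, Jmat ω i j * Jmat ω k l ∂(goeMeasure N) =
    (if i = k then 1 else 0) * (if j = l then 1 else 0) + (if i = l then 1 else 0) * (if j = k then 1 else 0) := by
  simp_rw [← JL_apply]
  unfold JL
  simp only [ContinuousLinearMap.proj_apply]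
  rw [goe_cov]
  have hp : (if i ≤ j then (i,j) else (j,i)).1 = (if i ≤ j then (i,j) else (j,i)).2 ↔ i = j := by
    split_ifs
    · rfl
    · exact eq_comm
  have hq : ((if i ≤ j then (i,j) else (j,i)) = (if k ≤ l then (k,l) else (l,k))) ↔ (i = k ∧ j = l) ∨ (i = l ∧ j = k) := by
    split_ifs <;> simp only [Prod.mk.injEq] <;> constructor <;> intro h <;> first | (rcases h with h | h <;> omega) | omega
  simp only [hp, hq]
  by_cases h1 : i = k <;> by_cases h2 : j = l <;> by_cases h3 : i = l <;> by_cases h4 : j = k <;> by_cases h5 : i = j <;> simp [h1, h2, h3, h4, h5] <;> first | omega | norm_num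
  all_goals simp_all
  all_goals norm_num

end MC

open Finset MeasureTheory ProbabilityTheory
open scoped BigOperators
set_option linter.all false

namespace MC

noncomputable def xv {N : ℕ} (α : ℚ) (σ : Fin N → Bool) (v : Fin N) : ℝ := spin (σ v) - (2 * (α:ℝ) - 1)

lemma H1_eq {N : ℕ} (α : ℚ) (ω : Fin N × Fin N → ℝ) (σ : Fin N → Bool) :
    H1 α ω σ = (Real.sqrt N)⁻¹ * ∑ i, ∑ j, Jmat ω i j * (xv α σ i * xv α σ j) := by
  unfold H1 H0 gvec xv
  set m := 2 * (α:ℝ) - 1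
  have e1 : ∑ i, (Real.sqrt N)⁻¹ * (∑ j, Jmat ω i j) * spin (σ i) = (Real.sqrt N)⁻¹ * ∑ i, ∑ j, Jmat ω i j * spin (σ i) := by
    rw [Finset.mul_sum]
    refine Finset.sum_congr rfl fun i _ => ?_
    rw [mul_assoc, Finset.sum_mul]
  have e2 : ∑ i, ∑ j, Jmat ω i j * spin (σ i) = ∑ i, ∑ j, Jmat ω i j * spin (σ j) := by
    rw [Finset.sum_comm]
    refine Finset.sum_congr rfl fun i _ => Finset.sum_congr rfl fun j _ => ?_
    rw [J_symm]
  have e3 : ∑ i, ∑ j, Jmat ω i j * ((spin (σ i) - m) * (spin (σ j) - m)) =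
     ∑ i, ∑ j, Jmat ω i j * spin (σ i) * spin (σ j) - m * ∑ i, ∑ j, Jmat ω i j * spin (σ i)
      - m * ∑ i, ∑ j, Jmat ω i j * spin (σ j) + m^2 * ∑ i, ∑ j, Jmat ω i j := by
    simp only [Finset.mul_sum, ← Finset.sum_sub_distrib, ← Finset.sum_add_distrib]
    refine Finset.sum_congr rfl fun i _ => Finset.sum_congr rfl fun j _ => ?_
    ring
  rw [e3, e1, ← e2]
  ring

noncomputable def HL {N : ℕ} (α : ℚ) (σ : Fin N → Bool) : StrongDual ℝ (Fin N × Fin N → ℝ) :=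
  ∑ p : Fin N × Fin N, ((Real.sqrt N)⁻¹ * (xv α σ p.1 * xv α σ p.2)) • JL p.1 p.2

lemma HL_apply {N : ℕ} (α : ℚ) (ω : Fin N × Fin N → ℝ) (σ : Fin N → Bool) : HL α σ ω = H1 α ω σ := by
  rw [H1_eq, HL, ContinuousLinearMap.sum_apply, ← Finset.univ_product_univ, Finset.sum_product, Finset.mul_sum]
  refine Finset.sum_congr rfl fun i _ => ?_
  rw [Finset.mul_sum]
  refine Finset.sum_congr rfl fun j _ => ?_
  rw [ContinuousLinearMap.smul_apply, JL_apply, smul_eq_mul]; ring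

lemma JJ_int {N : ℕ} (i j k l : Fin N) : Integrable (fun ω => Jmat ω i j * Jmat ω k l) (goeMeasure N) := by
  simp_rw [← JL_apply]
  exact MemLp.integrable_mul (IsGaussian.memLp_dual (goeMeasure N) (JL i j) 2 (by simp)) (IsGaussian.memLp_dual (goeMeasure N) (JL k l) 2 (by simp))

lemma HL_cov {N : ℕ} (hN : 0 < N) (α : ℚ) (σ σ' : Fin N → Bool) :
    ∫ ω, HL α σ ω * HL α σ' ω ∂(goeMeasure N) = 2 * N * Rb (xv α) σ σ' ^ 2 := by
  have hN' : (0:ℝ) < N := by exact_mod_cast hN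
  have h1 : ∀ ω : Fin N × Fin N → ℝ, HL α σ ω * HL α σ' ω = ∑ p : Fin N × Fin N, ∑ q : Fin N × Fin N,
      (((Real.sqrt N)⁻¹ * (xv α σ p.1 * xv α σ p.2)) * ((Real.sqrt N)⁻¹ * (xv α σ' q.1 * xv α σ' q.2))) * (Jmat ω p.1 p.2 * Jmat ω q.1 q.2) := by
    intro ω
    rw [HL, HL, ContinuousLinearMap.sum_apply, ContinuousLinearMap.sum_apply, Finset.sum_mul_sum]
    refine Finset.sum_congr rfl fun p _ => Finset.sum_congr rfl fun q _ => ?_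
    rw [ContinuousLinearMap.smul_apply, ContinuousLinearMap.smul_apply, JL_apply, JL_apply, smul_eq_mul, smul_eq_mul]; ring
  rw [integral_congr_ae (Filter.Eventually.of_forall h1), integral_finsetSum _ (fun p _ => integrable_finsetSum _ fun q _ => (JJ_int _ _ _ _).const_mul _)]
  have h2 : ∀ p : Fin N × Fin N, ∫ ω, ∑ q : Fin N × Fin N,
      (((Real.sqrt N)⁻¹ * (xv α σ p.1 * xv α σ p.2)) * ((Real.sqrt N)⁻¹ * (xv α σ' q.1 * xv α σ' q.2))) * (Jmat ω p.1 p.2 * Jmat ω q.1 q.2) ∂(goeMeasure N)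
      = (2/N) * ((xv α σ p.1 * xv α σ' p.1) * (xv α σ p.2 * xv α σ' p.2)) := by
    intro p
    rw [integral_finsetSum _ (fun q _ => (JJ_int _ _ _ _).const_mul _)]
    simp_rw [integral_const_mul, J_cov]
    have hs : (Real.sqrt N)⁻¹ * (Real.sqrt N)⁻¹ = 1 / N := by
      rw [← mul_inv, Real.mul_self_sqrt hN'.le, one_div]
    rw [← Finset.univ_product_univ, Finset.sum_product]
    simp only [mul_add, Finset.sum_add_distrib]
    simp only [mul_ite, mul_one, mul_zero, ite_mul, zero_mul, one_mul, Finset.sum_ite_eq, Finset.mem_univ, if_true]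
    rw [Finset.sum_comm (s := univ) (t := univ) (f := fun x x_1 => if p.2 = x then
            if p.1 = x_1 then (Real.sqrt N)⁻¹ * (xv α σ p.1 * xv α σ p.2) * ((Real.sqrt N)⁻¹ * (xv α σ' x * xv α σ' x_1)) else 0
          else 0)]
    simp only [Finset.sum_ite_eq, Finset.mem_univ, if_true]
    calc _ = ((Real.sqrt N)⁻¹ * (Real.sqrt N)⁻¹) * (2 * ((xv α σ p.1 * xv α σ' p.1) * (xv α σ p.2 * xv α σ' p.2))) := by ring
      _ = _ := by rw [hs]; ring
  rw [Finset.sum_congr rfl fun p _ => h2 p, ← Finset.mul_sum, ← Finset.univ_product_univ, Finset.sum_product]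
  simp only []
  rw [← Finset.sum_mul_sum, Rb]
  field_simp

lemma spin_sum {N : ℕ} (σ : Fin N → Bool) : ∑ v, spin (σ v) = 2 * #(univ.filter fun v => σ v = true) - N := by
  have : ∀ v, spin (σ v) = 2 * (if σ v = true then 1 else 0) - 1 := by
    intro v; unfold spin; split_ifs <;> norm_num
  simp_rw [this, Finset.sum_sub_distrib, ← Finset.mul_sum, Finset.sum_boole]
  simp

lemma aI_floor {α : ℚ} {N : ℕ} (h : alphaIntegral α N) : α * N = (⌊α * (N:ℚ)⌋₊ : ℕ) := by
  obtain ⟨k, hk⟩ := h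
  rw [hk, Nat.floor_natCast]

lemma aI_floorR {α : ℚ} {N : ℕ} (h : alphaIntegral α N) : (α:ℝ) * N = (⌊α * (N:ℚ)⌋₊ : ℕ) := by
  have := aI_floor h
  exact_mod_cast congrArg (fun q : ℚ => (q:ℝ)) this

lemma SNset_eq {α : ℚ} {N : ℕ} (h : alphaIntegral α N) : SNset N α = ↑(SV N ⌊α * (N:ℚ)⌋₊) := by
  ext σ
  simp only [SNset, Set.mem_setOf_eq, SV, Finset.coe_filter, Finset.mem_univ, true_and]
  rw [spin_sum]
  have := aI_floorR h
  constructor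
  · intro h1
    have : ((#(univ.filter fun v => σ v = true) : ℕ) : ℝ) = (⌊α * (N:ℚ)⌋₊ : ℕ) := by rw [← this]; linarith
    exact_mod_cast this
  · intro h1
    rw [h1, ← this]; ring

lemma xv_sum {α : ℚ} {N : ℕ} (h : alphaIntegral α N) (σ : Fin N → Bool) (hσ : σ ∈ SV N ⌊α * (N:ℚ)⌋₊) : ∑ v, xv α σ v = 0 := by
  have : σ ∈ SNset N α := by rw [SNset_eq h]; exact hσ
  simp only [SNset, Set.mem_setOf_eq] at this
  simp only [xv, Finset.sum_sub_distrib, this]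
  simp
  ring

lemma xv_abs {α : ℚ} (hα0 : 0 < α) (hα : α < 1/2) {N : ℕ} (σ : Fin N → Bool) (v : Fin N) : |xv α σ v| ≤ 2 := by
  have h0 : (0:ℝ) < α := by exact_mod_cast hα0
  have h1 : (α:ℝ) < 1/2 := by
    have : ((α:ℚ):ℝ) < ((1/2:ℚ):ℝ) := by exact_mod_cast hα
    simpa using this
  unfold xv spin
  rw [abs_le]; split_ifs <;> constructor <;> linarith

lemma cut_usum {α : ℚ} {N d h : ℕ} (hh : 2 * h = N * d) (hi : alphaIntegral α N) (σ : Fin N → Bool) (hσ : σ ∈ SV N ⌊α * (N:ℚ)⌋₊)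
    (τ : Fin h × Bool ≃ Fin N × Fin d) :
    (cutN univ τ (fun c => σ c.1) : ℝ) = N * d * α * (1 - α) - usum (xv α) τ h σ / 2 := by
  have e0 : ∑ c : Fin N × Fin d, xv α σ c.1 = 0 := by
    rw [← Finset.univ_product_univ, Finset.sum_product]
    simp [← Finset.mul_sum, xv_sum hi σ hσ]
  have e1 : ∑ i : Fin h, (xv α σ (τ (i,true)).1 + xv α σ (τ (i,false)).1) = 0 := by
    rw [← e0, ← Equiv.sum_comp τ, ← Finset.univ_product_univ (α := Fin h), Finset.sum_product]
    simp
  have hh' : 2 * (h:ℝ) = N * d := by exact_mod_cast hh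
  unfold cutN usum
  rw [← Finset.sum_boole]
  have hf : (univ.filter fun i : Fin h => i.1 < h) = univ := by ext i; simp
  rw [hf]
  have key : ∀ i : Fin h, (if σ (τ (i,false)).1 ≠ σ (τ (i,true)).1 then (1:ℝ) else 0) =
     2 * α * (1-α) - (xv α σ (τ (i,true)).1 * xv α σ (τ (i,false)).1) / 2 - (2 * (α:ℝ) - 1)/2 * (xv α σ (τ (i,true)).1 + xv α σ (τ (i,false)).1) := by
    intro i
    unfold xv spin
    cases σ (τ (i,false)).1 <;> cases σ (τ (i,true)).1 <;> simp <;> ring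
  rw [Finset.sum_congr rfl fun i _ => key i, Finset.sum_sub_distrib, Finset.sum_sub_distrib, ← Finset.mul_sum _ _ ((2 * (α:ℝ) - 1)/2), e1, ← Finset.sum_div]
  simp
  linear_combination (α:ℝ) * (1-α) * hh'

end MC

open Finset MeasureTheory ProbabilityTheory
open scoped BigOperators
set_option linter.all false

namespace MC

lemma LSE_sandwich {K : Type*} (S : Finset K) (W : K → ℝ) (M : ℝ) (h1 : ∀ σ ∈ S, W σ ≤ M) (h2 : ∃ σ ∈ S, W σ = M) :
    M ≤ LSE S W ∧ LSE S W ≤ M + Real.log #S := by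
  obtain ⟨σ, hσ, hM⟩ := h2
  have hS : S.Nonempty := ⟨σ, hσ⟩
  have e : S.sup' hS W = M := le_antisymm (Finset.sup'_le _ _ h1) (hM ▸ Finset.le_sup' W hσ)
  exact ⟨e ▸ LSE_ge hS W, e ▸ LSE_le hS W⟩

lemma logS {N k : ℕ} (h : k ≤ N) : Real.log #(SV N k) ≤ N := by
  have h1 : #(SV N k) ≤ 2 ^ N := by
    calc _ ≤ #(univ : Finset (Fin N → Bool)) := Finset.card_le_univ _
      _ = _ := by simp
  have h0 : (0:ℝ) < #(SV N k) := by exact_mod_cast (SV_nonempty h).card_pos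
  calc Real.log #(SV N k) ≤ Real.log ((2:ℝ)^N) := by
        apply Real.log_le_log h0; exact_mod_cast h1
    _ = N * Real.log 2 := by rw [Real.log_pow]
    _ ≤ N * 1 := by
        apply mul_le_mul_of_nonneg_left _ (Nat.cast_nonneg _)
        have := Real.log_two_lt_d9; linarith
    _ = N := mul_one _

lemma mx_SC {N d k h : ℕ} (hk : k ≤ N) (τ : Fin h × Bool ≃ Fin N × Fin d) :
    (∀ σ ∈ SV N k, cutN univ τ (fun c => σ c.1) ≤ mx (SC N d k) univ τ) ∧ ∃ σ ∈ SV N k, cutN univ τ (fun c => σ c.1) = mx (SC N d k) univ τ := by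
  constructor
  · intro σ hσ
    exact Finset.le_sup (f := cutN univ τ) (Finset.mem_image_of_mem _ hσ)
  · obtain ⟨s, hs, h⟩ := Finset.exists_mem_eq_sup (SC N d k) (SC_nonempty hk) (cutN univ τ)
    obtain ⟨σ, hσ, rfl⟩ := Finset.mem_image.1 hs
    exact ⟨σ, hσ, h.symm⟩

lemma Bside_conf {α : ℚ} {N d : ℕ} (hα : α < 1/2) (hα0 : 0 < α) (hd : 0 < d) (hi : alphaIntegral α N) (he : Even (N * d)) (β : ℝ) (hβ : 0 < β) 
    (hk : ⌊α * (N:ℚ)⌋₊ ≤ N) :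
    |𝔼 τ : Fin (N*d/2) × Bool ≃ Fin N × Fin d, LSE (SV N ⌊α * (N:ℚ)⌋₊) (fun σ => (-β/Real.sqrt d) * usum (xv α) τ (N*d/2) σ)
      - (2 * β / Real.sqrt d * (confE N d ⌊α * (N:ℚ)⌋₊ - N * d * α * (1 - α)) + N / 2)| ≤ N / 2 := by
  set k := ⌊α * (N:ℚ)⌋₊
  have hh : 2 * (N*d/2) = N * d := Nat.two_mul_div_two_of_even he
  have hne : Nonempty (Fin (N*d/2) × Bool ≃ Fin N × Fin d) := by
    apply Fintype.card_eq.1; simp; omega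
  have hc : 0 ≤ 2 * β / Real.sqrt d := by positivity
  have key : ∀ τ : Fin (N*d/2) × Bool ≃ Fin N × Fin d, 
     |LSE (SV N k) (fun σ => (-β/Real.sqrt d) * usum (xv α) τ (N*d/2) σ) - (2 * β / Real.sqrt d * (mx (SC N d k) univ τ - N * d * α * (1 - α)) + N / 2)| ≤ N/2 := by
    intro τ
    have hW : ∀ σ ∈ SV N k, (-β/Real.sqrt d) * usum (xv α) τ (N*d/2) σ = 2 * β / Real.sqrt d * (cutN univ τ (fun c => σ c.1) - N * d * α * (1 - α)) := by
      intro σ hσ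
      rw [cut_usum hh hi σ hσ]; ring
    obtain ⟨h1, σ0, hσ0, h2⟩ := mx_SC hk τ
    have := LSE_sandwich (SV N k) (fun σ => (-β/Real.sqrt d) * usum (xv α) τ (N*d/2) σ) (2 * β / Real.sqrt d * (mx (SC N d k) univ τ - N * d * α * (1 - α)))
      (by
        intro σ hσ
        simp only [hW σ hσ]
        apply mul_le_mul_of_nonneg_left _ hc
        have : ((cutN univ τ (fun c => σ c.1) : ℕ):ℝ) ≤ mx (SC N d k) univ τ := by exact_mod_cast h1 σ hσ
        linarith)
      ⟨σ0, hσ0, by simp only [hW σ0 hσ0, h2]⟩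
    have hl := logS hk
    rw [abs_le]; constructor <;> linarith [this.1, this.2]
  have e : 2 * β / Real.sqrt d * (confE N d k - N * d * α * (1 - α)) + N / 2 = 𝔼 τ : Fin (N*d/2) × Bool ≃ Fin N × Fin d, (2 * β / Real.sqrt d * (mx (SC N d k) univ τ - N * d * α * (1 - α)) + N / 2) := by
    rw [Finset.expect_add_distrib, ← Finset.mul_expect, Finset.expect_sub_distrib, Finset.expect_const Finset.univ_nonempty, Finset.expect_const Finset.univ_nonempty]
    rfl
  rw [e, ← Finset.expect_sub_distrib]
  exact (Finset.abs_expect_le _ _).trans (Finset.expect_le Finset.univ_nonempty (fun τ _ => key τ))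

lemma Bside_goe {α : ℚ} {N : ℕ} (hi : alphaIntegral α N) (β : ℝ) (hβ : 0 < β) 
    (hk : ⌊α * (N:ℚ)⌋₊ ≤ N) :
    |∫ ω, LSE (SV N ⌊α * (N:ℚ)⌋₊) (fun σ => ((β/2) • HL α σ : StrongDual ℝ (Fin N × Fin N → ℝ)) ω) ∂(goeMeasure N)
      - (β/2 * Emax N α (fun ω σ => H1 α ω σ) + N / 2)| ≤ N / 2 := by
  set k := ⌊α * (N:ℚ)⌋₊ with hkd
  have hS := SV_nonempty hk
  have hs : ∀ ω : Fin N × Fin N → ℝ, sSup ((fun σ => H1 α ω σ) '' SNset N α) = (SV N k).sup' hS (fun σ => HL α σ ω) := by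
    intro ω
    rw [SNset_eq hi, ← hkd, Finset.sup'_eq_csSup_image]
    simp only [HL_apply]
  have hint1 : Integrable (fun ω => LSE (SV N k) (fun σ => ((β/2) • HL α σ : StrongDual ℝ (Fin N × Fin N → ℝ)) ω)) (goeMeasure N) := by
    have := LSE_int (goeMeasure N) hS (fun _ => 0) (fun σ => (β/2) • HL α σ)
    simpa using this
  have hHL : ∀ σ, Integrable (fun ω => HL α σ ω) (goeMeasure N) := fun σ => IsGaussian.integrable_dual (goeMeasure N) (HL α σ)
  have hint2 : Integrable (fun ω => (SV N k).sup' hS (fun σ => HL α σ ω)) (goeMeasure N) := by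
    refine Integrable.mono' (g := fun ω => ∑ σ ∈ SV N k, |HL α σ ω|) (integrable_finsetSum _ fun σ _ => (hHL σ).abs) ?_ ?_
    · apply Continuous.aestronglyMeasurable
      exact Continuous.finset_sup'_apply hS (fun σ _ => (HL α σ).continuous)
    · refine Filter.Eventually.of_forall fun ω => ?_
      obtain ⟨σ, hσ, h⟩ := Finset.exists_mem_eq_sup' hS (fun σ => HL α σ ω)
      rw [h, Real.norm_eq_abs]
      exact Finset.single_le_sum (f := fun σ => |HL α σ ω|) (fun _ _ => abs_nonneg _) hσ
  have hE : Emax N α (fun ω σ => H1 α ω σ) = ∫ ω, (SV N k).sup' hS (fun σ => HL α σ ω) ∂(goeMeasure N) := by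
    unfold Emax
    exact integral_congr_ae (Filter.Eventually.of_forall hs)
  have e : β/2 * Emax N α (fun ω σ => H1 α ω σ) + N / 2 = ∫ ω, (β/2 * (SV N k).sup' hS (fun σ => HL α σ ω) + N/2) ∂(goeMeasure N) := by
    rw [integral_add (hint2.const_mul _) (integrable_const _), integral_const_mul, hE]
    simp
  have hint3 : Integrable (fun ω => β/2 * (SV N k).sup' hS (fun σ => HL α σ ω) + N/2) (goeMeasure N) := (hint2.const_mul _).add (integrable_const _)
  rw [e, ← integral_sub hint1 hint3]
  refine (abs_integral_le_integral_abs).trans ?_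
  have : ∫ ω, (N:ℝ)/2 ∂(goeMeasure N) = N/2 := by simp
  refine le_trans (integral_mono (hint1.sub hint3).abs (integrable_const _) ?_) this.le
  intro ω
  simp only
  obtain ⟨σ0, hσ0, h⟩ := Finset.exists_mem_eq_sup' hS (fun σ => HL α σ ω)
  have := LSE_sandwich (SV N k) (fun σ => ((β/2) • HL α σ : StrongDual ℝ (Fin N × Fin N → ℝ)) ω) (β/2 * (SV N k).sup' hS (fun σ => HL α σ ω))
    (by
      intro σ hσ
      simp only [ContinuousLinearMap.smul_apply, smul_eq_mul]
      apply mul_le_mul_of_nonneg_left _ (by positivity)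
      exact Finset.le_sup' (fun σ => HL α σ ω) hσ)
    ⟨σ0, hσ0, by rw [h]; rfl⟩
  have hl := logS hk
  rw [abs_le]; constructor <;> linarith [this.1, this.2]

lemma floor_le {α : ℚ} (hα0 : 0 < α) (hα : α < 1/2) (N : ℕ) : ⌊α * (N:ℚ)⌋₊ ≤ N := by
  have : ⌊α * (N:ℚ)⌋₊ ≤ ⌊(N:ℚ)⌋₊ := by
    apply Nat.floor_mono
    have : (0:ℚ) ≤ N := Nat.cast_nonneg _
    nlinarith
  simpa using this

lemma partB (α : ℚ) (hα0 : 0 < α) (hα : α < 1/2) (ε : ℝ) (hε : 0 < ε) : ∃ d0 : ℕ, ∀ d ≥ d0, ∀ N : ℕ, 0 < N → alphaIntegral α N → Even (N * d) →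
    |(confE N d ⌊α * (N:ℚ)⌋₊ - N * d * α * (1 - α)) / (Real.sqrt d * N) - 1 / (4 * (N:ℝ)) * Emax N α (fun ω σ => H1 α ω σ)| ≤ ε := by
  set β := 1 / ε with hβd
  have hβ : 0 < β := by positivity
  have hCg := Cg_nonneg
  set C := (35000 + 1280 * Cg) * β^3 + 8 * β^2 + 128 * β + 256 * β^2 with hC
  set Y := 1 + 4 * β + C / (β * ε) with hY
  have hC0 : 0 ≤ C := by positivity
  have hCb : 0 ≤ C / (β * ε) := by positivity
  refine ⟨⌈Y^4⌉₊, fun d hd N hN hi he => ?_⟩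
  have hk := floor_le hα0 hα N
  have hdY : Y^4 ≤ d := (Nat.ceil_le).1 hd
  set y := rt4 d with hy
  have hd0' : (0:ℝ) ≤ d := Nat.cast_nonneg _
  have hy4 : y^4 = d := rt4_pow hd0'
  have hyY : Y ≤ y := by
    have h1 : 0 ≤ y := rt4_nonneg _
    rw [← hy4] at hdY
    exact le_of_pow_le_pow_left₀ (by norm_num) h1 hdY
  have y1 : 1 ≤ y := by linarith
  have y0 : 0 < y := by linarith
  have hdpos : 0 < d := by
    have : (0:ℝ) < d := by rw [← hy4]; positivity
    exact_mod_cast this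
  have hsq : Real.sqrt d = y^2 := by
    rw [← hy4, show y^4 = (y^2)^2 by ring, Real.sqrt_sq (by positivity)]
  have hNr : (0:ℝ) < N := by exact_mod_cast hN
  have hh : 2 * (N*d/2) = N * d := Nat.two_mul_div_two_of_even he
  have hhr : 2 * ((N*d/2 : ℕ):ℝ) = N * y^4 := by rw [hy4]; exact_mod_cast hh
  have b1 := Bside_conf hα hα0 hdpos hi he β hβ hk
  have b2 := Bside_goe hi β hβ hk
  have hκa : |(-β / Real.sqrt d)| = β / y^2 := by rw [hsq, abs_div, abs_neg, abs_of_pos hβ, abs_of_pos (by positivity)]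
  have hκ2 : (-β / Real.sqrt d)^2 = β^2/y^4 := by rw [hsq]; field_simp
  have b3 := compare (goeMeasure N) (goe_centered N) (SV_nonempty hk) hN hdpos hh (xv α) (fun σ _ v => xv_abs hα0 hα σ v) (fun σ hσ => xv_sum hi σ hσ)
    (-β / Real.sqrt d) (by
      rw [hκa, mul_div_assoc', div_le_one (by positivity)]
      nlinarith) (1/y) (by positivity) (fun σ => (β/2) • HL α σ) (by
      intro σ hσ σ' hσ'
      have : ∀ ω, ((β/2) • HL α σ : StrongDual ℝ (Fin N × Fin N → ℝ)) ω * ((β/2) • HL α σ' : StrongDual ℝ (Fin N × Fin N → ℝ)) ω = β^2/4 * (HL α σ ω * HL α σ' ω) := by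
        intro ω; simp only [ContinuousLinearMap.smul_apply, smul_eq_mul]; ring
      rw [integral_congr_ae (Filter.Eventually.of_forall this), integral_const_mul, HL_cov hN, hκ2]
      have : ((N*d/2 : ℕ):ℝ) = N * y^4 / 2 := by linarith
      rw [this]; field_simp; ring)
  rw [hκa, hκ2] at b3
  have hrt : rt4 (N:ℝ) ^3 * rt4 (2 * ((N*d/2:ℕ):ℝ)) = N * y := by
    rw [hhr, hy4, rt4_mul hNr.le, ← hy]
    calc _ = rt4 (N:ℝ)^4 * y := by ring
      _ = _ := by rw [rt4_pow hNr.le]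
  have herr : ((N*d/2:ℕ):ℝ) * (70000 * (β/y^2)^3 + 16 * (β^2/y^4) * (1/y) + 40 * (4 * (β/y^2))^3 * Cg) + (32 * (β/y^2) + 64 * (β^2/y^4) / (1/y)) * (4 * rt4 N ^ 3 * rt4 (2 * ((N*d/2:ℕ):ℝ)))
     ≤ N * (C / y) := by
    have e1 : ((N*d/2 : ℕ):ℝ) = N * y^4 / 2 := by linarith
    have e2 : 4 * rt4 (N:ℝ) ^ 3 * rt4 (2 * ((N*d/2:ℕ):ℝ)) = 4 * (N * y) := by rw [← hrt]; ring
    rw [e2, e1]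
    have e3 : (N:ℝ) * y^4 / 2 * (70000 * (β/y^2)^3 + 16 * (β^2/y^4) * (1/y) + 40 * (4 * (β/y^2))^3 * Cg) + (32 * (β/y^2) + 64 * (β^2/y^4) / (1/y)) * (4 * (N * y))
      = N * ((((35000 + 1280 * Cg) * β^3 + 256 * β^2) / y + (8 * β^2 + 128 * β)) / y) := by
      field_simp; ring
    rw [e3]
    apply mul_le_mul_of_nonneg_left _ hNr.le
    apply div_le_div_of_nonneg_right _ y0.le
    have : ((35000 + 1280 * Cg) * β^3 + 256 * β^2) / y ≤ ((35000 + 1280 * Cg) * β^3 + 256 * β^2) := div_le_self (by positivity) y1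
    rw [hC]; linarith
  have b4 := b3.trans herr
  have tot : |2 * β / Real.sqrt d * (confE N d ⌊α * (N:ℚ)⌋₊ - N * d * α * (1 - α)) - β/2 * Emax N α (fun ω σ => H1 α ω σ)| ≤ N * (C / y) + N := by
    rw [abs_le] at *
    constructor <;> linarith [b1.1, b1.2, b2.1, b2.2, b4.1, b4.2]
  have e5 : (confE N d ⌊α * (N:ℚ)⌋₊ - N * d * α * (1 - α)) / (Real.sqrt d * N) - 1 / (4 * (N:ℝ)) * Emax N α (fun ω σ => H1 α ω σ)
    = (2 * β / Real.sqrt d * (confE N d ⌊α * (N:ℚ)⌋₊ - N * d * α * (1 - α)) - β/2 * Emax N α (fun ω σ => H1 α ω σ)) / (2 * β * N) := by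
    rw [hsq]; field_simp
    ring
  rw [e5, abs_div, abs_of_pos (show 0 < 2 * β * (N:ℝ) by positivity), div_le_iff₀ (by positivity)]
  refine tot.trans ?_
  have h6 : C / y ≤ β * ε := by
    rw [div_le_iff₀ y0]
    have : C / (β * ε) ≤ y := by linarith
    rw [div_le_iff₀ (by positivity)] at this; linarith
  have h7 : β * ε = 1 := by rw [hβd]; field_simp
  have h8 : (N:ℝ) * (C/y) ≤ N * 1 := mul_le_mul_of_nonneg_left (h7 ▸ h6) hNr.le
  calc _ ≤ 2 * (N:ℝ) * 1 := by linarith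
    _ = _ := by rw [← h7]; ring

end MC

open Finset MeasureTheory ProbabilityTheory
open scoped BigOperators
set_option linter.all false

namespace MC

lemma expect_prod' {A B : Type*} [Fintype A] [Fintype B] (f : A × B → ℝ) : 𝔼 x, f x = 𝔼 a, 𝔼 b, f (a, b) := by
  rw [← Finset.univ_product_univ, Finset.expect_product]

lemma exp_mean {A : Type*} [Fintype A] [Nonempty A] (m : A → ℝ) (c l : ℝ) (hm : ∀ a a', |m a - m a'| ≤ c) (hl : |l| * c ≤ 1) (h0 : 𝔼 a, m a = 0) :
    𝔼 a, Real.exp (l * m a) ≤ Real.exp (l^2 * c^2) := by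
  have hb : ∀ a, |m a| ≤ c := by
    intro a
    have : m a = 𝔼 a', (m a - m a') := by
      rw [Finset.expect_sub_distrib, h0, Finset.expect_const Finset.univ_nonempty]; ring
    rw [this]
    exact (Finset.abs_expect_le _ _).trans (Finset.expect_le Finset.univ_nonempty fun a' _ => hm a a')
  have hp : ∀ a, Real.exp (l * m a) ≤ 1 + l * m a + l^2 * c^2 := by
    intro a
    have h1 : |l * m a| ≤ |l| * c := by rw [abs_mul]; exact mul_le_mul_of_nonneg_left (hb a) (abs_nonneg _)
    have h2 := Real.abs_exp_sub_one_sub_id_le (h1.trans hl)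
    have h3 : (l * m a)^2 ≤ l^2 * c^2 := by
      rw [← sq_abs, ← sq_abs l, ← mul_pow]
      exact pow_le_pow_left₀ (abs_nonneg _) h1 2
    have := (abs_le.1 h2).2
    linarith
  calc 𝔼 a, Real.exp (l * m a) ≤ 𝔼 a, (1 + l * m a + l^2 * c^2) := Finset.expect_le_expect fun a _ => hp a
    _ = 1 + l^2 * c^2 := by
      rw [Finset.expect_add_distrib, Finset.expect_add_distrib, ← Finset.mul_expect, h0, Finset.expect_const Finset.univ_nonempty, Finset.expect_const Finset.univ_nonempty]; ring
    _ ≤ _ := by have := Real.add_one_le_exp (l^2 * c^2); linarith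

lemma decomp_swap {m : ℕ} (p : Fin (m+1)) (e : Equiv.Perm (Fin m)) (a b : Fin m) :
    Equiv.Perm.decomposeFin.symm (p, e * Equiv.swap a b) = Equiv.Perm.decomposeFin.symm (p, e) * Equiv.swap a.succ b.succ := by
  ext x
  refine Fin.cases ?_ (fun x => ?_) x
  · rw [Equiv.Perm.mul_apply, Equiv.swap_apply_of_ne_of_ne (Fin.succ_ne_zero a).symm (Fin.succ_ne_zero b).symm]
    simp
  · have : Equiv.swap a.succ b.succ x.succ = (Equiv.swap a b x).succ := by
      rw [Equiv.swap_apply_def, Equiv.swap_apply_def]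
      simp only [Fin.succ_inj]
      split_ifs <;> rfl
    rw [Equiv.Perm.mul_apply, this]
    simp

lemma conc_fin (c l : ℝ) (hc : 0 ≤ c) (hl : |l| * (2 * c) ≤ 1) (m : ℕ) : ∀ (F : Equiv.Perm (Fin m) → ℝ) (hF : ∀ σ a b, |F (σ * Equiv.swap a b) - F σ| ≤ c),
    𝔼 σ, Real.exp (l * (F σ - 𝔼 σ', F σ')) ≤ Real.exp (4 * l^2 * c^2 * m) := by
  induction m with
  | zero =>
    intro F hF
    have : ∀ σ, F σ = F 1 := fun σ => congrArg F (Subsingleton.elim _ _)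
    simp_rw [this, Finset.expect_const Finset.univ_nonempty]
    simp
  | succ m ih =>
    intro F hF
    set D := (Equiv.Perm.decomposeFin (n := m)).symm
    have hD : ∀ g : Equiv.Perm (Fin (m+1)) → ℝ, 𝔼 σ, g σ = 𝔼 p, 𝔼 e, g (D (p, e)) := by
      intro g
      rw [← expect_prod' (fun x => g (D x))]
      exact (Fintype.expect_equiv D _ _ (fun x => rfl)).symm
    set mp : Fin (m+1) → ℝ := fun p => 𝔼 e, F (D (p, e))
    set M := 𝔼 σ, F σ with hM
    have hMp : M = 𝔼 p, mp p := hD F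
    have hpq : ∀ p q e, |F (D (p,e)) - F (D (q, e))| ≤ 2 * c := by
      intro p q e
      set s := D (0, e)
      have h0 : ∀ p, D (p, e) = Equiv.swap 0 p * s := by
        
        intro p
        ext x
        refine Fin.cases ?_ (fun x => ?_) x
        · simp [D, s]
        · simp [D, s]
      have h1 : ∀ p, |F (D (p,e)) - F s| ≤ c := by
        intro p
        have : D (p, e) = s * Equiv.swap (s⁻¹ 0) (s⁻¹ p) := by
          rw [h0, Equiv.mul_swap_eq_swap_mul]; simp
        rw [this]; exact hF _ _ _
      have a1 := abs_le.1 (h1 p)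
      have a2 := abs_le.1 (h1 q)
      rw [abs_le]; constructor <;> linarith [a1.1, a1.2, a2.1, a2.2]
    rw [hD]
    have step : ∀ p, 𝔼 e, Real.exp (l * (F (D (p,e)) - M)) ≤ Real.exp (l * (mp p - M)) * Real.exp (4 * l^2 * c^2 * m) := by
      intro p
      have := ih (fun e => F (D (p, e))) (by
        intro σ a b
        simp only [D]
        rw [decomp_swap]; exact hF _ _ _)
      calc _ = 𝔼 e, Real.exp (l * (mp p - M)) * Real.exp (l * (F (D (p,e)) - mp p)) := by
            refine Finset.expect_congr rfl fun e _ => ?_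
            rw [← Real.exp_add]; congr 1; ring
        _ = Real.exp (l * (mp p - M)) * 𝔼 e, Real.exp (l * (F (D (p,e)) - mp p)) := by rw [Finset.mul_expect]
        _ ≤ _ := mul_le_mul_of_nonneg_left this (Real.exp_pos _).le
    have hm := exp_mean (fun p => mp p - M) (2*c) l (by
      intro p q
      have : mp p - M - (mp q - M) = 𝔼 e, (F (D (p,e)) - F (D (q,e))) := by
        rw [Finset.expect_sub_distrib]; simp only [mp]; ring
      rw [this]
      exact (Finset.abs_expect_le _ _).trans (Finset.expect_le Finset.univ_nonempty fun e _ => hpq p q e)) hl (by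
      rw [Finset.expect_sub_distrib, ← hMp, Finset.expect_const Finset.univ_nonempty]; ring)
    calc _ ≤ 𝔼 p, Real.exp (l * (mp p - M)) * Real.exp (4 * l^2 * c^2 * m) := Finset.expect_le_expect fun p _ => step p
      _ = (𝔼 p, Real.exp (l * (mp p - M))) * Real.exp (4 * l^2 * c^2 * m) := by rw [Finset.expect_mul]
      _ ≤ Real.exp (l^2 * (2*c)^2) * Real.exp (4 * l^2 * c^2 * m) := mul_le_mul_of_nonneg_right hm (Real.exp_pos _).le
      _ = _ := by rw [← Real.exp_add]; congr 1; push_cast; ring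

lemma conc {P C : Type*} [Fintype P] [DecidableEq P] [Fintype C] [DecidableEq C] (hc : Fintype.card P = Fintype.card C) (c l : ℝ) (hc0 : 0 ≤ c) (hl : |l| * (2 * c) ≤ 1)
    (F : (P ≃ C) → ℝ) (hF : ∀ (τ : P ≃ C) a b, |F ((Equiv.swap a b).trans τ) - F τ| ≤ c) :
    𝔼 τ, Real.exp (l * (F τ - 𝔼 τ', F τ')) ≤ Real.exp (4 * l^2 * c^2 * Fintype.card P) := by
  obtain ⟨e⟩ : Nonempty (P ≃ Fin (Fintype.card P)) := ⟨Fintype.equivFin P⟩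
  obtain ⟨e'⟩ : Nonempty (Fin (Fintype.card P) ≃ C) := ⟨Fintype.equivOfCardEq (by simp [hc])⟩
  set Q : Equiv.Perm (Fin (Fintype.card P)) ≃ (P ≃ C) := Equiv.equivCongr e.symm e' with hQ
  have hE : ∀ g : (P ≃ C) → ℝ, 𝔼 τ, g τ = 𝔼 σ, g (Q σ) := fun g => (Fintype.expect_equiv Q _ _ (fun x => rfl)).symm
  have := conc_fin c l hc0 hl (Fintype.card P) (fun σ => F (Q σ)) (by
    intro σ a b
    have : Q (σ * Equiv.swap a b) = (Equiv.swap (e.symm a) (e.symm b)).trans (Q σ) := by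
      ext x
      simp only [hQ, Equiv.equivCongr_apply_apply, Equiv.trans_apply, Equiv.Perm.mul_apply, Equiv.symm_symm]
      congr 2
      rw [Equiv.swap_apply_def, Equiv.swap_apply_def]
      simp only [← Equiv.eq_symm_apply]
      split_ifs <;> simp
    simp only [this]
    exact hF _ _ _)
  rw [hE, hE]
  exact this

end MC

open Finset MeasureTheory ProbabilityTheory
open scoped BigOperators
set_option linter.all false

namespace MC

def flp {I : Type*} (p : I × Bool) : I × Bool := (p.1, !p.2)

@[simp] lemma flp_flp {I : Type*} (p : I × Bool) : flp (flp p) = p := by simp [flp]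
lemma flp_ne {I : Type*} (p : I × Bool) : flp p ≠ p := by
  intro h
  have := congrArg Prod.snd h
  simp [flp] at this
lemma flp_inj {I : Type*} {p q : I × Bool} (h : flp p = flp q) : p = q := by
  rw [← flp_flp p, h, flp_flp]
lemma eq_or_flp {I : Type*} {p q : I × Bool} (h : p.1 = q.1) : p = q ∨ p = flp q := by
  obtain ⟨i, s⟩ := p
  obtain ⟨j, t⟩ := q
  simp only at h
  subst h
  cases s <;> cases t <;> simp [flp]

section
variable {I : Type*} [Fintype I] [DecidableEq I] {N d : ℕ} (τ : I × Bool ≃ Fin N × Fin d)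

def vx (p : I × Bool) : Fin N := (τ p).1
def dl (p : I × Bool) : Fin N × Fin N := (vx τ p, vx τ (flp p))
def badH (r : I × Bool) : Prop := ∃ r', r' ≠ r ∧ dl τ r' = dl τ r
def Nb (u : Fin N) : Finset (Fin N) := (univ.filter fun c => vx τ c = u).image fun c => vx τ (flp c)

open Classical in
noncomputable def bad : ℕ := #(univ.filter fun i : I => badH τ (i, true))

lemma dl_flp (p : I × Bool) : dl τ (flp p) = (dl τ p).swap := by simp [dl]

lemma badH_flp (r : I × Bool) (h : badH τ (flp r)) : badH τ r := by
  obtain ⟨r', h1, h2⟩ := h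
  refine ⟨flp r', fun e => h1 (by rw [← e, flp_flp]), ?_⟩
  rw [dl_flp, h2, dl_flp, Prod.swap_swap]

lemma badH_flp_iff (r : I × Bool) : badH τ (flp r) ↔ badH τ r :=
  ⟨badH_flp τ r, fun h => badH_flp τ (flp r) (by rwa [flp_flp])⟩

lemma badH_congr {r r' : I × Bool} (h : r.1 = r'.1) : badH τ r ↔ badH τ r' := by
  rcases eq_or_flp h with h | h
  · rw [h]
  · rw [h]; exact badH_flp_iff τ r'

lemma pre_card (A : Finset (Fin N)) : #(univ.filter fun p => vx τ p ∈ A) = #A * d := by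
  have : (univ.filter fun p => vx τ p ∈ A).map τ.toEmbedding = A ×ˢ (univ : Finset (Fin d)) := by
    ext c
    simp only [Finset.mem_map, Finset.mem_filter, Finset.mem_univ, true_and, Equiv.coe_toEmbedding, Finset.mem_product, and_true]
    constructor
    · rintro ⟨p, hp, rfl⟩; exact hp
    · intro hc
      exact ⟨τ.symm c, by simpa [vx] using hc, by simp⟩
  rw [← Finset.card_map τ.toEmbedding, this, Finset.card_product]; simp

lemma pre_card' (A : Finset (Fin N)) : #(univ.filter fun p => vx τ (flp p) ∈ A) = #A * d := by
  rw [← pre_card τ A]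
  apply Finset.card_bij (fun p _ => flp p)
  · intro p hp; simpa using hp
  · intro p _ q _ h; exact flp_inj h
  · intro p hp; exact ⟨flp p, by simpa using hp, by simp⟩

lemma Nb_card (u : Fin N) : #(Nb τ u) ≤ d := by
  refine Finset.card_image_le.trans ?_
  have := pre_card τ {u}
  simp at this
  exact this.le

lemma mem_Nb {u v : Fin N} : v ∈ Nb τ u ↔ ∃ c, dl τ c = (u, v) := by
  simp only [Nb, Finset.mem_image, Finset.mem_filter, Finset.mem_univ, true_and, dl, Prod.mk.injEq]

lemma Nb_symm {u v : Fin N} : v ∈ Nb τ u ↔ u ∈ Nb τ v := by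
  rw [mem_Nb, mem_Nb]
  constructor <;> rintro ⟨c, hc⟩ <;> exact ⟨flp c, by rw [dl_flp, hc]; rfl⟩

lemma vx_swap_q (q p : I × Bool) : vx ((Equiv.swap q p).trans τ) q = vx τ p := by simp [vx]
lemma vx_swap_p (q p : I × Bool) : vx ((Equiv.swap q p).trans τ) p = vx τ q := by simp [vx]
lemma vx_swap_o (q p r : I × Bool) (h1 : r ≠ q) (h2 : r ≠ p) : vx ((Equiv.swap q p).trans τ) r = vx τ r := by
  simp [vx, Equiv.swap_apply_of_ne_of_ne h1 h2]

lemma ne_of_fst {r s : I × Bool} (h : r.1 ≠ s.1) : r ≠ s := fun e => h (by rw [e])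

lemma dl_swap_o (q p r : I × Bool) (h1 : r.1 ≠ q.1) (h2 : r.1 ≠ p.1) : dl ((Equiv.swap q p).trans τ) r = dl τ r := by
  unfold dl
  rw [vx_swap_o τ q p r (ne_of_fst h1) (ne_of_fst h2), vx_swap_o τ q p (flp r) (ne_of_fst h1) (ne_of_fst h2)]

lemma swap_good (q p : I × Bool) (hpq : p.1 ≠ q.1) (h1 : vx τ p ≠ vx τ (flp q)) (h2 : vx τ p ≠ vx τ q) (h3 : vx τ p ∉ Nb τ (vx τ (flp q)))
    (h4 : ¬ (vx τ (flp q) = vx τ q ∧ vx τ p = vx τ (flp p))) : ¬ badH ((Equiv.swap q p).trans τ) q := by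
  rintro ⟨r, hr, he⟩
  have e1 : dl ((Equiv.swap q p).trans τ) q = (vx τ p, vx τ (flp q)) := by
    unfold dl
    rw [vx_swap_q, vx_swap_o τ q p (flp q) (flp_ne q) (ne_of_fst hpq.symm)]
  rw [e1] at he
  by_cases c1 : r.1 = q.1
  · rcases eq_or_flp c1 with rfl | rfl
    · exact hr rfl
    · rw [dl_flp, e1] at he
      simp only [Prod.swap_prod_mk, Prod.mk.injEq] at he
      exact h1 he.2
  by_cases c2 : r.1 = p.1
  · have e2 : dl ((Equiv.swap q p).trans τ) p = (vx τ q, vx τ (flp p)) := by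
      unfold dl
      rw [vx_swap_p, vx_swap_o τ q p (flp p) (ne_of_fst hpq) (flp_ne p)]
    rcases eq_or_flp c2 with rfl | rfl
    · rw [e2] at he
      simp only [Prod.mk.injEq] at he
      exact h2 he.1.symm
    · rw [dl_flp, e2] at he
      simp only [Prod.swap_prod_mk, Prod.mk.injEq] at he
      exact h4 ⟨he.2.symm, he.1.symm⟩
  · rw [dl_swap_o τ q p r c1 c2] at he
    apply h3
    rw [mem_Nb]
    exact ⟨flp r, by rw [dl_flp, he]; rfl⟩

def Xs (q : I × Bool) : Finset (I × Bool) :=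
  (univ.filter fun p => p.1 = q.1) ∪ (univ.filter fun p => vx τ p ∈ {vx τ (flp q), vx τ q} ∪ Nb τ (vx τ (flp q)))
    ∪ (univ.filter fun p => vx τ (flp p) ∈ {vx τ q} ∪ Nb τ (vx τ q))

lemma Xs_card (q : I × Bool) : #(Xs τ q) ≤ 2 + 3 * d + 2 * d * d := by
  have a1 : #(univ.filter fun p : I × Bool => p.1 = q.1) ≤ 2 := by
    calc _ ≤ #({q, flp q} : Finset (I × Bool)) := by
          apply Finset.card_le_card
          intro p hp
          simp only [Finset.mem_filter, Finset.mem_univ, true_and] at hp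
          rcases eq_or_flp hp with h | h <;> simp [h]
      _ ≤ 2 := Finset.card_le_two
  have a2 : #({vx τ (flp q), vx τ q} ∪ Nb τ (vx τ (flp q))) ≤ 2 + d :=
    (Finset.card_union_le _ _).trans (Nat.add_le_add Finset.card_le_two (Nb_card τ _))
  have a3 : #({vx τ q} ∪ Nb τ (vx τ q)) ≤ 1 + d :=
    (Finset.card_union_le _ _).trans (Nat.add_le_add (by simp) (Nb_card τ _))
  unfold Xs
  refine (Finset.card_union_le _ _).trans ?_
  refine (Nat.add_le_add_right (Finset.card_union_le _ _) _).trans ?_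
  rw [pre_card, pre_card']
  calc _ ≤ 2 + (2 + d) * d + (1 + d) * d := by gcongr
    _ = _ := by ring

lemma bad_swap_lt (q p : I × Bool) (hq : badH τ q) (hp : p ∉ Xs τ q) (hl : vx τ p ≠ vx τ (flp p)) :
    bad ((Equiv.swap q p).trans τ) < bad τ := by
  classical
  simp only [Xs, Finset.mem_union, Finset.mem_filter, Finset.mem_univ, true_and, Finset.mem_insert, Finset.mem_singleton, not_or] at hp
  obtain ⟨⟨h1, ⟨h2, h3⟩, h4⟩, h5, h6⟩ := hp
  have g1 := swap_good τ q p h1 h2 h3 h4 (fun h => hl h.2)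
  have g2 := swap_good τ p q (Ne.symm h1) (Ne.symm h5) (Ne.symm h3) (by rwa [Nb_symm]) (fun h => hl h.1.symm)
  rw [Equiv.swap_comm] at g2
  unfold bad
  apply Finset.card_lt_card
  rw [Finset.ssubset_iff_of_subset]
  · refine ⟨q.1, ?_, ?_⟩
    · simp only [Finset.mem_filter, Finset.mem_univ, true_and]
      exact (badH_congr τ (r := (q.1,true)) (r' := q) rfl).2 hq
    · simp only [Finset.mem_filter, Finset.mem_univ, true_and]
      intro h
      exact g1 ((badH_congr _ (r := (q.1,true)) (r' := q) rfl).1 h)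
  · intro k
    simp only [Finset.mem_filter, Finset.mem_univ, true_and]
    rintro hk
    obtain ⟨r, hr, he⟩ := id hk
    have bk : ∀ s : I × Bool, badH ((Equiv.swap q p).trans τ) s → s.1 ≠ q.1 ∧ s.1 ≠ p.1 := by
      intro s hs
      exact ⟨fun e => g1 ((badH_congr _ e).1 hs), fun e => g2 ((badH_congr _ e).1 hs)⟩
    have b1 := bk _ hk
    have b2 := bk r ⟨(k,true), hr.symm, he.symm⟩
    rw [dl_swap_o τ q p r b2.1 b2.2, dl_swap_o τ q p _ b1.1 b1.2] at he
    exact ⟨r, hr, he⟩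

lemma loops_card : #(univ.filter fun p : I × Bool => vx τ p = vx τ (flp p)) ≤ 2 * bad τ := by
  classical
  unfold bad
  have : (univ.filter fun p : I × Bool => vx τ p = vx τ (flp p)) ⊆ (univ.filter fun i : I => badH τ (i, true)) ×ˢ (univ : Finset Bool) := by
    intro p hp
    simp only [Finset.mem_filter, Finset.mem_univ, true_and, Finset.mem_product, and_true] at hp ⊢
    refine (badH_congr τ (r := p) (r' := (p.1,true)) rfl).1 ⟨flp p, flp_ne p, ?_⟩
    rw [dl_flp, dl, hp]; rfl
  refine (Finset.card_le_card this).trans ?_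
  rw [Finset.card_product]; simp [mul_comm]

lemma exists_dec (h0 : 0 < bad τ) (hn : 2 + 3 * d + 2 * d * d + 2 * bad τ < Fintype.card (I × Bool)) :
    ∃ q p, bad ((Equiv.swap q p).trans τ) < bad τ := by
  classical
  obtain ⟨i, hi⟩ : (univ.filter fun i : I => badH τ (i, true)).Nonempty := Finset.card_pos.1 h0
  simp only [Finset.mem_filter, Finset.mem_univ, true_and] at hi
  have : ∃ p, p ∉ Xs τ (i,true) ∪ (univ.filter fun p : I × Bool => vx τ p = vx τ (flp p)) := by
    by_contra hcon
    push Not at hcon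
    have : #(univ : Finset (I × Bool)) ≤ #(Xs τ (i,true) ∪ (univ.filter fun p : I × Bool => vx τ p = vx τ (flp p))) :=
      Finset.card_le_card fun p _ => hcon p
    have h2 := this.trans (Finset.card_union_le _ _)
    have h3 := Xs_card τ (i,true)
    have h4 := loops_card τ
    rw [Finset.card_univ] at h2
    omega
  obtain ⟨p, hp⟩ := this
  simp only [Finset.mem_union, Finset.mem_filter, Finset.mem_univ, true_and, not_or] at hp
  exact ⟨(i,true), p, bad_swap_lt τ _ p hi hp.1 hp.2⟩

lemma card_T (B : ℕ) (hn : 2 + 3 * d + 2 * d * d + 2 * B < Fintype.card (I × Bool)) :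
    ∀ k ≤ B, #(univ.filter fun τ : I × Bool ≃ Fin N × Fin d => bad τ ≤ k) ≤ (Fintype.card (I × Bool) ^ 2) ^ k * #(univ.filter fun τ : I × Bool ≃ Fin N × Fin d => bad τ ≤ 0) := by
  classical
  intro k
  induction k with
  | zero => intro _; simp
  | succ k ih =>
    intro hk
    have := ih (by omega)
    have hsub : (univ.filter fun τ : I × Bool ≃ Fin N × Fin d => bad τ ≤ k + 1) ⊆
       (univ : Finset ((I × Bool) × (I × Bool))).biUnion fun x => (univ.filter fun τ : I × Bool ≃ Fin N × Fin d => bad ((Equiv.swap x.1 x.2).trans τ) ≤ k) := by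
      intro τ hτ
      simp only [Finset.mem_filter, Finset.mem_univ, true_and, Finset.mem_biUnion] at hτ ⊢
      by_cases h0 : bad τ = 0
      · have hpos : 0 < Fintype.card (I × Bool) := by omega
        obtain ⟨p⟩ := Fintype.card_pos_iff.1 hpos
        refine ⟨(p, p), ?_⟩
        simp [h0]
      · obtain ⟨q, p, h⟩ := exists_dec τ (by omega) (by omega)
        exact ⟨(q,p), by simp only; omega⟩
    have hc : ∀ x : (I × Bool) × (I × Bool), #(univ.filter fun τ : I × Bool ≃ Fin N × Fin d => bad ((Equiv.swap x.1 x.2).trans τ) ≤ k) = #(univ.filter fun τ : I × Bool ≃ Fin N × Fin d => bad τ ≤ k) := by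
      intro x
      apply Finset.card_bij (fun τ _ => (Equiv.swap x.1 x.2).trans τ)
      · intro τ h; simpa using h
      · intro τ _ τ' _ h
        have := congrArg (fun e => (Equiv.swap x.1 x.2).trans e) h
        simpa [← Equiv.trans_assoc] using this
      · intro τ h
        refine ⟨(Equiv.swap x.1 x.2).trans τ, ?_, ?_⟩
        · simpa [← Equiv.trans_assoc] using h
        · simp [← Equiv.trans_assoc]
    calc _ ≤ _ := Finset.card_le_card hsub
      _ ≤ ∑ x : (I × Bool) × (I × Bool), #(univ.filter fun τ : I × Bool ≃ Fin N × Fin d => bad ((Equiv.swap x.1 x.2).trans τ) ≤ k) := Finset.card_biUnion_le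
      _ = Fintype.card (I × Bool) ^ 2 * #(univ.filter fun τ : I × Bool ≃ Fin N × Fin d => bad τ ≤ k) := by
          rw [Finset.sum_congr rfl fun x _ => hc x, Finset.sum_const, smul_eq_mul, Finset.card_univ, Fintype.card_prod (I × Bool)]; ring
      _ ≤ Fintype.card (I × Bool) ^ 2 * ((Fintype.card (I × Bool) ^ 2) ^ k * #(univ.filter fun τ : I × Bool ≃ Fin N × Fin d => bad τ ≤ 0)) := Nat.mul_le_mul_left _ this
      _ = _ := by ring

end
end MC

open Finset MeasureTheory ProbabilityTheory
open scoped BigOperators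
set_option linter.all false

namespace MC

section
variable {I : Type*} [Fintype I] [DecidableEq I] {N d : ℕ}

lemma avg_swap (q : I × Bool) (g : (I × Bool ≃ Fin N × Fin d) → ℝ) :
    (Fintype.card (I × Bool) : ℝ) * 𝔼 τ, g τ = 𝔼 τ : (I × Bool ≃ Fin N × Fin d), ∑ p, g ((Equiv.swap q p).trans τ) := by
  rw [Finset.expect_sum_comm]
  rw [Finset.sum_congr rfl fun p _ => expect_trans (Equiv.swap q p) g]
  simp

open Classical in
lemma loop_prob [Nonempty (I × Bool ≃ Fin N × Fin d)] (q : I × Bool) :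
    (Fintype.card (I × Bool) : ℝ) * 𝔼 τ : (I × Bool ≃ Fin N × Fin d), (if vx τ (flp q) = vx τ q then (1:ℝ) else 0) ≤ d + 1 := by
  rw [avg_swap q]
  refine Finset.expect_le Finset.univ_nonempty fun τ _ => ?_
  rw [Finset.sum_boole]
  have : (univ.filter fun p => vx ((Equiv.swap q p).trans τ) (flp q) = vx ((Equiv.swap q p).trans τ) q) ⊆ (univ.filter fun p => vx τ p ∈ ({vx τ (flp q)} : Finset _)) ∪ {flp q} := by
    intro p hp
    simp only [Finset.mem_filter, Finset.mem_univ, true_and, Finset.mem_union, Finset.mem_singleton] at hp ⊢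
    by_cases h : p = flp q
    · exact Or.inr h
    · left
      rw [vx_swap_q, vx_swap_o τ q p (flp q) (flp_ne q) (Ne.symm h)] at hp
      exact hp.symm
  have h2 := (Finset.card_le_card this).trans (Finset.card_union_le _ _)
  rw [pre_card] at h2
  simp only [Finset.card_singleton, one_mul] at h2
  exact_mod_cast h2

open Classical in
lemma bad_prob [Nonempty (I × Bool ≃ Fin N × Fin d)] (q : I × Bool) :
    (Fintype.card (I × Bool) : ℝ) * 𝔼 τ : (I × Bool ≃ Fin N × Fin d), (if badH τ q then (1:ℝ) else 0) ≤ (2 + 3 * d + 2 * d * d) + (d + 1) := by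
  refine le_trans ?_ (add_le_add_right (loop_prob (N := N) (d := d) q) _)
  rw [avg_swap q, Finset.mul_expect]
  have e : ((2:ℝ) + 3 * d + 2 * d * d) + 𝔼 τ : (I × Bool ≃ Fin N × Fin d), ((Fintype.card (I × Bool) : ℝ) * (if vx τ (flp q) = vx τ q then (1:ℝ) else 0)) =
     𝔼 τ : (I × Bool ≃ Fin N × Fin d), (((2:ℝ) + 3 * d + 2 * d * d) + (Fintype.card (I × Bool) : ℝ) * (if vx τ (flp q) = vx τ q then (1:ℝ) else 0)) := by
    rw [Finset.expect_add_distrib, Finset.expect_const Finset.univ_nonempty]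
  rw [e]
  refine Finset.expect_le_expect fun τ _ => ?_
  have hX : ((#(Xs τ q) : ℕ):ℝ) ≤ (2:ℝ) + 3 * d + 2 * d * d := by exact_mod_cast Xs_card τ q
  split_ifs with hl
  · rw [Finset.sum_boole]
    have : ((#(univ.filter fun p => badH ((Equiv.swap q p).trans τ) q) : ℕ) : ℝ) ≤ Fintype.card (I × Bool) := by
      exact_mod_cast Finset.card_le_univ _
    have : (0:ℝ) ≤ 2 + 3 * d + 2 * d * d := by positivity
    linarith
  · rw [Finset.sum_boole]
    have : (univ.filter fun p => badH ((Equiv.swap q p).trans τ) q) ⊆ Xs τ q := by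
      intro p
      simp only [Finset.mem_filter, Finset.mem_univ, true_and]
      intro h
      by_contra hp
      simp only [Xs, Finset.mem_union, Finset.mem_filter, Finset.mem_univ, true_and, Finset.mem_insert, Finset.mem_singleton, not_or] at hp
      obtain ⟨⟨h1, ⟨h2, h3⟩, h4⟩, h5, h6⟩ := hp
      exact swap_good τ q p h1 h2 h3 h4 (fun h => hl h.1) h
    have : ((#(univ.filter fun p => badH ((Equiv.swap q p).trans τ) q) : ℕ) : ℝ) ≤ #(Xs τ q) := by
      exact_mod_cast Finset.card_le_card this
    linarith

def Bd (d : ℕ) : ℕ := 2 + 3 * d + 2 * d * d + (d + 1)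

lemma bad_mean [Nonempty (I × Bool ≃ Fin N × Fin d)] [Nonempty I] :
    𝔼 τ : (I × Bool ≃ Fin N × Fin d), (bad τ : ℝ) ≤ Bd d / 2 := by
  classical
  have e : ∀ τ : I × Bool ≃ Fin N × Fin d, (bad τ : ℝ) = ∑ i : I, if badH τ (i,true) then (1:ℝ) else 0 := by
    intro τ; rw [Finset.sum_boole]; unfold bad; congr
  simp_rw [e]
  rw [Finset.expect_sum_comm]
  have hI : (0:ℝ) < Fintype.card I := by exact_mod_cast Fintype.card_pos
  have hP : (Fintype.card (I × Bool) : ℝ) = 2 * Fintype.card I := by simp [mul_comm]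
  have : ∀ i : I, 𝔼 τ : (I × Bool ≃ Fin N × Fin d), (if badH τ (i,true) then (1:ℝ) else 0) ≤ Bd d / (2 * Fintype.card I) := by
    intro i
    have := bad_prob (N := N) (d := d) (i, true)
    rw [hP] at this
    rw [le_div_iff₀ (by positivity)]
    unfold Bd; push_cast
    linarith
  calc _ ≤ ∑ i : I, (Bd d / (2 * Fintype.card I) : ℝ) := Finset.sum_le_sum fun i _ => this i
    _ = _ := by
      rw [Finset.sum_const, Finset.card_univ, nsmul_eq_mul]; field_simp

lemma simple_prob [Nonempty (I × Bool ≃ Fin N × Fin d)] (hn : 2 + 3 * d + 2 * d * d + 2 * Bd d < Fintype.card (I × Bool)) :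
    Fintype.card (I × Bool ≃ Fin N × Fin d) ≤ 2 * ((Fintype.card (I × Bool) ^ 2) ^ Bd d * #(univ.filter fun τ : I × Bool ≃ Fin N × Fin d => bad τ ≤ 0)) := by
  classical
  have hI : Nonempty I := by
    have : Nonempty (I × Bool) := Fintype.card_pos_iff.1 (by omega)
    obtain ⟨i, _⟩ := this
    exact ⟨i⟩
  have h1 := card_T (N := N) (d := d) (I := I) (Bd d) hn (Bd d) le_rfl
  refine le_trans ?_ (Nat.mul_le_mul_left 2 h1)
  have hm := bad_mean (N := N) (d := d) (I := I)
  rw [Fintype.expect_eq_sum_div_card, div_le_iff₀ (by exact_mod_cast Fintype.card_pos)] at hm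
  have h2 : (Fintype.card (I × Bool ≃ Fin N × Fin d)) = #(univ.filter fun τ : I × Bool ≃ Fin N × Fin d => bad τ ≤ Bd d) + #(univ.filter fun τ : I × Bool ≃ Fin N × Fin d => ¬ bad τ ≤ Bd d) := by
    rw [Finset.card_filter_add_card_filter_not]; rfl
  have h3 : ((#(univ.filter fun τ : I × Bool ≃ Fin N × Fin d => ¬ bad τ ≤ Bd d) : ℕ):ℝ) * Bd d ≤ ∑ τ : I × Bool ≃ Fin N × Fin d, (bad τ : ℝ) := by
    calc _ = ∑ τ ∈ univ.filter (fun τ : I × Bool ≃ Fin N × Fin d => ¬ bad τ ≤ Bd d), (Bd d : ℝ) := by simp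
      _ ≤ ∑ τ ∈ univ.filter (fun τ : I × Bool ≃ Fin N × Fin d => ¬ bad τ ≤ Bd d), (bad τ : ℝ) := by
          refine Finset.sum_le_sum fun τ hτ => ?_
          simp only [Finset.mem_filter, Finset.mem_univ, true_and, not_le] at hτ
          exact_mod_cast hτ.le
      _ ≤ _ := Finset.sum_le_sum_of_subset_of_nonneg (Finset.filter_subset _ _) (fun _ _ _ => Nat.cast_nonneg _)
  have hB : (0:ℝ) < Bd d := by unfold Bd; push_cast; positivity
  have h4 : ((#(univ.filter fun τ : I × Bool ≃ Fin N × Fin d => ¬ bad τ ≤ Bd d) : ℕ):ℝ) ≤ (Fintype.card (I × Bool ≃ Fin N × Fin d)) / 2 := by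
    have := h3.trans hm
    by_contra hcon
    have hcon := lt_of_not_ge hcon
    have := mul_lt_mul_of_pos_right hcon hB
    linarith
  have h5 : 2 * #(univ.filter fun τ : I × Bool ≃ Fin N × Fin d => ¬ bad τ ≤ Bd d) ≤ (Fintype.card (I × Bool ≃ Fin N × Fin d)) := by
    have : (2:ℝ) * ((#(univ.filter fun τ : I × Bool ≃ Fin N × Fin d => ¬ bad τ ≤ Bd d) : ℕ):ℝ) ≤ (Fintype.card (I × Bool ≃ Fin N × Fin d)) := by linarith
    exact_mod_cast this
  omega

end
end MC

open Finset MeasureTheory ProbabilityTheory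
open scoped BigOperators
set_option linter.all false

namespace MC

section
variable {I C : Type*} [Fintype I] [DecidableEq I] [Fintype C] [DecidableEq C]

lemma cutN_swap_le (τ : I × Bool ≃ C) (a b : I × Bool) (s : C → Bool) :
    cutN univ ((Equiv.swap a b).trans τ) s ≤ cutN univ τ s + 2 := by
  unfold cutN
  calc _ ≤ #((univ.filter fun i => s (τ (i,false)) ≠ s (τ (i,true))) ∪ {a.1, b.1}) := by
        apply Finset.card_le_card
        intro i hi
        simp only [Finset.mem_union, Finset.mem_filter, Finset.mem_univ, true_and, Finset.mem_insert, Finset.mem_singleton] at hi ⊢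
        by_cases h1 : i = a.1
        · right; left; exact h1
        by_cases h2 : i = b.1
        · right; right; exact h2
        left
        have e : ∀ t, Equiv.swap a b (i,t) = (i,t) := fun t =>
          Equiv.swap_apply_of_ne_of_ne (fun h => h1 (by rw [← h])) (fun h => h2 (by rw [← h]))
        simpa [e] using hi
    _ ≤ _ := (Finset.card_union_le _ _).trans (by gcongr; exact Finset.card_le_two)

lemma mx_swap_le (S : Finset (C → Bool)) (τ : I × Bool ≃ C) (a b : I × Bool) :
    mx S univ ((Equiv.swap a b).trans τ) ≤ mx S univ τ + 2 := by
  refine Finset.sup_le fun s hs => (cutN_swap_le τ a b s).trans ?_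
  gcongr
  exact Finset.le_sup (f := cutN univ τ) hs

lemma mx_lip (S : Finset (C → Bool)) (τ : I × Bool ≃ C) (a b : I × Bool) :
    |((mx S univ ((Equiv.swap a b).trans τ) : ℕ) : ℝ) - (mx S univ τ : ℕ)| ≤ 2 := by
  have h1 := mx_swap_le S τ a b
  have h2 := mx_swap_le S ((Equiv.swap a b).trans τ) a b
  have e : (Equiv.swap a b).trans ((Equiv.swap a b).trans τ) = τ := by
    ext x; simp
  rw [e] at h2
  have h1' : ((mx S univ ((Equiv.swap a b).trans τ) : ℕ) : ℝ) ≤ (mx S univ τ : ℕ) + 2 := by exact_mod_cast h1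
  have h2' : ((mx S univ τ : ℕ) : ℝ) ≤ (mx S univ ((Equiv.swap a b).trans τ) : ℕ) + 2 := by exact_mod_cast h2
  rw [abs_le]; constructor <;> linarith

lemma mx_conc (hc : Fintype.card (I × Bool) = Fintype.card C) (S : Finset (C → Bool)) (l : ℝ) (hl : |l| * 4 ≤ 1) :
    𝔼 τ : (I × Bool ≃ C), Real.exp (l * ((mx S univ τ : ℕ) - confT I S)) ≤ Real.exp (16 * l^2 * Fintype.card (I × Bool)) := by
  have := conc (P := I × Bool) (C := C) hc 2 l (by norm_num) (by linarith) (fun τ => ((mx S univ τ : ℕ) : ℝ)) (fun τ a b => mx_lip S τ a b)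
  refine this.trans (le_of_eq ?_)
  congr 1; ring

/-- Jensen step on a subset. -/
lemma cond_mean (hc : Fintype.card (I × Bool) = Fintype.card C) (S : Finset (C → Bool))
    (T : Finset (I × Bool ≃ C)) (hT : T.Nonempty) (K : ℝ) (hK : (Fintype.card (I × Bool ≃ C) : ℝ) ≤ K * #T)
    (l : ℝ) (hl0 : 0 < l) (hl : l * 4 ≤ 1) :
    |(∑ τ ∈ T, ((mx S univ τ : ℕ) : ℝ)) / #T - confT I S| ≤ (Real.log K + 16 * l^2 * Fintype.card (I × Bool)) / l := by
  have hTp : (0:ℝ) < #T := by exact_mod_cast hT.card_pos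
  have hne : Nonempty (I × Bool ≃ C) := ⟨hT.choose⟩
  have hcp : (0:ℝ) < Fintype.card (I × Bool ≃ C) := by exact_mod_cast Fintype.card_pos
  have hKp : 0 < K := by
    by_contra h
    have : K * #T ≤ 0 := mul_nonpos_of_nonpos_of_nonneg (not_lt.1 h) hTp.le
    linarith
  set D := (∑ τ ∈ T, ((mx S univ τ : ℕ) : ℝ)) / #T - confT I S with hD
  have key : ∀ m : ℝ, |m| * 4 ≤ 1 → m * D ≤ Real.log K + 16 * m^2 * Fintype.card (I × Bool) := by
    intro m hm
    have hD' : m * D = ∑ τ ∈ T, (1 / (#T:ℝ)) • (m * ((mx S univ τ : ℕ) - confT I S)) := by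
      simp only [smul_eq_mul]
      rw [← Finset.mul_sum, ← Finset.mul_sum, Finset.sum_sub_distrib, Finset.sum_const, nsmul_eq_mul, hD]
      field_simp
    have hJ : Real.exp (m * D) ≤ ∑ τ ∈ T, (1 / (#T:ℝ)) • Real.exp (m * ((mx S univ τ : ℕ) - confT I S)) := by
      rw [hD']
      apply convexOn_exp.map_sum_le
      · intro _ _; positivity
      · rw [Finset.sum_const, nsmul_eq_mul]; field_simp
      · intro _ _; trivial
    have h2 : ∑ τ ∈ T, (1 / (#T:ℝ)) • Real.exp (m * ((mx S univ τ : ℕ) - confT I S)) ≤ K * Real.exp (16 * m^2 * Fintype.card (I × Bool)) := by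
      have hc2 := mx_conc hc S m hm
      rw [Fintype.expect_eq_sum_div_card, div_le_iff₀ hcp] at hc2
      simp only [smul_eq_mul]
      rw [← Finset.mul_sum]
      have h3 : ∑ τ ∈ T, Real.exp (m * ((mx S univ τ : ℕ) - confT I S)) ≤ ∑ τ : I × Bool ≃ C, Real.exp (m * ((mx S univ τ : ℕ) - confT I S)) :=
        Finset.sum_le_sum_of_subset_of_nonneg (Finset.subset_univ _) (fun _ _ _ => (Real.exp_pos _).le)
      rw [one_div, inv_mul_le_iff₀ hTp]
      calc _ ≤ _ := h3.trans hc2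
        _ ≤ Real.exp (16 * m^2 * Fintype.card (I × Bool)) * (K * #T) := by gcongr
        _ = _ := by ring
    have h4 := Real.log_le_log (Real.exp_pos _) (hJ.trans h2)
    rwa [Real.log_exp, Real.log_mul hKp.ne' (Real.exp_pos _).ne', Real.log_exp] at h4
  have k1 := key l (by rwa [abs_of_pos hl0])
  have k2 := key (-l) (by rwa [abs_neg, abs_of_pos hl0])
  rw [le_div_iff₀ hl0]
  rcases abs_cases D with ⟨h, _⟩ | ⟨h, _⟩ <;> rw [h] <;> nlinarith
end
end MC

open Finset MeasureTheory ProbabilityTheory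
open scoped BigOperators
set_option linter.all false

namespace MC

section
variable {I : Type*} [Fintype I] [DecidableEq I] {N d : ℕ}

def inF (G : SimpleGraph (Fin N)) (τ : I × Bool ≃ Fin N × Fin d) : Prop :=
  Function.Injective (dl τ) ∧ ∀ u v, G.Adj u v ↔ ∃ p, dl τ p = (u, v)

def gt (τ : I × Bool ≃ Fin N × Fin d) : SimpleGraph (Fin N) where
  Adj u v := u ≠ v ∧ ∃ p, dl τ p = (u, v)
  symm := ⟨by
    rintro u v ⟨h, p, hp⟩
    exact ⟨h.symm, flp p, by rw [dl_flp, hp]; rfl⟩⟩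
  loopless := ⟨fun u h => h.1 rfl⟩

lemma bad_iff (τ : I × Bool ≃ Fin N × Fin d) : bad τ ≤ 0 ↔ Function.Injective (dl τ) := by
  classical
  unfold bad
  rw [Nat.le_zero, Finset.card_eq_zero, Finset.filter_eq_empty_iff]
  constructor
  · intro h p q hpq
    by_contra hne
    exact h (Finset.mem_univ q.1) ((badH_congr τ (r := q) (r' := (q.1, true)) rfl).1 ⟨p, hne, hpq⟩)
  · rintro h i - ⟨r', h1, h2⟩
    exact h1 (h h2)

lemma inF_gt {τ : I × Bool ≃ Fin N × Fin d} (h : Function.Injective (dl τ)) : inF (gt τ) τ := by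
  refine ⟨h, fun u v => ⟨fun h => h.2, fun h2 => ⟨?_, h2⟩⟩⟩
  rintro rfl
  obtain ⟨p, hp⟩ := h2
  refine flp_ne p (h ?_)
  rw [dl_flp, hp]; rfl

lemma inF_eq {G : SimpleGraph (Fin N)} {τ : I × Bool ≃ Fin N × Fin d} (h : inF G τ) : gt τ = G := by
  ext u v
  rw [h.2 u v, (inF_gt h.1).2 u v]

lemma inF_reg {G : SimpleGraph (Fin N)} {τ : I × Bool ≃ Fin N × Fin d} (h : inF G τ) : IsDReg d G := by
  classical
  intro v
  have h1 := pre_card τ {v}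
  rw [Finset.card_singleton, one_mul] at h1
  rw [← h1, ← Fintype.card_subtype, ← Nat.card_eq_fintype_card]
  symm
  refine Nat.card_eq_of_bijective (fun p : {p // vx τ p ∈ ({v} : Finset (Fin N))} => (⟨vx τ (flp p.1), ?_⟩ : G.neighborSet v)) ⟨?_, ?_⟩
  · obtain ⟨p, hp⟩ := p
    simp only [Finset.mem_singleton, Set.mem_setOf_eq] at hp
    exact (h.2 _ _).2 ⟨p, by simp [dl, hp]⟩
  · rintro ⟨p, hp⟩ ⟨q, hq⟩ hpq
    simp only [Finset.mem_singleton, Set.mem_setOf_eq] at hp hq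
    simp only [Subtype.mk.injEq] at hpq ⊢
    exact h.1 (by simp [dl, hp, hq, hpq])
  · rintro ⟨w, hw⟩
    obtain ⟨p, hp⟩ := (h.2 _ _).1 hw
    simp only [dl, Prod.mk.injEq] at hp
    exact ⟨⟨p, by simp [hp.1]⟩, Subtype.ext hp.2⟩

abbrev KR (I : Type*) (N d : ℕ) := {κ : Equiv.Perm (I × Bool) // ∀ p, κ (flp p) = flp (κ p)} ×
  {ρ : Equiv.Perm (Fin N × Fin d) // ∀ c, (ρ c).1 = c.1}

lemma fib_card {G : SimpleGraph (Fin N)} {τ0 : I × Bool ≃ Fin N × Fin d} (h0 : inF G τ0) :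
    Nat.card {τ : I × Bool ≃ Fin N × Fin d // inF G τ} = Nat.card (KR I N d) := by
  classical
  have hdl : ∀ x : KR I N d, ∀ p, dl (x.1.1.trans (τ0.trans x.2.1)) p = dl τ0 (x.1.1 p) := by
    rintro ⟨⟨κ, hκ⟩, ⟨ρ, hρ⟩⟩ p
    simp [dl, vx, hκ, hρ]
  symm
  refine Nat.card_eq_of_bijective (fun x : KR I N d => ⟨x.1.1.trans (τ0.trans x.2.1), ?_, ?_⟩) ⟨?_, ?_⟩
  · intro p q hpq
    rw [hdl, hdl] at hpq
    exact x.1.1.injective (h0.1 hpq)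
  · intro u v
    rw [h0.2]
    constructor
    · rintro ⟨p, hp⟩
      exact ⟨x.1.1.symm p, by rw [hdl]; simpa using hp⟩
    · rintro ⟨p, hp⟩
      exact ⟨x.1.1 p, by rw [← hdl]; exact hp⟩
  · intro x y hxy
    have hxy : x.1.1.trans (τ0.trans x.2.1) = y.1.1.trans (τ0.trans y.2.1) := congrArg Subtype.val hxy
    have h1 : x.1 = y.1 := by
      apply Subtype.ext
      ext1 p
      apply h0.1
      rw [← hdl x, ← hdl y, hxy]
    have h2 : x.2 = y.2 := by
      apply Subtype.ext
      ext1 c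
      have := congrArg (fun e : I × Bool ≃ Fin N × Fin d => e (x.1.1.symm (τ0.symm c))) hxy
      simp only [Equiv.trans_apply] at this
      rw [← h1] at this
      simpa using this
    exact Prod.ext h1 h2
  · rintro ⟨τ, hτ⟩
    have : ∀ p, ∃ q, dl τ0 q = dl τ p := by
      intro p
      exact (h0.2 _ _).1 ((hτ.2 (dl τ p).1 (dl τ p).2).2 ⟨p, rfl⟩)
    choose k hk using this
    have kinj : Function.Injective k := fun p q hpq => hτ.1 (by rw [← hk, ← hk, hpq])
    let κ : Equiv.Perm (I × Bool) := Equiv.ofBijective k (Finite.injective_iff_bijective.1 kinj)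
    have hκ : ∀ p, κ p = k p := fun p => rfl
    refine ⟨(⟨κ, ?_⟩, ⟨(κ.trans τ0).symm.trans τ, ?_⟩), ?_⟩
    · intro p
      apply h0.1
      rw [hκ, hκ, hk, dl_flp, dl_flp, hk]
    · intro c
      obtain ⟨p, rfl⟩ := (κ.trans τ0).surjective c
      rw [Equiv.trans_apply, Equiv.symm_apply_apply]
      have := congrArg Prod.fst (hk p)
      simpa [dl, vx, hκ] using this.symm
    · apply Subtype.ext
      ext1 p
      simp

lemma fib_nonempty {h : ℕ} (hh : 2 * h = N * d) {G : SimpleGraph (Fin N)} (hG : IsDReg d G) :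
    ∃ τ : Fin h × Bool ≃ Fin N × Fin d, inF G τ := by
  classical
  have hl : ∀ u, ∃ f : Fin N → ℕ, (∀ v, G.Adj u v → f v < d) ∧ ∀ v w, G.Adj u v → G.Adj u w → f v = f w → v = w := by
    intro u
    have e : G.neighborSet u ≃ Fin d := Finite.equivFinOfCardEq (hG u)
    refine ⟨fun v => if h : G.Adj u v then (e ⟨v, h⟩ : ℕ) else 0, ?_, ?_⟩
    · intro v hv
      simp [hv]
    · intro v w hv hw hvw
      simp only [hv, hw, dif_pos] at hvw
      have := e.injective (Fin.ext hvw)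
      exact congrArg Subtype.val this
  choose f hf1 hf2 using hl
  let A : Finset (Fin N × Fin N) := univ.filter fun p => G.Adj p.1 p.2 ∧ p.1 < p.2
  let B : Finset (Fin N × Fin N) := univ.filter fun p => G.Adj p.1 p.2 ∧ p.2 < p.1
  have hAB : #A = #B := by
    apply Finset.card_bij (fun p _ => p.swap)
    · intro p hp
      simp only [A, B, Finset.mem_filter, Finset.mem_univ, true_and] at hp ⊢
      exact ⟨hp.1.symm, hp.2⟩
    · intro p _ q _ hpq; exact Prod.swap_injective hpq
    · intro p hp
      simp only [A, B, Finset.mem_filter, Finset.mem_univ, true_and] at hp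
      exact ⟨p.swap, by simpa [A] using ⟨hp.1.symm, hp.2⟩, by simp⟩
  have hsum : #A + #B = N * d := by
    have hd : Disjoint A B := by
      rw [Finset.disjoint_left]
      intro p hp hq
      simp only [A, B, Finset.mem_filter, Finset.mem_univ, true_and] at hp hq
      exact lt_asymm hp.2 hq.2
    have hU : A ∪ B = univ.filter fun p : Fin N × Fin N => G.Adj p.1 p.2 := by
      ext p
      simp only [A, B, Finset.mem_union, Finset.mem_filter, Finset.mem_univ, true_and]
      constructor
      · rintro (h | h) <;> exact h.1
      · intro h
        rcases lt_or_gt_of_ne h.ne with h1 | h1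
        · exact Or.inl ⟨h, h1⟩
        · exact Or.inr ⟨h, h1⟩
    rw [← Finset.card_union_of_disjoint hd, hU]
    rw [Finset.card_filter, Fintype.sum_prod_type]
    have : ∀ u : Fin N, (∑ v : Fin N, if G.Adj u v then 1 else 0) = d := by
      intro u
      rw [← Finset.card_filter, ← hG u, Nat.card_eq_fintype_card, Fintype.card_subtype]
      rfl
    simp [this]
  have hA : Fintype.card A = h := by rw [Fintype.card_coe]; omega
  let e : Fin h ≃ A := (Fintype.equivFinOfCardEq hA).symm
  let δ : Fin h × Bool → Fin N × Fin N := fun p => if p.2 then (e p.1).1 else (e p.1).1.swap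
  have he : ∀ i, G.Adj (e i).1.1 (e i).1.2 ∧ (e i).1.1 < (e i).1.2 := by
    intro i
    have := (e i).2
    simpa only [A, Finset.mem_filter, Finset.mem_univ, true_and] using this
  have hδs : ∀ p, δ (flp p) = (δ p).swap := by
    rintro ⟨i, b⟩; cases b <;> simp [δ, flp]
  have hδa : ∀ p, G.Adj (δ p).1 (δ p).2 := by
    rintro ⟨i, b⟩
    cases b
    · simpa [δ] using (he i).1.symm
    · simpa [δ] using (he i).1
  have hδi : Function.Injective δ := by
    rintro ⟨i, b⟩ ⟨j, c⟩ hij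
    have hi := (he i).2
    have hj := (he j).2
    cases b <;> cases c <;> simp only [δ, if_true, Bool.false_eq_true, if_false] at hij
    · have := e.injective (Subtype.ext (Prod.swap_injective hij)); rw [this]
    · rw [← hij] at hj; exact absurd hj (not_lt.2 hi.le)
    · rw [hij] at hi; exact absurd hi (not_lt.2 hj.le)
    · have := e.injective (Subtype.ext hij); rw [this]
  have hδr : ∀ u v, G.Adj u v → ∃ p, δ p = (u, v) := by
    intro u v huv
    rcases lt_or_gt_of_ne huv.ne with h1 | h1
    · refine ⟨(e.symm ⟨(u,v), by simp [A, huv, h1]⟩, true), by simp [δ]⟩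
    · refine ⟨(e.symm ⟨(v,u), by simp [A, huv.symm, h1]⟩, false), by simp [δ]⟩
  let t : Fin h × Bool → Fin N × Fin d := fun p => ((δ p).1, ⟨f (δ p).1 (δ p).2, hf1 _ _ (hδa p)⟩)
  have ht : Function.Injective t := by
    intro p q hpq
    simp only [t, Prod.mk.injEq, Fin.mk.injEq] at hpq
    have h3 := hδa p
    have h4 := hδa q
    obtain ⟨h1, h2⟩ := hpq
    rw [h1] at h2 h3
    exact hδi (Prod.ext h1 (hf2 _ _ _ h3 h4 h2))
  have hb : Function.Bijective t := by
    rw [Fintype.bijective_iff_injective_and_card]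
    refine ⟨ht, ?_⟩
    simp; omega
  have hdl : ∀ p, dl (Equiv.ofBijective t hb) p = δ p := by
    intro p
    simp [dl, vx, t, hδs]
  refine ⟨Equiv.ofBijective t hb, ?_, ?_⟩
  · intro p q hpq
    rw [hdl, hdl] at hpq
    exact hδi hpq
  · intro u v
    constructor
    · intro huv
      obtain ⟨p, hp⟩ := hδr u v huv
      exact ⟨p, by rw [hdl, hp]⟩
    · rintro ⟨p, hp⟩
      rw [hdl] at hp
      have := hδa p
      rwa [hp] at this

lemma regExp_eq {h : ℕ} (hh : 2 * h = N * d) (g : SimpleGraph (Fin N) → ℝ) :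
    regExp N d g = (∑ τ ∈ univ.filter (fun τ : Fin h × Bool ≃ Fin N × Fin d => bad τ ≤ 0), g (gt τ)) /
      #(univ.filter (fun τ : Fin h × Bool ≃ Fin N × Fin d => bad τ ≤ 0)) := by
  classical
  set T := univ.filter (fun τ : Fin h × Bool ≃ Fin N × Fin d => bad τ ≤ 0) with hT
  have hmap : ∀ τ ∈ T, gt τ ∈ regFinset N d := by
    intro τ hτ
    simp only [hT, Finset.mem_filter, Finset.mem_univ, true_and, bad_iff] at hτ
    simp only [regFinset, Finset.mem_filter, Finset.mem_univ, true_and]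
    exact inF_reg (inF_gt hτ)
  have hfib : ∀ G ∈ regFinset N d, #(T.filter fun τ => gt τ = G) = Nat.card (KR (Fin h) N d) := by
    intro G hG
    simp only [regFinset, Finset.mem_filter, Finset.mem_univ, true_and] at hG
    obtain ⟨τ0, h0⟩ := fib_nonempty hh hG
    rw [← fib_card h0, Nat.card_eq_fintype_card, Fintype.card_subtype]
    congr 1
    ext τ
    simp only [hT, Finset.mem_filter, Finset.mem_univ, true_and, bad_iff]
    constructor
    · rintro ⟨h1, rfl⟩; exact inF_gt h1
    · intro h1; exact ⟨h1.1, inF_eq h1⟩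
  have hM : (0:ℝ) < Nat.card (KR (Fin h) N d) := by
    have : Nonempty (KR (Fin h) N d) := ⟨(⟨1, fun _ => rfl⟩, ⟨1, fun _ => rfl⟩)⟩
    exact_mod_cast Nat.card_pos
  have h1 : ∀ g : SimpleGraph (Fin N) → ℝ, ∑ τ ∈ T, g (gt τ) = Nat.card (KR (Fin h) N d) * ∑ G ∈ regFinset N d, g G := by
    intro g
    rw [← Finset.sum_fiberwise_of_maps_to hmap, Finset.mul_sum]
    refine Finset.sum_congr rfl fun G hG => ?_
    rw [← hfib G hG, ← nsmul_eq_mul, ← Finset.sum_const]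
    refine Finset.sum_congr rfl fun τ hτ => ?_
    rw [(Finset.mem_filter.1 hτ).2]
  have h2 : (#T : ℝ) = Nat.card (KR (Fin h) N d) * #(regFinset N d) := by
    have := h1 (fun _ => 1)
    simpa using this
  rw [h1, h2, regExp, mul_div_mul_left _ _ hM.ne']

end
end MC

open Finset MeasureTheory ProbabilityTheory
open scoped BigOperators
set_option linter.all false

namespace MC

section
variable {I : Type*} [Fintype I] [DecidableEq I] {N d : ℕ}

lemma cut_eq {τ : I × Bool ≃ Fin N × Fin d} (h : Function.Injective (dl τ)) (s : Finset (Fin N)) (σ : Fin N → Bool)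
    (hs : ∀ v, v ∈ s ↔ σ v = true) : cutCount (gt τ) s = cutN univ τ (fun c => σ c.1) := by
  classical
  have hF := inF_gt h
  have h1 : cutCount (gt τ) s = #(univ.filter fun p => vx τ p ∈ s ∧ vx τ (flp p) ∉ s) := by
    rw [← Fintype.card_subtype, ← Nat.card_eq_fintype_card, cutCount]
    symm
    refine Nat.card_eq_of_bijective (fun p => ⟨dl τ p.1, ?_⟩) ⟨?_, ?_⟩
    · exact ⟨p.2.1, p.2.2, (hF.2 _ _).2 ⟨p.1, rfl⟩⟩
    · intro p q hpq
      exact Subtype.ext (h (congrArg Subtype.val hpq))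
    · rintro ⟨⟨u, v⟩, h1, h2, h3⟩
      obtain ⟨p, hp⟩ := (hF.2 _ _).1 h3
      have hp' := hp
      simp only [dl, Prod.mk.injEq] at hp'
      refine ⟨⟨p, ?_, ?_⟩, Subtype.ext hp⟩
      · rw [hp'.1]; exact h1
      · rw [hp'.2]; exact h2
  rw [h1]
  unfold cutN
  apply Finset.card_bij (fun p _ => p.1)
  · rintro ⟨i, b⟩ hp
    simp only [Finset.mem_filter, Finset.mem_univ, true_and, hs, vx, flp] at hp ⊢
    cases b
    · intro hc; exact hp.2 (by simpa using hc ▸ hp.1)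
    · intro hc; exact hp.2 (by simpa using hc ▸ hp.1)
  · intro p hp q hq hpq
    simp only [Finset.mem_filter, Finset.mem_univ, true_and] at hp hq
    rcases eq_or_flp hpq with h | h
    · exact h
    · rw [h] at hp; exact absurd hp.1 hq.2
  · intro i hi
    simp only [Finset.mem_filter, Finset.mem_univ, true_and] at hi
    by_cases hb : σ (τ (i, false)).1 = true
    · refine ⟨(i, false), ?_, rfl⟩
      simp only [Finset.mem_filter, Finset.mem_univ, true_and, hs, vx, flp, Bool.not_false]
      exact ⟨hb, fun hc => hi (hb.trans hc.symm)⟩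
    · refine ⟨(i, true), ?_, rfl⟩
      simp only [Finset.mem_filter, Finset.mem_univ, true_and, hs, vx, flp, Bool.not_true]
      refine ⟨?_, hb⟩
      by_contra hc
      exact hi ((Bool.not_eq_true _ ▸ hb : σ (τ (i, false)).1 = false).trans (Bool.not_eq_true _ ▸ hc : σ (τ (i, true)).1 = false).symm)

lemma mcut_eq (α : ℚ) {τ : I × Bool ≃ Fin N × Fin d} (h : Function.Injective (dl τ)) :
    mcut α (gt τ) = mx (SC N d ⌊α * (N:ℚ)⌋₊) univ τ := by
  classical
  unfold mcut mx SC
  rw [Finset.sup_image]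
  apply le_antisymm
  · refine Finset.sup_le fun s hs => ?_
    rw [cut_eq h s (fun v => decide (v ∈ s)) (by simp)]
    refine Finset.le_sup (f := cutN univ τ ∘ fun (σ : Fin N → Bool) (c : Fin N × Fin d) => σ c.1) (b := fun v => decide (v ∈ s)) ?_
    simp only [SV, Finset.mem_filter, Finset.mem_univ, true_and, decide_eq_true_eq]
    rw [Finset.mem_powersetCard] at hs
    rw [← hs.2]; congr 1; ext; simp
  · refine Finset.sup_le fun σ hσ => ?_
    simp only [SV, Finset.mem_filter, Finset.mem_univ, true_and] at hσ
    have := cut_eq h (univ.filter fun v => σ v = true) σ (by simp)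
    simp only [Function.comp]
    rw [← this]
    exact Finset.le_sup (f := fun s => cutCount (gt τ) s) (Finset.mem_powersetCard.2 ⟨Finset.subset_univ _, hσ⟩)

end

lemma reg_conf_bound (α : ℚ) {N d : ℕ} (he : Even (N * d)) (hn : 2 + 3 * d + 2 * d * d + 2 * Bd d < N * d)
    (l : ℝ) (hl0 : 0 < l) (hl : l * 4 ≤ 1) :
    |regExp N d (fun G => (mcut α G : ℝ)) - confE N d ⌊α * (N:ℚ)⌋₊| ≤
      (Real.log (2 * ((((N * d : ℕ):ℝ)) ^ 2) ^ Bd d) + 16 * l^2 * (N * d : ℕ)) / l := by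
  classical
  have hh : 2 * (N * d / 2) = N * d := Nat.mul_div_cancel' he.two_dvd
  have hcard : Fintype.card (Fin (N * d / 2) × Bool) = N * d := by simp; omega
  have hc : Fintype.card (Fin (N * d / 2) × Bool) = Fintype.card (Fin N × Fin d) := by rw [hcard]; simp
  have hne : Nonempty (Fin (N * d / 2) × Bool ≃ Fin N × Fin d) := Fintype.card_eq.1 hc
  have hs := simple_prob (N := N) (d := d) (I := Fin (N * d / 2)) (by rw [hcard]; exact hn)
  rw [regExp_eq hh]
  set T := univ.filter (fun τ : Fin (N * d / 2) × Bool ≃ Fin N × Fin d => bad τ ≤ 0) with hT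
  have hTne : T.Nonempty := by
    rw [Finset.nonempty_iff_ne_empty]
    intro h0
    rw [h0] at hs
    have : 0 < Fintype.card (Fin (N * d / 2) × Bool ≃ Fin N × Fin d) := Fintype.card_pos
    simp at hs
  have hsum : ∑ τ ∈ T, ((mcut α (gt τ) : ℕ) : ℝ) = ∑ τ ∈ T, ((mx (SC N d ⌊α * (N:ℚ)⌋₊) univ τ : ℕ) : ℝ) := by
    refine Finset.sum_congr rfl fun τ hτ => ?_
    simp only [hT, Finset.mem_filter, Finset.mem_univ, true_and, bad_iff] at hτ
    rw [mcut_eq α hτ]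
  rw [hsum]
  have := cond_mean hc (SC N d ⌊α * (N:ℚ)⌋₊) T hTne (2 * ((((N * d : ℕ):ℝ)) ^ 2) ^ Bd d) (by
    rw [hcard] at hs
    have : ((Fintype.card (Fin (N * d / 2) × Bool ≃ Fin N × Fin d) : ℕ) : ℝ) ≤ ((2 * ((((N * d)) ^ 2) ^ Bd d * #T) : ℕ) : ℝ) := by exact_mod_cast hs
    refine this.trans (le_of_eq ?_)
    push_cast; ring) l hl0 hl
  rw [hcard] at this
  exact this

end MC

open Finset MeasureTheory ProbabilityTheory
open scoped BigOperators
set_option linter.all false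

namespace MC

lemma logterm (d : ℕ) (hd : 0 < d) (B : ℕ) :
    Filter.Tendsto (fun N : ℕ => Real.log (2 * ((((N * d : ℕ):ℝ)) ^ 2) ^ B) / N) Filter.atTop (nhds 0) := by
  have hd' : (0:ℝ) < d := by exact_mod_cast hd
  have h1 : Filter.Tendsto (fun N : ℕ => (N:ℝ) * d) Filter.atTop Filter.atTop :=
    Filter.Tendsto.atTop_mul_const hd' tendsto_natCast_atTop_atTop
  have h2 : Filter.Tendsto (fun x : ℝ => Real.log x / x) Filter.atTop (nhds 0) := by
    simpa using Real.isLittleO_log_id_atTop.tendsto_div_nhds_zero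
  have h3 := (h2.comp h1).const_mul (2 * B * d : ℝ)
  have h4 : Filter.Tendsto (fun N : ℕ => Real.log 2 / (N:ℝ)) Filter.atTop (nhds 0) :=
    tendsto_const_div_atTop_nhds_zero_nat _
  have h5 := h4.add h3
  rw [mul_zero, add_zero] at h5
  refine h5.congr' ?_
  filter_upwards [Filter.eventually_gt_atTop 0] with N hN
  have hN' : (0:ℝ) < N := by exact_mod_cast hN
  simp only [Function.comp]
  push_cast
  rw [Real.log_mul (x := 2) two_ne_zero (by positivity), Real.log_pow, Real.log_pow]
  field_simp
  push_cast; ring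

lemma reg_conf_lim (α : ℚ) (d : ℕ) (hd : 0 < d) :
    Filter.Tendsto (fun N : ℕ => (regExp N d (fun G => (mcut α G : ℝ)) - confE N d ⌊α * (N:ℚ)⌋₊) / N)
      (Filter.atTop ⊓ Filter.principal {N | alphaIntegral α N ∧ Even (N * d)}) (nhds 0) := by
  have hd' : (0:ℝ) < d := by exact_mod_cast hd
  rw [Metric.tendsto_nhds]
  intro ε hε
  obtain ⟨l, hl0, hl1, hl2⟩ : ∃ l : ℝ, 0 < l ∧ l * 4 ≤ 1 ∧ 16 * l * d ≤ ε / 2 := by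
    refine ⟨min (1/4) (ε / (32 * d)), by positivity, by linarith [min_le_left (1/4) (ε / (32 * d))], ?_⟩
    have := min_le_right (1/4) (ε / (32 * d))
    calc _ ≤ 16 * (ε / (32 * d)) * d := by gcongr
      _ = _ := by field_simp; norm_num
  have hlog := Metric.tendsto_nhds.1 (logterm d hd (Bd d)) (l * (ε / 2)) (by positivity)
  rw [Filter.eventually_inf_principal]
  filter_upwards [hlog, Filter.eventually_gt_atTop (2 + 3 * d + 2 * d * d + 2 * Bd d)] with N h1 h2 h3
  have hN : 0 < N := by omega
  have hN' : (0:ℝ) < N := by exact_mod_cast hN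
  have hb := reg_conf_bound α h3.2 (h2.trans_le (Nat.le_mul_of_pos_right N hd)) l hl0 hl1
  rw [Real.dist_eq, sub_zero] at h1 ⊢
  have h1 := (abs_lt.1 h1).2
  rw [div_lt_iff₀ hN'] at h1
  rw [abs_div, abs_of_pos hN', div_lt_iff₀ hN']
  refine hb.trans_lt ?_
  rw [div_lt_iff₀ hl0]
  push_cast at h1 ⊢
  have : 16 * l^2 * (N * d) ≤ (ε / 2) * N * l := by
    calc _ = (16 * l * d) * (N * l) := by ring
      _ ≤ (ε / 2) * (N * l) := by gcongr
      _ = _ := by ring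
  nlinarith

lemma adm_neBot (α : ℚ) (hα0 : 0 < α) (d : ℕ) :
    (Filter.atTop ⊓ Filter.principal {N : ℕ | alphaIntegral α N ∧ Even (N * d)}).NeBot := by
  rw [← Filter.frequently_mem_iff_neBot, Filter.frequently_atTop]
  intro a
  have hden : 0 < α.den := α.den_pos
  refine ⟨2 * α.den * (a + 1), ?_, ⟨(α.num.toNat) * (2 * (a + 1)), ?_⟩, ?_⟩
  · nlinarith
  · have h1 : α * α.den = α.num := Rat.mul_den_eq_num α
    have h2 : ((α.num.toNat : ℕ) : ℚ) = α.num := by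
      have : ((α.num.toNat : ℕ) : ℤ) = α.num := Int.toNat_of_nonneg (Rat.num_nonneg.2 hα0.le)
      exact_mod_cast this
    push_cast
    rw [h2, ← h1]; ring
  · exact ⟨α.den * (a+1) * d, by ring⟩

theorem main (α : ℚ) (hα0 : 0 < α) (hα : α < 1 / 2) :
    ∃ L : ℝ, ∃ g : ℕ → ℝ,
      (∀ d : ℕ, 0 < d →
        Filter.Tendsto (fun N : ℕ =>
            (regExp N d (fun G => (mcut α G : ℝ)) -
              (N : ℝ) * d * (α : ℝ) * (1 - (α : ℝ))) / (Real.sqrt d * N))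
          (Filter.atTop ⊓ Filter.principal {N | alphaIntegral α N ∧ Even (N * d)})
          (nhds (g d))) ∧
      Filter.Tendsto g Filter.atTop (nhds L) ∧
      Filter.Tendsto (fun N : ℕ => (1 / (4 * (N : ℝ))) * Emax N α (fun ω σ => H1 α ω σ))
        (Filter.atTop ⊓ Filter.principal {N | alphaIntegral α N}) (nhds L) := by
  have hl : ∀ d : ℕ, ∃ l : ℝ, 0 < d → Filter.Tendsto (fun N : ℕ => confE N d ⌊α * (N:ℚ)⌋₊ / N)
      (Filter.atTop ⊓ Filter.principal {N | alphaIntegral α N ∧ Even (N * d)}) (nhds l) := by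
    intro d
    rcases Nat.eq_zero_or_pos d with h | h
    · exact ⟨0, fun h' => by omega⟩
    · obtain ⟨l, hl⟩ := confE_lim α hα0 hα d h
      exact ⟨l, fun _ => hl⟩
  choose l hl using hl
  set g : ℕ → ℝ := fun d => (l d - d * α * (1 - α)) / Real.sqrt d with hg
  -- the configuration-model limit
  have hconf : ∀ d : ℕ, 0 < d → Filter.Tendsto (fun N : ℕ =>
            (confE N d ⌊α * (N:ℚ)⌋₊ -
              (N : ℝ) * d * (α : ℝ) * (1 - (α : ℝ))) / (Real.sqrt d * N))
          (Filter.atTop ⊓ Filter.principal {N | alphaIntegral α N ∧ Even (N * d)})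
          (nhds (g d)) := by
    intro d hd
    have hd' : (0:ℝ) < Real.sqrt d := Real.sqrt_pos.2 (by exact_mod_cast hd)
    refine (((hl d hd).sub_const (d * α * (1 - α) : ℝ)).div_const (Real.sqrt d)).congr' ?_
    refine Filter.Eventually.filter_mono inf_le_left ?_
    filter_upwards [Filter.eventually_gt_atTop 0] with N hN
    have hN' : (0:ℝ) < N := by exact_mod_cast hN
    field_simp
  have hreg : ∀ d : ℕ, 0 < d → Filter.Tendsto (fun N : ℕ =>
            (regExp N d (fun G => (mcut α G : ℝ)) -
              (N : ℝ) * d * (α : ℝ) * (1 - (α : ℝ))) / (Real.sqrt d * N))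
          (Filter.atTop ⊓ Filter.principal {N | alphaIntegral α N ∧ Even (N * d)})
          (nhds (g d)) := by
    intro d hd
    have hd' : (0:ℝ) < Real.sqrt d := Real.sqrt_pos.2 (by exact_mod_cast hd)
    have := (hconf d hd).add ((reg_conf_lim α d hd).div_const (Real.sqrt d))
    rw [zero_div, add_zero] at this
    refine this.congr' ?_
    refine Filter.Eventually.filter_mono inf_le_left ?_
    filter_upwards [Filter.eventually_gt_atTop 0] with N hN
    have hN' : (0:ℝ) < N := by exact_mod_cast hN
    field_simp
    ring
  set b : ℕ → ℝ := fun N => (1 / (4 * (N : ℝ))) * Emax N α (fun ω σ => H1 α ω σ) with hb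
  set F : Filter ℕ := Filter.atTop ⊓ Filter.principal {N | alphaIntegral α N} with hF
  have hFd : ∀ d, Filter.atTop ⊓ Filter.principal {N | alphaIntegral α N ∧ Even (N * d)} ≤ F := by
    intro d
    exact inf_le_inf_left _ (Filter.principal_mono.2 fun N h => h.1)
  have hFe : ∀ d, Even d → Filter.atTop ⊓ Filter.principal {N | alphaIntegral α N ∧ Even (N * d)} = F := by
    intro d hd
    have : {N | alphaIntegral α N ∧ Even (N * d)} = {N | alphaIntegral α N} := by
      ext N; simp [Nat.even_mul, hd]
    rw [this]
  have hclose : ∀ ε > 0, ∃ d0 : ℕ, ∀ d ≥ d0, 0 < d → ∀ᶠ N in Filter.atTop ⊓ Filter.principal {N | alphaIntegral α N ∧ Even (N * d)}, |g d - b N| ≤ ε := by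
    intro ε hε
    obtain ⟨d0, h0⟩ := partB α hα0 hα (ε / 2) (by positivity)
    refine ⟨d0, fun d hd hd0 => ?_⟩
    have h1 := Metric.tendsto_nhds.1 (hconf d hd0) (ε / 2) (by positivity)
    have h2 : ∀ᶠ N in Filter.atTop ⊓ Filter.principal {N | alphaIntegral α N ∧ Even (N * d)}, 0 < N ∧ alphaIntegral α N ∧ Even (N * d) := by
      rw [Filter.eventually_inf_principal]
      filter_upwards [Filter.eventually_gt_atTop 0] with N hN h
      exact ⟨hN, h⟩
    filter_upwards [h1, h2] with N h1 h2
    have h3 := h0 d hd N h2.1 h2.2.1 h2.2.2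
    rw [Real.dist_eq] at h1
    simp only [hb]
    rw [abs_le] at h3 ⊢
    rw [abs_lt] at h1
    constructor <;> linarith [h1.1, h1.2, h3.1, h3.2]
  have hNe : ∀ d, (Filter.atTop ⊓ Filter.principal {N : ℕ | alphaIntegral α N ∧ Even (N * d)}).NeBot := adm_neBot α hα0
  have hFne : F.NeBot := (hNe 0).mono (hFd 0)
  have hcau : Cauchy (Filter.map b F) := by
    rw [Metric.cauchy_iff]
    refine ⟨inferInstance, fun ε hε => ?_⟩
    obtain ⟨d0, h0⟩ := hclose (ε / 3) (by positivity)
    have h1 := h0 (2 * (d0 + 1)) (by omega) (by omega)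
    rw [hFe _ ⟨d0 + 1, by ring⟩] at h1
    refine ⟨{x | |g (2 * (d0 + 1)) - x| ≤ ε / 3}, h1, ?_⟩
    intro x hx y hy
    simp only [Set.mem_setOf_eq] at hx hy
    rw [Real.dist_eq, abs_lt]
    rw [abs_le] at hx hy
    constructor <;> linarith [hx.1, hx.2, hy.1, hy.2]
  obtain ⟨L, hL⟩ := cauchy_map_iff_exists_tendsto.1 hcau
  refine ⟨L, g, hreg, ?_, hL⟩
  rw [Metric.tendsto_atTop]
  intro ε hε
  obtain ⟨d0, h0⟩ := hclose (ε / 2) (by positivity)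
  refine ⟨d0 + 1, fun d hd => ?_⟩
  have h1 := h0 d (by omega) (by omega)
  have := hNe d
  have h2 : Filter.Tendsto (fun N => |g d - b N|) (Filter.atTop ⊓ Filter.principal {N | alphaIntegral α N ∧ Even (N * d)}) (nhds |g d - L|) :=
    ((hL.mono_left (hFd d)).const_sub (g d)).abs
  have h3 := le_of_tendsto h2 h1
  rw [Real.dist_eq]
  linarith

end MC

/-- Fix a rational `α ∈ (0,1/2)`.  The limits below exist and
`lim_{d→∞} lim_{N→∞} (E_{R(N,d)}[MCUT_α] − N d α(1−α))/(√d N)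
  = lim_{N→∞} (1/(4N)) E[max_{σ ∈ S_N(α)} H_1(σ)]`,
where `N` ranges over integers with `αN` an integer and `Nd` even. -/
theorem statement6 (α : ℚ) (hα0 : 0 < α) (hα : α < 1 / 2) :
    ∃ L : ℝ, ∃ g : ℕ → ℝ,
      (∀ d : ℕ, 0 < d →
        Filter.Tendsto (fun N : ℕ =>
            (regExp N d (fun G => (mcut α G : ℝ)) -
              (N : ℝ) * d * (α : ℝ) * (1 - (α : ℝ))) / (Real.sqrt d * N))
          (Filter.atTop ⊓ Filter.principal {N | alphaIntegral α N ∧ Even (N * d)})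
          (nhds (g d))) ∧
      Filter.Tendsto g Filter.atTop (nhds L) ∧
      Filter.Tendsto (fun N : ℕ => (1 / (4 * (N : ℝ))) * Emax N α (fun ω σ => H1 α ω σ))
        (Filter.atTop ⊓ Filter.principal {N | alphaIntegral α N}) (nhds L) := by
  exact MC.main α hα0 hα
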